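/- arXiv:2309.02353 — 3 statements merged into one kernel-verified Lean document; each statement's English description precedes it below -/
import Mathlib

section
/- There exist constants c > 0 and C > 0 such that the following holds (L^∞ almost-periodicity). For every finite abelian group G, every ε > 0, every integer k ≥ 1, every set S ⊆ G, and all nonempty sets A₁, A₂ ⊆ G with densities α₁ = |A₁|/|G| and α₂ = |A₂|/|G|, there is a nonempty set X ⊆ G with |X| ≥ c·exp(−C·ε^{−2}·k²·⌞α₁⌟·⌞α₂⌟)·|G| such that ‖μ_X^{(k)} ∗ (μ_{A₁} ∘ μ_{A₂}) ∗ 1_S − (μ_{A₁} ∘ μ_{A₂}) ∗ 1_S‖_∞ ≤ ε. -/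
open Finset

noncomputable section

/-- normalized indicator `μ_A = (|G|/|A|) 1_A`. -/
def mu {G : Type*} [Fintype G] [DecidableEq G] (A : Finset G) : G → ℝ :=
  fun x => if x ∈ A then (Fintype.card G : ℝ) / (A.card : ℝ) else 0

/-- indicator function of a finite set. -/
def indic {G : Type*} [DecidableEq G] (S : Finset G) : G → ℝ :=
  fun x => if x ∈ S then 1 else 0

/-- convolution with respect to normalized counting measure. -/
def conv {G : Type*} [Fintype G] [AddCommGroup G] (f g : G → ℝ) : G → ℝ :=
  fun x => (∑ y, f y * g (x - y)) / (Fintype.card G : ℝ)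

/-- difference convolution with respect to normalized counting measure. -/
def dconv {G : Type*} [Fintype G] [AddCommGroup G] (f g : G → ℝ) : G → ℝ :=
  fun x => (∑ y, f (x + y) * g y) / (Fintype.card G : ℝ)

/-- `convPow f k` is the `k`-fold convolution `f ∗ ⋯ ∗ f` (with `convPow f 0` the identity). -/
def convPow {G : Type*} [Fintype G] [AddCommGroup G] [DecidableEq G] (f : G → ℝ) : ℕ → G → ℝ
  | 0 => fun x => if x = 0 then (Fintype.card G : ℝ) else 0
  | n + 1 => conv f (convPow f n)

/-- `lo δ = log (2/δ)`. -/
def lo (δ : ℝ) : ℝ := Real.log (2 / δ)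

lemma ap_pow_le_cosh (m : ℕ) (y : ℝ) :
    y ^ (2 * m) ≤ (2 * (m:ℝ)) ^ (2 * m) * ((Real.exp y + Real.exp (-y)) / 2) := by
  have h := Real.hasSum_cosh y
  have h1 : y ^ (2 * m) / ((2 * m).factorial : ℝ) ≤ Real.cosh y := by
    refine le_hasSum h m ?_
    intro j _
    have : 0 ≤ y ^ (2 * j) := by rw [pow_mul]; positivity
    positivity
  have hf : (0:ℝ) < ((2 * m).factorial : ℝ) := by positivity
  rw [div_le_iff₀ hf, Real.cosh_eq] at h1
  have h2 : ((2 * m).factorial : ℝ) ≤ (2 * (m:ℝ)) ^ (2 * m) := by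
    exact_mod_cast Nat.factorial_le_pow (2 * m)
  calc _ ≤ _ := h1
    _ ≤ _ := by
      rw [mul_comm]
      gcongr

lemma ap_exp_convex (t g : ℝ) (hg : |g| ≤ 1) :
    Real.exp (t * g) ≤ Real.cosh t + g * Real.sinh t := by
  obtain ⟨h1, h2⟩ := abs_le.mp hg
  have := convexOn_exp.2 (Set.mem_univ t) (Set.mem_univ (-t))
    (show (0:ℝ) ≤ (1 + g) / 2 by linarith) (show (0:ℝ) ≤ (1 - g) / 2 by linarith) (by ring)
  simp only [smul_eq_mul] at this
  have e : (1 + g) / 2 * t + (1 - g) / 2 * -t = t * g := by ring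
  rw [e] at this
  rw [Real.cosh_eq, Real.sinh_eq]
  linarith

lemma ap_exp_sum {G : Type*} [DecidableEq G] (A : Finset G) (g : G → ℝ)
    (hg : ∀ a ∈ A, |g a| ≤ 1) (h0 : ∑ a ∈ A, g a = 0) (n : ℕ) (t : ℝ) :
    ∑ p ∈ Fintype.piFinset (fun _ : Fin n => A), Real.exp (t * ∑ i, g (p i)) ≤
      ((A.card : ℝ) * Real.exp (t ^ 2 / 2)) ^ n := by
  have h1 : ∑ p ∈ Fintype.piFinset (fun _ : Fin n => A), Real.exp (t * ∑ i, g (p i))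
      = (∑ a ∈ A, Real.exp (t * g a)) ^ n := by
    have := Finset.prod_univ_sum (fun _ : Fin n => A) (fun _ a => Real.exp (t * g a))
    simp only [Finset.prod_const, Finset.card_univ, Fintype.card_fin] at this
    rw [this]
    refine Finset.sum_congr rfl fun p _ => ?_
    rw [← Real.exp_sum, Finset.mul_sum]
  rw [h1]
  refine pow_le_pow_left₀ (Finset.sum_nonneg fun _ _ => (Real.exp_pos _).le) ?_ n
  calc ∑ a ∈ A, Real.exp (t * g a) ≤ ∑ a ∈ A, (Real.cosh t + g a * Real.sinh t) :=
        Finset.sum_le_sum fun a ha => ap_exp_convex t (g a) (hg a ha)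
    _ = A.card * Real.cosh t := by
        rw [Finset.sum_add_distrib, ← Finset.sum_mul, h0]; simp
    _ ≤ _ := by
        gcongr
        exact Real.cosh_le_exp_half_sq t

lemma ap_moment {G : Type*} [DecidableEq G] (A : Finset G) (g : G → ℝ)
    (hg : ∀ a ∈ A, |g a| ≤ 1) (h0 : ∑ a ∈ A, g a = 0) (n m : ℕ) (hn : 0 < n) (hm : 0 < m) :
    ∑ p ∈ Fintype.piFinset (fun _ : Fin n => A), (∑ i, g (p i)) ^ (2 * m) ≤
      (2 * m * n * Real.exp 1) ^ m * (A.card : ℝ) ^ n := by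
  have hn' : (0:ℝ) < n := by exact_mod_cast hn
  have hm' : (0:ℝ) < m := by exact_mod_cast hm
  set t : ℝ := Real.sqrt (2 * m / n) with ht
  have ht2 : t ^ 2 = 2 * m / n := Real.sq_sqrt (by positivity)
  have hA := ap_exp_sum A g hg h0 n t
  have hB := ap_exp_sum A g hg h0 n (-t)
  have hsum : ∑ p ∈ Fintype.piFinset (fun _ : Fin n => A), (t * ∑ i, g (p i)) ^ (2 * m) ≤
      (2 * (m:ℝ)) ^ (2 * m) * ((A.card : ℝ) * Real.exp (t ^ 2 / 2)) ^ n := by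
    calc _ ≤ ∑ p ∈ Fintype.piFinset (fun _ : Fin n => A), (2 * (m:ℝ)) ^ (2 * m) *
          ((Real.exp (t * ∑ i, g (p i)) + Real.exp (-(t * ∑ i, g (p i)))) / 2) :=
          Finset.sum_le_sum fun p _ => ap_pow_le_cosh m _
      _ ≤ _ := by
          rw [← Finset.mul_sum]
          gcongr
          rw [← Finset.sum_div, Finset.sum_add_distrib]
          simp only [neg_mul, neg_sq] at hB
          linarith
  simp only [mul_pow t] at hsum
  rw [← Finset.mul_sum, pow_mul t, ht2] at hsum
  have he : Real.exp (2 * m / n / 2) ^ n = Real.exp 1 ^ m := by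
    rw [← Real.exp_nat_mul, ← Real.exp_nat_mul]
    congr 1
    field_simp
  rw [mul_pow (A.card : ℝ), he] at hsum
  have hk : (2 * (m:ℝ)) ^ (2 * m) = (2 * m / n) ^ m * (2 * m * n) ^ m := by
    rw [← mul_pow, pow_mul]; congr 1; field_simp
  rw [hk] at hsum
  have hpos : (0:ℝ) < (2 * m / n) ^ m := by positivity
  refine le_of_mul_le_mul_left (hsum.trans_eq ?_) hpos
  rw [mul_pow _ (Real.exp 1)]
  ring

lemma ap_conv_assoc {G : Type*} [AddCommGroup G] [Fintype G] (f g h : G → ℝ) :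
    conv (conv f g) h = conv f (conv g h) := by
  funext x
  simp only [conv]
  congr 1
  have h1 : ∀ y, f y * ((∑ w, g w * h (x - y - w)) / (Fintype.card G : ℝ))
      = ∑ w, f y * g (w - y) * h (x - w) / (Fintype.card G : ℝ) := by
    intro y
    rw [← Equiv.sum_comp (Equiv.subRight y) (fun w => g w * h (x - y - w)), Finset.sum_div,
      Finset.mul_sum]
    refine Finset.sum_congr rfl fun w _ => ?_
    simp only [Equiv.subRight_apply]
    rw [show x - y - (w - y) = x - w by abel]
    ring
  simp only [h1]
  rw [Finset.sum_comm]
  refine Finset.sum_congr rfl fun w _ => ?_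
  rw [Finset.sum_div, Finset.sum_mul]
  refine Finset.sum_congr rfl fun y _ => ?_
  ring

lemma ap_conv_mu {G : Type*} [AddCommGroup G] [Fintype G] [DecidableEq G] (X : Finset G)
    (f : G → ℝ) (x : G) : conv (mu X) f x = (∑ y ∈ X, f (x - y)) / (X.card : ℝ) := by
  have hN : (Fintype.card G : ℝ) ≠ 0 := by exact_mod_cast Fintype.card_ne_zero
  simp only [conv, mu, ite_mul, zero_mul]
  rw [← Finset.sum_filter]
  simp only [Finset.filter_mem_eq_inter, Finset.univ_inter]
  rw [← Finset.mul_sum]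
  field_simp

lemma ap_convPow {G : Type*} [AddCommGroup G] [Fintype G] [DecidableEq G] (X : Finset G)
    (hX : X.Nonempty) (f : G → ℝ) (δ : ℝ) (h : ∀ y ∈ X, ∀ x, |f (x - y) - f x| ≤ δ) (k : ℕ) :
    ∀ x, |conv (convPow (mu X) k) f x - f x| ≤ k * δ := by
  have hN : (Fintype.card G : ℝ) ≠ 0 := by exact_mod_cast Fintype.card_ne_zero
  have hXc : (0:ℝ) < X.card := by exact_mod_cast hX.card_pos
  induction k with
  | zero =>
    intro x
    simp [convPow, conv, hN]
  | succ k ih =>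
    intro x
    rw [convPow, ap_conv_assoc, ap_conv_mu]
    have e : (∑ y ∈ X, conv (convPow (mu X) k) f (x - y)) / (X.card : ℝ) - f x
        = (∑ y ∈ X, ((conv (convPow (mu X) k) f (x - y) - f (x - y)) + (f (x - y) - f x)))
          / (X.card : ℝ) := by
      have : ∀ y, (conv (convPow (mu X) k) f (x - y) - f (x - y)) + (f (x - y) - f x)
        = conv (convPow (mu X) k) f (x - y) - f x := fun y => by ring
      simp only [this, Finset.sum_sub_distrib, Finset.sum_const, nsmul_eq_mul]
      field_simp
    rw [e, abs_div, abs_of_pos hXc, div_le_iff₀ hXc]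
    calc _ ≤ ∑ y ∈ X, |(conv (convPow (mu X) k) f (x - y) - f (x - y)) + (f (x - y) - f x)| :=
          Finset.abs_sum_le_sum_abs _ _
      _ ≤ ∑ y ∈ X, (k * δ + δ) := Finset.sum_le_sum fun y hy =>
          (abs_add_le _ _).trans (add_le_add (ih _) (h y hy x))
      _ = _ := by
          rw [Finset.sum_const, nsmul_eq_mul]; push_cast; ring

lemma ap_phi {G : Type*} [AddCommGroup G] [Fintype G] [DecidableEq G] (A B : Finset G)
    (f : G → ℝ) (x : G) :
    conv (dconv (mu A) (mu B)) f x
      = (∑ b ∈ B, (∑ a ∈ A, f (x + b - a)) / (A.card : ℝ)) / (B.card : ℝ) := by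
  have hN : (Fintype.card G : ℝ) ≠ 0 := by exact_mod_cast Fintype.card_ne_zero
  have h1 : ∀ b, (∑ a ∈ A, f (x + b - a)) / (A.card : ℝ) = conv (mu A) f (x + b) := fun b =>
    (ap_conv_mu A f (x + b)).symm
  have h2 : ∀ g : G → ℝ, (∑ b ∈ B, g b) / (B.card : ℝ)
      = (∑ b, mu B b * g b) / (Fintype.card G : ℝ) := by
    intro g
    simp only [mu, ite_mul, zero_mul]
    rw [← Finset.sum_filter]
    simp only [Finset.filter_mem_eq_inter, Finset.univ_inter]
    rw [← Finset.mul_sum]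
    field_simp
  simp only [h1]
  rw [h2]
  simp only [conv, dconv]
  congr 1
  have h3 : ∀ b, mu B b * ((∑ y, mu A y * f (x + b - y)) / (Fintype.card G : ℝ))
      = ∑ y, mu A (y + b) * mu B b * f (x - y) / (Fintype.card G : ℝ) := by
    intro b
    rw [← Equiv.sum_comp (Equiv.addRight b) (fun y => mu A y * f (x + b - y)), Finset.sum_div,
      Finset.mul_sum]
    refine Finset.sum_congr rfl fun w _ => ?_
    simp only [Equiv.coe_addRight]
    rw [show x + b - (w + b) = x - w by abel]
    ring
  simp only [h3]
  rw [Finset.sum_comm]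
  refine Finset.sum_congr rfl fun w _ => ?_
  rw [Finset.sum_div, Finset.sum_mul]
  refine Finset.sum_congr rfl fun y _ => ?_
  ring

/-- Sampling: at least half of the tuples in `A^n` are good. -/
lemma ap_good {G : Type*} [AddCommGroup G] [Fintype G] [DecidableEq G] (A : Finset G)
    (hA : A.Nonempty) (f F : G → ℝ) (hf : ∀ x, 0 ≤ f x ∧ f x ≤ 1)
    (hF : ∀ x, F x = (∑ a ∈ A, f (x - a)) / (A.card : ℝ)) (n m : ℕ) (hn : 0 < n) (hm : 0 < m) :
    (A.card : ℝ) ^ n / 2 ≤ (((Fintype.piFinset (fun _ : Fin n => A)).filter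
      (fun p => ∑ x, (∑ i, (f (x - p i) - F x)) ^ (2 * m) ≤
        2 * (2 * m * n * Real.exp 1) ^ m * Fintype.card G)).card : ℝ) := by
  have hc : (0:ℝ) < A.card := by exact_mod_cast hA.card_pos
  have hN : (0:ℝ) < Fintype.card G := by exact_mod_cast Fintype.card_pos
  have hn' : (0:ℝ) < n := by exact_mod_cast hn
  have hm' : (0:ℝ) < m := by exact_mod_cast hm
  have hF01 : ∀ x, 0 ≤ F x ∧ F x ≤ 1 := by
    intro x
    rw [hF]
    refine ⟨div_nonneg (Finset.sum_nonneg fun a _ => (hf _).1) hc.le, ?_⟩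
    rw [div_le_one hc]
    calc _ ≤ ∑ a ∈ A, (1:ℝ) := Finset.sum_le_sum fun a _ => (hf _).2
      _ = _ := by simp
  set K : ℝ := (2 * m * n * Real.exp 1) ^ m with hK
  have hKpos : 0 < K := by positivity
  set P := Fintype.piFinset (fun _ : Fin n => A) with hP
  have hPc : (P.card : ℝ) = (A.card : ℝ) ^ n := by
    simp [hP]
  set W : (Fin n → G) → ℝ := fun p => ∑ x, (∑ i, (f (x - p i) - F x)) ^ (2 * m) with hW
  have hW0 : ∀ p, 0 ≤ W p := fun p => Finset.sum_nonneg fun x _ => by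
    rw [pow_mul]; positivity
  have htot : ∑ p ∈ P, W p ≤ K * (A.card : ℝ) ^ n * Fintype.card G := by
    rw [hW, Finset.sum_comm]
    calc _ ≤ ∑ x : G, K * (A.card : ℝ) ^ n := by
          refine Finset.sum_le_sum fun x _ => ?_
          refine ap_moment A (fun a => f (x - a) - F x) ?_ ?_ n m hn hm
          · intro a _
            rw [abs_le]
            constructor <;> linarith [hf (x - a), hF01 x, (hf (x - a)).1, (hf (x - a)).2,
              (hF01 x).1, (hF01 x).2]
          · rw [Finset.sum_sub_distrib, Finset.sum_const, nsmul_eq_mul, hF]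
            field_simp
            ring
      _ = _ := by simp; ring
  set M : ℝ := 2 * K * Fintype.card G with hM
  have hMpos : 0 < M := by positivity
  have hbad : ((P.filter (fun p => ¬ W p ≤ M)).card : ℝ) * M ≤ ∑ p ∈ P, W p := by
    calc _ = ∑ p ∈ P.filter (fun p => ¬ W p ≤ M), M := by simp
      _ ≤ ∑ p ∈ P.filter (fun p => ¬ W p ≤ M), W p := Finset.sum_le_sum fun p hp => by
          exact (not_le.mp (Finset.mem_filter.mp hp).2).le
      _ ≤ _ := Finset.sum_le_sum_of_subset_of_nonneg (Finset.filter_subset _ _)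
          fun p _ _ => hW0 p
  have hsplit : ((P.filter (fun p => W p ≤ M)).card : ℝ)
      + ((P.filter (fun p => ¬ W p ≤ M)).card : ℝ) = (A.card : ℝ) ^ n := by
    rw [← hPc]
    exact_mod_cast Finset.card_filter_add_card_filter_not (s := P) (fun p => W p ≤ M)
  have hb2 : ((P.filter (fun p => ¬ W p ≤ M)).card : ℝ) ≤ (A.card : ℝ) ^ n / 2 := by
    refine le_of_mul_le_mul_right (hbad.trans (htot.trans_eq ?_)) hMpos
    rw [hM]; ring
  linarith

/-- Pigeonhole: many common translates. -/
lemma ap_pigeon {G : Type*} [AddCommGroup G] [Fintype G] [DecidableEq G] (n : ℕ)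
    (L : Finset (Fin n → G)) :
    ∃ z : Fin n → G, (L.card : ℝ) * Fintype.card G ≤
      ((Finset.univ.filter (fun t : G => (fun i => z i + t) ∈ L)).card : ℝ) *
        (Fintype.card G : ℝ) ^ n := by
  by_contra! hcon
  have h1 : ∑ z : Fin n → G, ((Finset.univ.filter (fun t : G => (fun i => z i + t) ∈ L)).card : ℝ)
      = (L.card : ℝ) * Fintype.card G := by
    simp only [Finset.card_filter, Nat.cast_sum]
    rw [Finset.sum_comm]
    have : ∀ t : G, ∑ z : Fin n → G, (((if (fun i => z i + t) ∈ L then 1 else 0 : ℕ)) : ℝ)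
        = L.card := by
      intro t
      have := Equiv.sum_comp (Equiv.addRight (fun _ : Fin n => t))
        (fun z => (((if z ∈ L then 1 else 0 : ℕ)) : ℝ))
      rw [show (L.card : ℝ) = ∑ z, (((if z ∈ L then 1 else 0 : ℕ)) : ℝ) by simp, ← this]
      rfl
    simp only [this]
    simp [mul_comm]
  have h2 : ∑ z : Fin n → G, ((Finset.univ.filter (fun t : G => (fun i => z i + t) ∈ L)).card : ℝ)
      * (Fintype.card G : ℝ) ^ n < ∑ z : Fin n → G, (L.card : ℝ) * Fintype.card G :=
    Finset.sum_lt_sum_of_nonempty Finset.univ_nonempty fun z _ => hcon z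
  rw [← Finset.sum_mul, h1] at h2
  simp at h2
  linarith

lemma ap_core {G : Type*} [AddCommGroup G] [Fintype G] [DecidableEq G] (A B : Finset G)
    (hA : A.Nonempty) (hB : B.Nonempty) (f : G → ℝ) (hf : ∀ x, 0 ≤ f x ∧ f x ≤ 1)
    (n m : ℕ) (hn : 0 < n) (hm : 0 < m) (η : ℝ) (hη : 0 < η)
    (hsmall : 2 * (2 * m * n * Real.exp 1) ^ m * Fintype.card G ≤ (n * η) ^ (2 * m) * B.card) :
    ∃ X : Finset G, X.Nonempty ∧
      ((A.card : ℝ) / Fintype.card G) ^ n / 2 * Fintype.card G ≤ (X.card : ℝ) ∧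
      ∀ y ∈ X, ∀ x, |conv (dconv (mu A) (mu B)) f (x - y) - conv (dconv (mu A) (mu B)) f x|
        ≤ 2 * η := by
  have hc : (0:ℝ) < A.card := by exact_mod_cast hA.card_pos
  have hb : (0:ℝ) < B.card := by exact_mod_cast hB.card_pos
  have hN : (0:ℝ) < Fintype.card G := by exact_mod_cast Fintype.card_pos
  have hn' : (0:ℝ) < n := by exact_mod_cast hn
  set F : G → ℝ := fun x => (∑ a ∈ A, f (x - a)) / (A.card : ℝ) with hF
  set Φ := conv (dconv (mu A) (mu B)) f with hΦ
  have hΦF : ∀ x, Φ x = (∑ b ∈ B, F (x + b)) / (B.card : ℝ) := fun x => ap_phi A B f x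
  have hgood := ap_good A hA f F hf (fun x => rfl) n m hn hm
  set L := (Fintype.piFinset (fun _ : Fin n => A)).filter
      (fun p => ∑ x, (∑ i, (f (x - p i) - F x)) ^ (2 * m) ≤
        2 * (2 * m * n * Real.exp 1) ^ m * Fintype.card G) with hL
  obtain ⟨z, hz⟩ := ap_pigeon n L
  set T := Finset.univ.filter (fun t : G => (fun i => z i + t) ∈ L) with hT
  have hTc : ((A.card : ℝ) / Fintype.card G) ^ n / 2 * Fintype.card G ≤ (T.card : ℝ) := by
    rw [div_pow, div_div, mul_comm _ (2:ℝ), ← div_div, div_mul_eq_mul_div,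
      div_le_iff₀ (by positivity)]
    exact (mul_le_mul_of_nonneg_right hgood hN.le).trans hz
  have hTpos : (0:ℝ) < T.card := lt_of_lt_of_le (by positivity) hTc
  have hTne : T.Nonempty := by
    rw [← Finset.card_pos]; exact_mod_cast hTpos
  have key : ∀ t ∈ T, ∀ x, |(∑ b ∈ B, (∑ i, f (x + b - z i)) / n) / (B.card : ℝ) - Φ (x + t)|
      ≤ η := by
    intro t ht x
    have h1 := (Finset.mem_filter.mp (Finset.mem_filter.mp ht).2).2
    rw [← Equiv.sum_comp (Equiv.addRight t)] at h1
    simp only [Equiv.coe_addRight] at h1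
    set D : G → ℝ := fun w => ∑ i, (f (w - z i) - F (w + t)) with hD
    have h2 : ∑ w, D w ^ (2 * m) ≤ (n * η) ^ (2 * m) * B.card := by
      refine le_trans (le_of_eq ?_) (h1.trans hsmall)
      refine Finset.sum_congr rfl fun w _ => ?_
      simp only [hD]
      congr 1
      refine Finset.sum_congr rfl fun i _ => ?_
      rw [show w + t - (z i + t) = w - z i by abel]
    have h3 : ∑ b ∈ B, D (x + b) ^ (2 * m) ≤ ∑ w, D w ^ (2 * m) := by
      rw [← Equiv.sum_comp (Equiv.addLeft x) (fun w => D w ^ (2 * m))]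
      refine Finset.sum_le_sum_of_subset_of_nonneg (Finset.subset_univ B) fun w _ _ => ?_
      rw [pow_mul]; positivity
    have h4 : ((∑ b ∈ B, D (x + b)) / (B.card : ℝ)) ^ (2 * m)
        ≤ (∑ b ∈ B, D (x + b) ^ (2 * m)) / (B.card : ℝ) := by
      have := Real.pow_arith_mean_le_arith_mean_pow_of_even B (fun _ => (B.card : ℝ)⁻¹)
        (fun b => D (x + b)) (fun _ _ => by positivity)
        (by rw [Finset.sum_const, nsmul_eq_mul]; field_simp) (even_two_mul m)
      rw [← Finset.mul_sum, ← Finset.mul_sum] at this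
      rw [div_eq_inv_mul, div_eq_inv_mul]
      exact this
    have h5 : ((∑ b ∈ B, D (x + b)) / (B.card : ℝ)) ^ (2 * m) ≤ (n * η) ^ (2 * m) := by
      refine h4.trans ?_
      rw [div_le_iff₀ hb]
      exact h3.trans h2
    have h6 : |(∑ b ∈ B, D (x + b)) / (B.card : ℝ)| ≤ n * η := by
      rw [← Even.pow_abs (even_two_mul m)] at h5
      exact le_of_pow_le_pow_left₀ (by omega) (by positivity) h5
    have e : (∑ b ∈ B, (∑ i, f (x + b - z i)) / n) / (B.card : ℝ) - Φ (x + t)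
        = ((∑ b ∈ B, D (x + b)) / (B.card : ℝ)) / n := by
      rw [hΦF, ← sub_div, ← Finset.sum_sub_distrib, 
        div_right_comm (∑ b ∈ B, D (x + b)), Finset.sum_div B (fun b => D (x + b))]
      congr 1
      refine Finset.sum_congr rfl fun b _ => ?_
      simp only [hD, Finset.sum_sub_distrib, Finset.sum_const, nsmul_eq_mul, Finset.card_univ,
        Fintype.card_fin]
      rw [show x + t + b = x + b + t by abel]
      field_simp
    rw [e, abs_div, abs_of_pos hn', div_le_iff₀ hn']
    linarith
  obtain ⟨t0, ht0⟩ := hTne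
  refine ⟨T.image (fun t => t0 - t), ⟨t0 - t0, Finset.mem_image_of_mem _ ht0⟩, ?_, ?_⟩
  · rw [Finset.card_image_of_injective _ (sub_right_injective)]
    exact hTc
  · intro y hy x
    obtain ⟨t, ht, rfl⟩ := Finset.mem_image.mp hy
    have k1 := key t ht (x - t0)
    have k2 := key t0 ht0 (x - t0)
    rw [show x - t0 + t = x - (t0 - t) by abel] at k1
    rw [sub_add_cancel] at k2
    rw [abs_le] at k1 k2 ⊢
    constructor <;> linarith [k1.1, k1.2, k2.1, k2.2]

/-- **Theorem (L^∞ almost-periodicity)**: there are constants `c, C > 0` such that for every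
finite abelian group `G`, `ε > 0`, `k ≥ 1`, `S ⊆ G` and nonempty `A₁, A₂ ⊆ G` of densities
`α₁, α₂`, there is a nonempty `X ⊆ G` with
`|X| ≥ c exp(-C ε⁻² k² ⌞α₁⌟ ⌞α₂⌟) |G|` such that
`‖μ_X^{(k)} ∗ μ_{A₁} ∘ μ_{A₂} ∗ 1_S − μ_{A₁} ∘ μ_{A₂} ∗ 1_S‖_∞ ≤ ε`. -/
theorem linfty_almost_periodicity :
    ∃ c C : ℝ, 0 < c ∧ 0 < C ∧
      ∀ (G : Type) [AddCommGroup G] [Fintype G] [DecidableEq G],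
        ∀ ε : ℝ, 0 < ε → ∀ k : ℕ, 1 ≤ k →
          ∀ (S A₁ A₂ : Finset G), A₁.Nonempty → A₂.Nonempty →
            ∀ α₁ α₂ : ℝ, α₁ = (A₁.card : ℝ) / Fintype.card G →
              α₂ = (A₂.card : ℝ) / Fintype.card G →
              ∃ X : Finset G, X.Nonempty ∧
                c * Real.exp (-C * ε⁻¹ ^ 2 * k ^ 2 * lo α₁ * lo α₂) * Fintype.card G ≤
                  (X.card : ℝ) ∧
                ‖conv (convPow (mu X) k) (conv (dconv (mu A₁) (mu A₂)) (indic S)) -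
                    conv (dconv (mu A₁) (mu A₂)) (indic S)‖ ≤ ε := by
  refine ⟨1 / 2, 200, by norm_num, by norm_num, ?_⟩
  intro G _ _ _ ε hε k hk S A₁ A₂ hA hB α₁ α₂ hα₁ hα₂
  have hc : (0:ℝ) < A₁.card := by exact_mod_cast hA.card_pos
  have hb : (0:ℝ) < A₂.card := by exact_mod_cast hB.card_pos
  have hN : (0:ℝ) < Fintype.card G := by exact_mod_cast Fintype.card_pos
  have hk1 : (1:ℝ) ≤ k := by exact_mod_cast hk
  have hk0 : (0:ℝ) < k := by linarith
  have ha0 : 0 < α₁ := by rw [hα₁]; positivity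
  have hb0 : 0 < α₂ := by rw [hα₂]; positivity
  have ha1 : α₁ ≤ 1 := by
    rw [hα₁, div_le_one hN]; exact_mod_cast Finset.card_le_univ A₁
  have hb1 : α₂ ≤ 1 := by
    rw [hα₂, div_le_one hN]; exact_mod_cast Finset.card_le_univ A₂
  have hlog2 : (1:ℝ) / 2 ≤ Real.log 2 := by linarith [Real.log_two_gt_d9]
  have hlo : ∀ α : ℝ, 0 < α → α ≤ 1 → 1 / 2 ≤ lo α := by
    intro α h0 h1
    refine hlog2.trans ?_
    rw [lo]
    refine Real.log_le_log (by norm_num) ?_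
    rw [le_div_iff₀ h0]; linarith
  have hl1 := hlo α₁ ha0 ha1
  have hl2 := hlo α₂ hb0 hb1
  have hind : ∀ x, 0 ≤ indic S x ∧ indic S x ≤ 1 := by
    intro x; rw [indic]; split_ifs <;> norm_num
  -- it suffices to bound each coordinate
  rcases le_or_gt 1 ε with h1ε | h1ε
  · -- trivial case
    refine ⟨Finset.univ, Finset.univ_nonempty, ?_, ?_⟩
    · rw [Finset.card_univ]
      have : Real.exp (-200 * ε⁻¹ ^ 2 * k ^ 2 * lo α₁ * lo α₂) ≤ 1 := by
        rw [Real.exp_le_one_iff]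
        have : 0 ≤ 200 * ε⁻¹ ^ 2 * k ^ 2 * lo α₁ * lo α₂ := by positivity
        linarith
      nlinarith
    · set Φ := conv (dconv (mu A₁) (mu A₂)) (indic S) with hΦ
      have hr : ∀ x, 0 ≤ Φ x ∧ Φ x ≤ 1 := by
        intro x
        rw [hΦ, ap_phi]
        have hin : ∀ b, 0 ≤ (∑ a ∈ A₁, indic S (x + b - a)) / (A₁.card : ℝ) ∧
            (∑ a ∈ A₁, indic S (x + b - a)) / (A₁.card : ℝ) ≤ 1 := by
          intro b
          refine ⟨div_nonneg (Finset.sum_nonneg fun a _ => (hind _).1) hc.le, ?_⟩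
          rw [div_le_one hc]
          calc _ ≤ ∑ a ∈ A₁, (1:ℝ) := Finset.sum_le_sum fun a _ => (hind _).2
            _ = _ := by simp
        refine ⟨div_nonneg (Finset.sum_nonneg fun a _ => (hin _).1) hb.le, ?_⟩
        rw [div_le_one hb]
        calc _ ≤ ∑ a ∈ A₂, (1:ℝ) := Finset.sum_le_sum fun a _ => (hin _).2
          _ = _ := by simp
      -- convolving with a probability measure keeps values in the unit interval
      have hr2 : ∀ j x, 0 ≤ conv (convPow (mu (Finset.univ : Finset G)) j) Φ x ∧
          conv (convPow (mu (Finset.univ : Finset G)) j) Φ x ≤ 1 := by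
        intro j
        induction j with
        | zero =>
          intro x
          have : conv (convPow (mu (Finset.univ : Finset G)) 0) Φ x = Φ x := by
            simp [convPow, conv, hN.ne']
          rw [this]; exact hr x
        | succ j ih =>
          intro x
          rw [convPow, ap_conv_assoc, ap_conv_mu]
          refine ⟨div_nonneg (Finset.sum_nonneg fun a _ => (ih _).1) (by positivity), ?_⟩
          rw [Finset.card_univ, div_le_one hN]
          calc _ ≤ ∑ a : G, (1:ℝ) := Finset.sum_le_sum fun a _ => (ih _).2
            _ = _ := by simp
      rw [pi_norm_le_iff_of_nonneg hε.le]
      intro x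
      rw [Pi.sub_apply, Real.norm_eq_abs, abs_le]
      constructor <;> linarith [(hr x).1, (hr x).2, (hr2 k x).1, (hr2 k x).2]
  · -- main case
    obtain ⟨m, hm⟩ : ∃ m : ℕ, m = ⌈lo α₂⌉₊ := ⟨_, rfl⟩
    have hm1 : lo α₂ ≤ m := by rw [hm]; exact Nat.le_ceil _
    have hm2 : (m:ℝ) ≤ 3 * lo α₂ := by
      have := (Nat.ceil_lt_add_one (a := lo α₂) (by linarith)).le
      rw [hm]; linarith
    have hmpos : 0 < m := by rw [hm]; exact Nat.ceil_pos.mpr (by linarith)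
    have hm' : (1:ℝ) ≤ m := by exact_mod_cast hmpos
    set q : ℝ := m * k ^ 2 * ε⁻¹ ^ 2 with hq
    have hei : 1 ≤ ε⁻¹ := (one_le_inv₀ hε).mpr h1ε.le
    have hq1 : 1 ≤ q := by
      have h1 : (1:ℝ) ≤ (k:ℝ) ^ 2 := one_le_pow₀ hk1
      have h2 : (1:ℝ) ≤ ε⁻¹ ^ 2 := one_le_pow₀ hei
      have h3 : (1:ℝ) ≤ m * k ^ 2 := one_le_mul_of_one_le_of_one_le hm' h1
      exact one_le_mul_of_one_le_of_one_le h3 h2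
    obtain ⟨n, hn⟩ : ∃ n : ℕ, n = ⌈64 * q⌉₊ := ⟨_, rfl⟩
    have hn1 : 64 * q ≤ n := by rw [hn]; exact Nat.le_ceil _
    have hn2 : (n:ℝ) ≤ 65 * q := by
      have := (Nat.ceil_lt_add_one (a := 64 * q) (by linarith)).le
      rw [hn]; linarith
    have hnr : (0:ℝ) < n := by linarith
    have hnpos : 0 < n := by exact_mod_cast hnr
    have hη : 0 < ε / (2 * k) := by positivity
    obtain ⟨X, hX, hXc, hXp⟩ := ap_core A₁ A₂ hA hB (indic S) hind n m hnpos hmpos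
      (ε / (2 * k)) hη (by
        have e1 : 2 / α₂ ≤ Real.exp 1 ^ m := by
          rw [← Real.exp_nat_mul, mul_one, ← Real.log_le_iff_le_exp (by positivity)]
          exact hm1
        have e2 : 2 * (Fintype.card G : ℝ) = 2 / α₂ * A₂.card := by
          rw [hα₂]; field_simp
        have e3 : 2 * m * n * Real.exp 1 * Real.exp 1 ≤ (n * (ε / (2 * k))) ^ 2 := by
          have hexp : Real.exp 1 * Real.exp 1 ≤ 8 := by
            nlinarith [Real.exp_one_lt_d9, Real.exp_pos 1]
          have h4 : (n * (ε / (2 * k))) ^ 2 = n * (n * (ε ^ 2 / (4 * k ^ 2))) := by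
            ring
          have h5 : 64 * q * (ε ^ 2 / (4 * k ^ 2)) = 16 * m := by
            rw [hq]; field_simp; norm_num
          have h6 : 16 * (m:ℝ) ≤ n * (ε ^ 2 / (4 * k ^ 2)) := by
            rw [← h5]; gcongr
          rw [h4]
          calc 2 * m * n * Real.exp 1 * Real.exp 1 = 2 * m * n * (Real.exp 1 * Real.exp 1) := by
                ring
            _ ≤ 2 * m * n * 8 := by gcongr
            _ = n * (16 * m) := by ring
            _ ≤ _ := by gcongr
        calc 2 * (2 * m * n * Real.exp 1) ^ m * (Fintype.card G : ℝ)
            = (2 * m * n * Real.exp 1) ^ m * (2 * (Fintype.card G : ℝ)) := by ring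
          _ = (2 * m * n * Real.exp 1) ^ m * (2 / α₂ * A₂.card) := by rw [e2]
          _ ≤ (2 * m * n * Real.exp 1) ^ m * (Real.exp 1 ^ m * A₂.card) := by gcongr
          _ = (2 * m * n * Real.exp 1 * Real.exp 1) ^ m * A₂.card := by
              rw [mul_pow _ (Real.exp 1) m]; ring
          _ ≤ ((n * (ε / (2 * k))) ^ 2) ^ m * A₂.card := by gcongr
          _ = _ := by rw [← pow_mul])
    refine ⟨X, hX, le_trans ?_ hXc, ?_⟩
    · rw [← hα₁]
      have h7 : Real.exp (-200 * ε⁻¹ ^ 2 * k ^ 2 * lo α₁ * lo α₂) ≤ α₁ ^ n := by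
        rw [← Real.exp_log (pow_pos ha0 n), Real.exp_le_exp, Real.log_pow]
        have h8 : -Real.log α₁ ≤ lo α₁ := by
          rw [lo, Real.log_div (by norm_num) ha0.ne']
          linarith
        have h9 : (n:ℝ) * -Real.log α₁ ≤ 200 * ε⁻¹ ^ 2 * k ^ 2 * lo α₁ * lo α₂ := by
          calc (n:ℝ) * -Real.log α₁ ≤ n * lo α₁ := by gcongr
            _ ≤ (65 * q) * lo α₁ := by gcongr
            _ = 65 * ε⁻¹ ^ 2 * k ^ 2 * lo α₁ * m := by rw [hq]; ring
            _ ≤ 65 * ε⁻¹ ^ 2 * k ^ 2 * lo α₁ * (3 * lo α₂) := by gcongr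
            _ = 195 * (ε⁻¹ ^ 2 * k ^ 2 * lo α₁ * lo α₂) := by ring
            _ ≤ 200 * (ε⁻¹ ^ 2 * k ^ 2 * lo α₁ * lo α₂) := by
                gcongr; norm_num
            _ = _ := by ring
        linarith
      have : 1 / 2 * Real.exp (-200 * ε⁻¹ ^ 2 * k ^ 2 * lo α₁ * lo α₂) ≤ α₁ ^ n / 2 := by
        linarith
      exact mul_le_mul_of_nonneg_right this hN.le
    · rw [pi_norm_le_iff_of_nonneg hε.le]
      intro x
      rw [Pi.sub_apply, Real.norm_eq_abs]
      refine (ap_convPow X hX _ _ hXp k x).trans_eq ?_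
      field_simp
end
end

section
/- For every ε ∈ (0, 1/8) there is a constant C = C(ε) > 0 such that the following holds. Let q be a prime, n a positive integer, and let S ⊆ 𝔽_q^n and nonempty A, A₁, A₂ ⊆ 𝔽_q^n have densities α, α₁, α₂ respectively (for A, A₁, A₂), and suppose that (1) ⟨μ_{A₁} ∘ μ_{A₂}, 1_S⟩ ≥ 1 − ε, and (2) μ_A ∘ μ_A(x) ≥ 1 + 4ε for every x ∈ S. Then there exists a linear subspace V ≤ 𝔽_q^n of codimension at most C·⌞α⌟²·⌞α₁⌟·⌞α₂⌟ such that ‖μ_V ∗ μ_A‖_∞ ≥ 1 + ε/2. -/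
open Finset

noncomputable section

/-- normalized inner product (for real-valued functions). -/
def nip {G : Type*} [Fintype G] (f g : G → ℝ) : ℝ :=
  (∑ x, f x * g x) / (Fintype.card G : ℝ)

/-- A linear subspace of `𝔽_q^n`, as a finset. -/
def submoduleFinset {q n : ℕ} [Fact q.Prime] (W : Submodule (ZMod q) (Fin n → ZMod q)) :
    Finset (Fin n → ZMod q) :=
  letI := Classical.decPred (fun x : Fin n → ZMod q => x ∈ W)
  Finset.univ.filter (fun x => x ∈ W)

/-! ### Exponential moments -/

lemma exp_mul_le_cosh_sinh (t y : ℝ) (hy : |y| ≤ 1) :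
    Real.exp (t * y) ≤ Real.cosh t + y * Real.sinh t := by
  obtain ⟨h1, h2⟩ := abs_le.mp hy
  have h := convexOn_exp.2 (Set.mem_univ t) (Set.mem_univ (-t))
    (show 0 ≤ (1 + y) / 2 by linarith) (show 0 ≤ (1 - y) / 2 by linarith) (by ring)
  simp only [smul_eq_mul] at h
  have e : (1 + y) / 2 * t + (1 - y) / 2 * -t = t * y := by ring
  rw [e] at h
  rw [Real.cosh_eq, Real.sinh_eq]
  linarith

lemma mgf_bound {ι : Type*} (X : Finset ι) (f : ι → ℝ) (hf : ∀ a ∈ X, |f a| ≤ 1)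
    (h0 : ∑ a ∈ X, f a = 0) (t : ℝ) :
    ∑ a ∈ X, Real.exp (t * f a) ≤ X.card * Real.exp (t ^ 2 / 2) := by
  calc ∑ a ∈ X, Real.exp (t * f a) ≤ ∑ a ∈ X, (Real.cosh t + f a * Real.sinh t) :=
        Finset.sum_le_sum fun a ha => exp_mul_le_cosh_sinh t _ (hf a ha)
    _ = X.card * Real.cosh t := by
        rw [Finset.sum_add_distrib, ← Finset.sum_mul, h0]; simp
    _ ≤ _ := by gcongr; exact Real.cosh_le_exp_half_sq t

lemma jensen_exp {ι : Type*} (X : Finset ι) (hX : X.Nonempty) (f : ι → ℝ) :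
    X.card * Real.exp ((∑ a ∈ X, f a) / X.card) ≤ ∑ a ∈ X, Real.exp (f a) := by
  have hc : (0 : ℝ) < X.card := by exact_mod_cast hX.card_pos
  have h := convexOn_exp.map_sum_le (t := X) (w := fun _ => (X.card : ℝ)⁻¹) (p := f)
    (fun _ _ => by positivity) (by simp [hc.ne']) (fun _ _ => Set.mem_univ _)
  simp only [smul_eq_mul, ← Finset.mul_sum] at h
  rw [div_eq_inv_mul]
  calc _ ≤ (X.card : ℝ) * ((X.card : ℝ)⁻¹ * ∑ a ∈ X, Real.exp (f a)) := by gcongr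
    _ = _ := by field_simp

/-! ### Characters and Chang's lemma -/

section chang
variable {q n : ℕ} [Fact q.Prime]

/-- the character `x ↦ e(r·x / q)`. -/
def chr (r x : Fin n → ZMod q) : ℂ := ZMod.stdAddChar (r ⬝ᵥ x)

/-- Fourier coefficient of the uniform measure on `T`. -/
def hat (T : Finset (Fin n → ZMod q)) (r : Fin n → ZMod q) : ℂ := (∑ t ∈ T, chr r t) / T.card

lemma chr_add (r x y : Fin n → ZMod q) : chr r (x + y) = chr r x * chr r y := by
  simp [chr, dotProduct_add, AddChar.map_add_eq_mul]

lemma chr_neg (r x : Fin n → ZMod q) : chr r (-x) = (starRingEnd ℂ) (chr r x) := by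
  simp only [chr, dotProduct_neg, AddChar.map_neg_eq_conj]

lemma chr_sub (r x y : Fin n → ZMod q) :
    chr r (x - y) = chr r x * (starRingEnd ℂ) (chr r y) := by
  rw [sub_eq_add_neg, chr_add, chr_neg]

lemma norm_chr (r x : Fin n → ZMod q) : ‖chr r x‖ = 1 := by
  simp [chr, AddChar.norm_apply]

lemma sum_std : ∑ u : ZMod q, (ZMod.stdAddChar u : ℂ) = 0 := by
  have h := AddChar.sum_mulShift (1 : ZMod q) (ZMod.isPrimitive_stdAddChar q)
  simpa using h

lemma sum_chr (x : Fin n → ZMod q) :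
    ∑ r, chr r x = if x = 0 then ((q : ℂ) ^ n) else 0 := by
  have h : ∀ r : Fin n → ZMod q, chr r x = ∏ i, (ZMod.stdAddChar (r i * x i) : ℂ) := by
    intro r
    have := map_prod (AddChar.toMonoidHom (ZMod.stdAddChar (N := q)))
      (fun i => Multiplicative.ofAdd (r i * x i)) Finset.univ
    rw [← ofAdd_sum] at this
    exact this
  simp only [h]
  have h2 := Finset.prod_univ_sum (fun _ : Fin n => (Finset.univ : Finset (ZMod q)))
    (fun i u => (ZMod.stdAddChar (u * x i) : ℂ))
  rw [Fintype.piFinset_univ] at h2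
  rw [← h2]
  simp only [AddChar.sum_mulShift _ (ZMod.isPrimitive_stdAddChar q), ZMod.card]
  split_ifs with hx
  · simp [hx]
  · obtain ⟨i, hi⟩ := Function.ne_iff.mp hx
    exact Finset.prod_eq_zero (Finset.mem_univ i) (by rw [if_neg (by simpa using hi)]; simp)

lemma sum_comp_surj {ι : Type*} [Fintype ι] [DecidableEq ι]
    (Φ : (Fin n → ZMod q) →ₗ[ZMod q] (ι → ZMod q))
    (hΦ : Function.Surjective Φ) (g : (ι → ZMod q) → ℝ) :
    ∃ K : ℝ, 0 ≤ K ∧ K * (q : ℝ) ^ (Fintype.card ι) = (q : ℝ) ^ n ∧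
      ∑ x, g (Φ x) = K * ∑ u, g u := by
  have hfib : ∀ u, ((Finset.univ.filter (fun x => Φ x = u)).card : ℝ)
      = ((Finset.univ.filter (fun x => Φ x = 0)).card : ℝ) := by
    intro u
    exact_mod_cast AddMonoidHom.card_fiber_eq_of_mem_range Φ (hΦ u) (hΦ 0)
  have key : ∀ g : (ι → ZMod q) → ℝ,
      ∑ x, g (Φ x) = ((Finset.univ.filter (fun x => Φ x = 0)).card : ℝ) * ∑ u, g u := by
    intro g
    rw [← Finset.sum_fiberwise (s := Finset.univ) (g := Φ), Finset.mul_sum]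
    refine Finset.sum_congr rfl fun u _ => ?_
    rw [← hfib u, Finset.sum_congr rfl (g := fun _ => g u)]
    · simp
    · intro x hx
      rw [(Finset.mem_filter.mp hx).2]
  refine ⟨_, by positivity, ?_, key g⟩
  have := key (fun _ => 1)
  simp [ZMod.card] at this
  rw [this]

lemma chang_indep {ι : Type*} [Fintype ι] [DecidableEq ι]
    (T : Finset (Fin n → ZMod q)) (hT : T.Nonempty) (r : ι → Fin n → ZMod q)
    (hs : Function.Surjective (Matrix.mulVecLin (Matrix.of r)))
    (hr : ∀ i, 1 / 2 ≤ ‖hat T (r i)‖) :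
    (T.card : ℝ) * Real.exp (Fintype.card ι / 8) ≤ (q : ℝ) ^ n := by
  have hc : (0 : ℝ) < T.card := by exact_mod_cast hT.card_pos
  choose c hc1 hc2 using fun i => RCLike.exists_norm_eq_mul_self (hat T (r i))
  set g : (ι → ZMod q) → ℝ := fun u => ∏ i, Real.exp (1 / 2 * (c i * ZMod.stdAddChar (u i)).re)
    with hg
  obtain ⟨K, hK0, hK1, hK2⟩ := sum_comp_surj _ hs g
  have hgx : ∀ x, g (Matrix.mulVecLin (Matrix.of r) x)
      = Real.exp (1 / 2 * ∑ i, (c i * chr (r i) x).re) := by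
    intro x
    rw [hg, Finset.mul_sum, Real.exp_sum]
    rfl
  have hgsum : ∑ u, g u ≤ ((q : ℝ) * Real.exp ((1 / 2 : ℝ) ^ 2 / 2)) ^ Fintype.card ι := by
    have h2 := Finset.prod_univ_sum (fun _ : ι => (Finset.univ : Finset (ZMod q)))
      (fun i u => Real.exp (1 / 2 * (c i * ZMod.stdAddChar u).re))
    rw [Fintype.piFinset_univ] at h2
    rw [hg, ← h2, ← Finset.card_univ, ← Finset.prod_const]
    refine Finset.prod_le_prod (fun i _ => Finset.sum_nonneg fun _ _ => (Real.exp_pos _).le)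
      fun i _ => ?_
    have := mgf_bound (Finset.univ : Finset (ZMod q))
      (fun u => (c i * ZMod.stdAddChar u).re) (fun u _ => ?_) ?_ (1 / 2)
    · simpa [ZMod.card] using this
    · refine (Complex.abs_re_le_norm _).trans ?_
      rw [norm_mul, hc1, AddChar.norm_apply]; simp
    · rw [← Complex.re_sum, ← Finset.mul_sum, sum_std]; simp
  have hJ := jensen_exp T hT (fun x => 1 / 2 * ∑ i, (c i * chr (r i) x).re)
  have hmean : (Fintype.card ι : ℝ) / 4 ≤
      (∑ x ∈ T, (1 / 2 * ∑ i, (c i * chr (r i) x).re)) / T.card := by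
    have e : (∑ x ∈ T, (1 / 2 * ∑ i, (c i * chr (r i) x).re)) / T.card
        = 1 / 2 * ∑ i, ‖hat T (r i)‖ := by
      rw [← Finset.mul_sum, Finset.sum_comm, mul_div_assoc, Finset.sum_div]
      congr 1
      refine Finset.sum_congr rfl fun i _ => ?_
      rw [← Complex.re_sum, ← Finset.mul_sum, ← Complex.ofReal_re ‖hat T (r i)‖]
      have := hc2 i
      simp only [Complex.coe_algebraMap] at this
      rw [show ((‖hat T (r i)‖ : ℝ) : ℂ) = c i * hat T (r i) from hc2 i, hat, ← mul_div_assoc]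
      rw [← Complex.ofReal_natCast, Complex.div_ofReal_re]
    rw [e]
    have : ∑ i : ι, (1 / 2 : ℝ) ≤ ∑ i, ‖hat T (r i)‖ := Finset.sum_le_sum fun i _ => hr i
    simp at this
    linarith
  have h1 : (T.card : ℝ) * Real.exp (Fintype.card ι / 4) ≤
      (q : ℝ) ^ n * Real.exp (Fintype.card ι / 8) := by
    calc _ ≤ ∑ x ∈ T, Real.exp (1 / 2 * ∑ i, (c i * chr (r i) x).re) := by
          refine le_trans ?_ hJ
          gcongr
      _ ≤ ∑ x, Real.exp (1 / 2 * ∑ i, (c i * chr (r i) x).re) :=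
          Finset.sum_le_univ_sum_of_nonneg fun _ => (Real.exp_pos _).le
      _ = ∑ x, g (Matrix.mulVecLin (Matrix.of r) x) := by simp only [hgx]
      _ ≤ K * ((q : ℝ) * Real.exp ((1 / 2 : ℝ) ^ 2 / 2)) ^ Fintype.card ι := by
          rw [hK2]; gcongr
      _ = _ := by
          rw [mul_pow, ← mul_assoc, hK1, ← Real.exp_nat_mul]
          congr 2; ring
  have e4 : Real.exp ((Fintype.card ι : ℝ) / 4)
      = Real.exp (Fintype.card ι / 8) * Real.exp (Fintype.card ι / 8) := by
    rw [← Real.exp_add]; congr 1; ring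
  rw [e4, ← mul_assoc] at h1
  exact le_of_mul_le_mul_right h1 (Real.exp_pos _)

lemma chang (T : Finset (Fin n → ZMod q)) (hT : T.Nonempty) :
    ∃ V : Submodule (ZMod q) (Fin n → ZMod q),
      (n : ℝ) - Module.finrank (ZMod q) V ≤ 8 * Real.log ((q : ℝ) ^ n / T.card) ∧
      ∀ r, 1 / 2 ≤ ‖hat T r‖ → ∀ v ∈ V, chr r v = 1 := by
  classical
  obtain ⟨b, hb1, hb2, hb3⟩ :=
    exists_linearIndependent (ZMod q) {r : Fin n → ZMod q | 1 / 2 ≤ ‖hat T r‖}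
  let M : Matrix b (Fin n) (ZMod q) := Matrix.of (fun i : b => (i : Fin n → ZMod q))
  have hrank : M.rank = Fintype.card b := LinearIndependent.rank_matrix hb3
  have hsurj : Function.Surjective M.mulVecLin := by
    rw [← LinearMap.range_eq_top]
    apply Submodule.eq_top_of_finrank_eq
    rw [Module.finrank_fintype_fun_eq_card]
    exact hrank
  refine ⟨LinearMap.ker M.mulVecLin, ?_, ?_⟩
  · have h := LinearMap.finrank_range_add_finrank_ker M.mulVecLin
    rw [Module.finrank_fintype_fun_eq_card, Fintype.card_fin,
      show Module.finrank (ZMod q) (LinearMap.range M.mulVecLin) = Fintype.card b from hrank] at h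
    have h' : (n : ℝ) - Module.finrank (ZMod q) (LinearMap.ker M.mulVecLin) = Fintype.card b := by
      rw [sub_eq_iff_eq_add]; exact_mod_cast h.symm
    rw [h']
    have hc := chang_indep T hT (fun i : b => (i : Fin n → ZMod q)) hsurj (fun i => hb1 i.2)
    have hT0 : (0 : ℝ) < T.card := by exact_mod_cast hT.card_pos
    have : (Fintype.card b : ℝ) / 8 ≤ Real.log ((q : ℝ) ^ n / T.card) := by
      rw [Real.le_log_iff_exp_le (lt_of_lt_of_le (by positivity) (div_le_div_of_nonneg_right hc hT0.le)),
        le_div_iff₀ hT0]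
      linarith
    linarith
  · intro r hr v hv
    have hmem : r ∈ Submodule.span (ZMod q) b := by
      rw [hb2]; exact Submodule.subset_span hr
    have hle : Submodule.span (ZMod q) b ≤
        LinearMap.ker ((Matrix.of (fun _ : Unit => v)).mulVecLin) := by
      rw [Submodule.span_le]
      intro x hx
      have := congrFun (LinearMap.mem_ker.mp hv) ⟨x, hx⟩
      rw [SetLike.mem_coe, LinearMap.mem_ker]
      ext i
      exact (dotProduct_comm v x).trans this
    have : r ⬝ᵥ v = 0 := by
      have := congrFun (LinearMap.mem_ker.mp (hle hmem)) ()
      exact (dotProduct_comm r v).trans this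
    simp [chr, this]

end chang

/-! ### Averaging operators -/

section averaging
variable {G : Type*} [AddCommGroup G]

/-- averaging over the translates `s i`, `i ∈ I`. -/
def Av {ι : Type*} (I : Finset ι) (s : ι → G) : Module.End ℝ (G → ℝ) where
  toFun φ := fun y => (∑ i ∈ I, φ (y + s i)) / I.card
  map_add' φ ψ := by
    ext y; simp [Finset.sum_add_distrib, add_div]
  map_smul' c φ := by
    ext y; simp [← Finset.mul_sum, mul_div_assoc]

lemma Av_apply {ι : Type*} (I : Finset ι) (s : ι → G) (φ : G → ℝ) (y : G) :
    Av I s φ y = (∑ i ∈ I, φ (y + s i)) / I.card := rfl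

lemma Av_mono {ι : Type*} (I : Finset ι) (s : ι → G) {φ ψ : G → ℝ} (h : ∀ y, φ y ≤ ψ y) (y : G) :
    Av I s φ y ≤ Av I s ψ y := by
  rw [Av_apply, Av_apply]
  gcongr
  exact h _

lemma Av_const {ι : Type*} (I : Finset ι) (hI : I.Nonempty) (s : ι → G) (c : ℝ) (y : G) :
    Av I s (fun _ => c) y = c := by
  have hc : (0 : ℝ) < I.card := by exact_mod_cast hI.card_pos
  rw [Av_apply]; simp; field_simp

lemma Av_abs_le {ι : Type*} (I : Finset ι) (hI : I.Nonempty) (s : ι → G) {φ : G → ℝ} {c : ℝ}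
    (h : ∀ y, |φ y| ≤ c) (y : G) : |Av I s φ y| ≤ c := by
  rw [abs_le]
  constructor
  · rw [← Av_const I hI s (-c) y]
    exact Av_mono I s (fun z => (abs_le.mp (h z)).1) y
  · rw [← Av_const I hI s c y]
    exact Av_mono I s (fun z => (abs_le.mp (h z)).2) y

lemma Av_comm {ι κ : Type*} (I : Finset ι) (s : ι → G) (J : Finset κ) (u : κ → G) :
    Commute (Av I s) (Av J u) := by
  ext φ y
  simp only [Module.End.mul_apply, Av_apply, ← Finset.sum_div]
  rw [Finset.sum_comm, div_right_comm]
  simp only [add_right_comm]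

lemma Av_pow_mono {ι : Type*} (I : Finset ι) (s : ι → G) (k : ℕ) {φ ψ : G → ℝ}
    (h : ∀ y, φ y ≤ ψ y) (y : G) :
    ((Av I s) ^ k) φ y ≤ ((Av I s) ^ k) ψ y := by
  induction k generalizing y with
  | zero => exact h y
  | succ k ih =>
    rw [pow_succ', Module.End.mul_apply, Module.End.mul_apply]
    exact Av_mono I s ih y

lemma Av_pow_const {ι : Type*} (I : Finset ι) (hI : I.Nonempty) (s : ι → G) (k : ℕ) (c : ℝ)
    (y : G) : ((Av I s) ^ k) (fun _ => c) y = c := by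
  have : ((Av I s) ^ k) (fun _ => c) = fun _ => c := by
    induction k with
    | zero => rfl
    | succ k ih =>
      rw [pow_succ', Module.End.mul_apply, ih]
      ext y
      exact Av_const I hI s c y
  rw [this]

lemma Av_pow_close {ι : Type*} (I : Finset ι) (hI : I.Nonempty) (s : ι → G) (F : G → ℝ) (η : ℝ)
    (h : ∀ i ∈ I, ∀ y, |F (y + s i) - F y| ≤ η) (k : ℕ) (y : G) :
    |((Av I s) ^ k) F y - F y| ≤ k * η := by
  have h1 : ∀ y, |Av I s F y - F y| ≤ η := by
    intro y
    have hc : (0 : ℝ) < I.card := by exact_mod_cast hI.card_pos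
    have : Av I s F y - F y = (∑ i ∈ I, (F (y + s i) - F y)) / I.card := by
      rw [Av_apply, Finset.sum_sub_distrib]; simp; field_simp
    rw [this, abs_div, abs_of_pos hc, div_le_iff₀ hc]
    refine (Finset.abs_sum_le_sum_abs _ _).trans ?_
    refine (Finset.sum_le_sum fun i hi => h i hi y).trans ?_
    simp [mul_comm]
  induction k generalizing y with
  | zero => simp
  | succ k ih =>
    rw [pow_succ', Module.End.mul_apply]
    have h2 := Av_abs_le I hI s (φ := ((Av I s) ^ k) F - F) (c := k * η) (fun y => ih y) y
    rw [map_sub, Pi.sub_apply] at h2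
    have h3 := h1 y
    push_cast
    rw [abs_le] at *
    constructor <;> linarith [h2.1, h2.2, h3.1, h3.2]

/-! ### Croot–Sisask almost periodicity -/

variable [Fintype G]

/-- sampling error -/
def smp (f : G → ℝ) (A₁ : Finset G) (m : ℕ) (a : Fin m → G) (x : G) : ℝ :=
  (∑ i, f (x + a i)) / m - (∑ b ∈ A₁, f (x + b)) / A₁.card

lemma smp_moment (f : G → ℝ) (hf : ∀ x, 0 ≤ f x ∧ f x ≤ 1) (A₁ : Finset G) (h₁ : A₁.Nonempty)
    (m : ℕ) (hm : 0 < m) (δ : ℝ) :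
    ∑ a ∈ Fintype.piFinset (fun _ : Fin m => A₁), ∑ x, Real.exp (m * δ * smp f A₁ m a x) ≤
      (A₁.card : ℝ) ^ m * (Fintype.card G * Real.exp (m * δ ^ 2 / 2)) := by
  have hc : (0 : ℝ) < A₁.card := by exact_mod_cast h₁.card_pos
  have hm' : (0 : ℝ) < m := by exact_mod_cast hm
  rw [Finset.sum_comm]
  have key : ∀ x, ∑ a ∈ Fintype.piFinset (fun _ : Fin m => A₁),
      Real.exp (m * δ * smp f A₁ m a x) ≤ (A₁.card : ℝ) ^ m * Real.exp (m * δ ^ 2 / 2) := by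
    intro x
    set g := (∑ b ∈ A₁, f (x + b)) / A₁.card with hg
    have hg0 : 0 ≤ g := div_nonneg (Finset.sum_nonneg fun _ _ => (hf _).1) hc.le
    have hg1 : g ≤ 1 := by
      rw [hg, div_le_one hc]
      refine (Finset.sum_le_sum fun i _ => (hf (x + i)).2).trans ?_
      simp
    have e : ∀ a : Fin m → G, Real.exp (m * δ * smp f A₁ m a x)
        = ∏ i, Real.exp (δ * (f (x + a i) - g)) := by
      intro a
      rw [← Real.exp_sum, ← Finset.mul_sum, Finset.sum_sub_distrib]
      simp only [smp, ← hg]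
      congr 1
      simp
      field_simp
    simp only [e]
    rw [Finset.sum_prod_piFinset A₁ (fun _ b => Real.exp (δ * (f (x + b) - g)))]
    rw [Finset.prod_const, Finset.card_univ, Fintype.card_fin]
    have hb := mgf_bound A₁ (fun b => f (x + b) - g) (fun b _ => by
      have := hf (x + b)
      rw [abs_le]; constructor <;> linarith) (by
      rw [Finset.sum_sub_distrib, hg]; simp; field_simp; simp) δ
    calc _ ≤ ((A₁.card : ℝ) * Real.exp (δ ^ 2 / 2)) ^ m := by
          gcongr
      _ = _ := by
          rw [mul_pow, ← Real.exp_nat_mul]; congr 2; ring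
  refine (Finset.sum_le_sum fun x _ => key x).trans ?_
  simp
  apply le_of_eq; ring

lemma smp_good [DecidableEq G] (f : G → ℝ) (hf : ∀ x, 0 ≤ f x ∧ f x ≤ 1) (A₁ : Finset G) (h₁ : A₁.Nonempty)
    (m : ℕ) (hm : 0 < m) (δ : ℝ) :
    ∃ L : Finset (Fin m → G), (A₁.card : ℝ) ^ m ≤ 2 * L.card ∧ ∀ a ∈ L,
      ∑ x, (Real.exp (m * δ * smp f A₁ m a x) + Real.exp (-(m * δ * smp f A₁ m a x))) ≤
        4 * (Fintype.card G * Real.exp (m * δ ^ 2 / 2)) := by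
  set B : ℝ := Fintype.card G * Real.exp (m * δ ^ 2 / 2) with hB
  have hB0 : 0 < B := by
    have : 0 < Fintype.card G := Fintype.card_pos
    positivity
  set W : (Fin m → G) → ℝ := fun a =>
    ∑ x, (Real.exp (m * δ * smp f A₁ m a x) + Real.exp (-(m * δ * smp f A₁ m a x))) with hW
  set X := Fintype.piFinset (fun _ : Fin m => A₁) with hX
  have hXc : (X.card : ℝ) = (A₁.card : ℝ) ^ m := by simp [hX]
  have htot : ∑ a ∈ X, W a ≤ 2 * ((A₁.card : ℝ) ^ m * B) := by
    have h1 := smp_moment f hf A₁ h₁ m hm δ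
    have h2 := smp_moment f hf A₁ h₁ m hm (-δ)
    simp only [neg_sq, mul_neg, neg_mul] at h2
    simp only [hW, Finset.sum_add_distrib]
    linarith
  refine ⟨X.filter (fun a => W a ≤ 4 * B), ?_, fun a ha => (Finset.mem_filter.mp ha).2⟩
  have h3 : ((X.filter (fun a => ¬ W a ≤ 4 * B)).card : ℝ) * (4 * B) ≤ ∑ a ∈ X, W a := by
    rw [← nsmul_eq_mul]
    refine (Finset.card_nsmul_le_sum _ W _ ?_).trans ?_
    · intro a ha
      exact (not_le.mp (Finset.mem_filter.mp ha).2).le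
    · refine Finset.sum_le_sum_of_subset_of_nonneg (Finset.filter_subset _ _) fun a _ _ => ?_
      exact Finset.sum_nonneg fun x _ => by positivity
  have h4 : ((X.filter (fun a => W a ≤ 4 * B)).card : ℝ)
      + ((X.filter (fun a => ¬ W a ≤ 4 * B)).card : ℝ) = (A₁.card : ℝ) ^ m := by
    rw [← hXc]; exact_mod_cast Finset.card_filter_add_card_filter_not _
  have h5 : ((X.filter (fun a => ¬ W a ≤ 4 * B)).card : ℝ) * 2 ≤ (A₁.card : ℝ) ^ m := by
    have := h3.trans htot
    refine le_of_mul_le_mul_right (a := 2 * B) ?_ (by positivity)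
    linarith
  linarith

lemma smp_close (f : G → ℝ) (A₁ A₂ : Finset G) (h₂ : A₂.Nonempty)
    (m : ℕ) (hm : 0 < m) (δ : ℝ) (hδ : 0 < δ)
    (hmδ : 2 * Real.log (4 * Fintype.card G / A₂.card) ≤ m * δ ^ 2) (a : Fin m → G)
    (ha : ∑ x, (Real.exp (m * δ * smp f A₁ m a x) + Real.exp (-(m * δ * smp f A₁ m a x))) ≤
        4 * (Fintype.card G * Real.exp (m * δ ^ 2 / 2))) (y : G) :
    |(∑ b ∈ A₂, smp f A₁ m a (y - b)) / A₂.card| ≤ δ := by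
  have hc : (0 : ℝ) < A₂.card := by exact_mod_cast h₂.card_pos
  have hm' : (0 : ℝ) < m := by exact_mod_cast hm
  have hN : (0 : ℝ) < Fintype.card G := by exact_mod_cast Fintype.card_pos
  set M := (∑ b ∈ A₂, |smp f A₁ m a (y - b)|) / A₂.card with hM
  have h0 : |(∑ b ∈ A₂, smp f A₁ m a (y - b)) / A₂.card| ≤ M := by
    rw [abs_div, abs_of_pos hc, hM]
    gcongr
    exact Finset.abs_sum_le_sum_abs _ _
  refine h0.trans ?_
  have hJ := jensen_exp A₂ h₂ (fun b => m * δ * |smp f A₁ m a (y - b)|)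
  rw [← Finset.mul_sum, mul_div_assoc, ← hM] at hJ
  set E : G → ℝ := fun x => Real.exp (m * δ * smp f A₁ m a x) + Real.exp (-(m * δ * smp f A₁ m a x))
    with hE
  have h1 : ∑ b ∈ A₂, Real.exp (m * δ * |smp f A₁ m a (y - b)|) ≤ ∑ x, E x := by
    calc _ ≤ ∑ b ∈ A₂, E (y - b) := by
          refine Finset.sum_le_sum fun b _ => ?_
          simp only [hE]
          rcases abs_cases (smp f A₁ m a (y - b)) with ⟨h, _⟩ | ⟨h, _⟩
          · rw [h]; linarith [Real.exp_pos (-(m * δ * smp f A₁ m a (y - b)))]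
          · rw [h, mul_neg]; linarith [Real.exp_pos (m * δ * smp f A₁ m a (y - b))]
      _ ≤ ∑ b, E (y - b) :=
          Finset.sum_le_univ_sum_of_nonneg fun _ => by positivity
      _ = ∑ x, E x := Equiv.sum_comp (Equiv.subLeft y) E
  have h2 := hJ.trans (h1.trans ha)
  have h3 : Real.exp (m * δ * M) ≤ 4 * Fintype.card G / A₂.card * Real.exp (m * δ ^ 2 / 2) := by
    rw [div_mul_eq_mul_div, le_div_iff₀ hc]
    linarith
  have h4 : m * δ * M ≤ Real.log (4 * Fintype.card G / A₂.card) + m * δ ^ 2 / 2 := by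
    rw [← Real.exp_le_exp, Real.exp_add, Real.exp_log (by positivity)]
    exact h3
  refine le_of_mul_le_mul_left (a := m * δ) ?_ (by positivity)
  linarith

lemma croot_sisask [DecidableEq G] (f : G → ℝ) (hf : ∀ x, 0 ≤ f x ∧ f x ≤ 1) (A₁ A₂ : Finset G)
    (h₁ : A₁.Nonempty) (h₂ : A₂.Nonempty)
    (m : ℕ) (hm : 0 < m) (δ : ℝ) (hδ : 0 < δ)
    (hmδ : 2 * Real.log (4 * Fintype.card G / A₂.card) ≤ m * δ ^ 2) :
    ∃ T : Finset G, (Fintype.card G : ℝ) * ((A₁.card : ℝ) / Fintype.card G) ^ m ≤ 2 * T.card ∧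
      ∀ t ∈ T, ∀ t' ∈ T, ∀ y, 
        |Av (A₁ ×ˢ A₂) (fun p => p.1 - p.2) f (y + (t - t')) -
          Av (A₁ ×ˢ A₂) (fun p => p.1 - p.2) f y| ≤ 2 * δ := by
  have hN : (0 : ℝ) < Fintype.card G := by exact_mod_cast Fintype.card_pos
  have hc₁ : (0 : ℝ) < A₁.card := by exact_mod_cast h₁.card_pos
  have hc₂ : (0 : ℝ) < A₂.card := by exact_mod_cast h₂.card_pos
  obtain ⟨L, hL1, hL2⟩ := smp_good f hf A₁ h₁ m hm δ
  let T : (Fin m → G) → Finset G := fun b => Finset.univ.filter (fun t => (fun i => b i + t) ∈ L)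
  have hsum : ∑ b, ((T b).card : ℝ) = Fintype.card G * L.card := by
    have : ∀ b, ((T b).card : ℝ) = ∑ t, if (fun i => b i + t) ∈ L then (1 : ℝ) else 0 := by
      intro b; simp [T]
    simp only [this]
    rw [Finset.sum_comm]
    have h2 : ∀ t : G, (∑ b : Fin m → G, if (fun i => b i + t) ∈ L then (1 : ℝ) else 0)
        = L.card := by
      intro t
      rw [show (∑ b : Fin m → G, if (fun i => b i + t) ∈ L then (1 : ℝ) else 0)
        = ∑ b : Fin m → G, if b ∈ L then (1 : ℝ) else 0 from
        Equiv.sum_comp (Equiv.addRight (fun _ : Fin m => t))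
          (fun b => if b ∈ L then (1 : ℝ) else 0)]
      simp
    simp [h2]
  obtain ⟨b, -, hb⟩ : ∃ b ∈ (Finset.univ : Finset (Fin m → G)),
      (Fintype.card G : ℝ) * L.card / (Fintype.card G : ℝ) ^ m ≤ ((T b).card : ℝ) := by
    refine Finset.exists_le_of_sum_le Finset.univ_nonempty ?_
    rw [hsum]
    simp
    apply le_of_eq; field_simp
  refine ⟨T b, ?_, ?_⟩
  · rw [div_pow, ← mul_div_assoc]
    rw [div_le_iff₀ (by positivity)] at hb ⊢
    nlinarith
  · set F := Av (A₁ ×ˢ A₂) (fun p => p.1 - p.2) f with hF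
    let H : G → ℝ := fun z => (∑ c ∈ A₂, (∑ i, f (z - c + b i)) / m) / A₂.card
    have hFe : ∀ y, F y = (∑ c ∈ A₂, (∑ a ∈ A₁, f (y - c + a)) / A₁.card) / A₂.card := by
      intro y
      rw [hF, Av_apply, Finset.sum_product_right, Finset.card_product, ← Finset.sum_div, div_div]
      push_cast
      congr 1
      refine Finset.sum_congr rfl fun c _ => Finset.sum_congr rfl fun a _ => ?_
      congr 1; abel
    have key : ∀ t ∈ T b, ∀ y, |H (y + t) - F y| ≤ δ := by
      intro t ht y
      have := smp_close f A₁ A₂ h₂ m hm δ hδ hmδ _ (hL2 _ (Finset.mem_filter.mp ht).2) y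
      convert this using 2
      rw [hFe, ← sub_div, ← Finset.sum_sub_distrib]
      congr 1
      refine Finset.sum_congr rfl fun c _ => ?_
      simp only [smp]
      congr 2
      refine Finset.sum_congr rfl fun i _ => ?_
      congr 1; abel
    intro t ht t' ht' y
    have e1 := key t ht y
    have e2 := key t' ht' (y + (t - t'))
    rw [show y + (t - t') + t' = y + t by abel] at e2
    rw [abs_le] at *
    constructor <;> linarith [e1.1, e1.2, e2.1, e2.2]

end averaging

/-! ### Fourier side -/

section fourier
variable {q n : ℕ} [Fact q.Prime]

lemma card_vec : (Fintype.card (Fin n → ZMod q) : ℝ) = (q : ℝ) ^ n := by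
  simp [ZMod.card]

lemma dconv_mu (A : Finset (Fin n → ZMod q)) (hA : A.Nonempty) (z : Fin n → ZMod q) :
    dconv (mu A) (mu A) z = ∑ r, ‖hat A r‖ ^ 2 * (chr r z).re := by
  have hc : (0 : ℝ) < A.card := by exact_mod_cast hA.card_pos
  have hN : (0 : ℝ) < (q : ℝ) ^ n := by
    have := (Fact.out : q.Prime).pos
    positivity
  have h1 : ∀ r, ‖hat A r‖ ^ 2 * (chr r z).re =
      (∑ a ∈ A, ∑ b ∈ A, (chr r (z + b - a)).re) / (A.card : ℝ) ^ 2 := by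
    intro r
    have e : ((‖hat A r‖ ^ 2 : ℝ) : ℂ) * chr r z
        = (∑ a ∈ A, ∑ b ∈ A, chr r (z + b - a)) / ((A.card : ℝ) ^ 2 : ℝ) := by
      have e2 : ((‖hat A r‖ ^ 2 : ℝ) : ℂ) = hat A r * (starRingEnd ℂ) (hat A r) := by
        rw [Complex.mul_conj, Complex.normSq_eq_norm_sq]
      rw [e2, hat, map_div₀, map_sum, Complex.conj_natCast]
      have : ∀ a b, chr r (z + b - a) = chr r z * (chr r b * (starRingEnd ℂ) (chr r a)) := by
        intro a b
        rw [chr_sub, chr_add, mul_assoc]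
      simp only [this, ← Finset.mul_sum, ← Finset.sum_mul]
      push_cast
      have hc' : (A.card : ℂ) ≠ 0 := by exact_mod_cast hc.ne'
      field_simp
    have e3 := congrArg Complex.re e
    rw [Complex.re_ofReal_mul, Complex.div_ofReal_re] at e3
    simpa [Complex.re_sum] using e3
  simp only [h1]
  rw [← Finset.sum_div, Finset.sum_comm]
  have h2 : ∀ a ∈ A, ∑ r, ∑ b ∈ A, (chr r (z + b - a)).re
      = ∑ b ∈ A, if z + b = a then (q : ℝ) ^ n else 0 := by
    intro a _
    rw [Finset.sum_comm]
    refine Finset.sum_congr rfl fun b _ => ?_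
    rw [← Complex.re_sum, sum_chr]
    simp only [sub_eq_zero]
    split_ifs
    · norm_cast
    · simp
  rw [Finset.sum_congr rfl h2, Finset.sum_comm]
  simp only [dconv, mu, card_vec]
  have h3 : ∀ y, ((if z + y ∈ A then (q : ℝ) ^ n / A.card else 0) *
      (if y ∈ A then (q : ℝ) ^ n / A.card else 0)) =
      if y ∈ A then (if z + y ∈ A then (q : ℝ) ^ n else 0) * ((q : ℝ) ^ n / (A.card : ℝ) ^ 2) else 0 := by
    intro y
    split_ifs
    · ring
    · simp
    · simp
    · simp
  simp only [h3, Finset.sum_ite_mem, Finset.univ_inter, Finset.sum_ite_eq]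
  rw [← Finset.sum_mul]
  field_simp

lemma chr_zero (r : Fin n → ZMod q) : chr r 0 = 1 := by simp [chr]

lemma sum_hat_sq (A : Finset (Fin n → ZMod q)) (hA : A.Nonempty) :
    ∑ r, ‖hat A r‖ ^ 2 = (q : ℝ) ^ n / A.card := by
  have hc : (0 : ℝ) < A.card := by exact_mod_cast hA.card_pos
  have hN : (0 : ℝ) < (q : ℝ) ^ n := by
    have := (Fact.out : q.Prime).pos
    positivity
  have h := dconv_mu A hA 0
  simp only [chr_zero, Complex.one_re, mul_one] at h
  rw [← h]
  simp only [dconv, mu, card_vec, zero_add]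
  have : ∀ y, ((if y ∈ A then (q : ℝ) ^ n / A.card else 0) *
      (if y ∈ A then (q : ℝ) ^ n / A.card else 0)) =
      if y ∈ A then ((q : ℝ) ^ n / A.card) ^ 2 else 0 := by
    intro y; split_ifs <;> ring
  simp only [this, Finset.sum_ite_mem, Finset.univ_inter, Finset.sum_const, nsmul_eq_mul]
  field_simp

/-- real part of a character -/
def rchr (r : Fin n → ZMod q) : (Fin n → ZMod q) → ℝ := fun x => (chr r x).re

lemma rchr_abs (r x : Fin n → ZMod q) : |rchr r x| ≤ 1 :=
  (Complex.abs_re_le_norm _).trans (norm_chr r x).le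

lemma Av_rchr (T : Finset (Fin n → ZMod q)) (hT : T.Nonempty) (r : Fin n → ZMod q) :
    Av (T ×ˢ T) (fun p => p.1 - p.2) (rchr r) = (‖hat T r‖ ^ 2) • rchr r := by
  have hc : (0 : ℝ) < T.card := by exact_mod_cast hT.card_pos
  ext y
  rw [Av_apply, Pi.smul_apply, smul_eq_mul]
  have e : ((‖hat T r‖ ^ 2 : ℝ) : ℂ) * chr r y
        = (∑ p ∈ T ×ˢ T, chr r (y + (p.1 - p.2))) / ((T.card : ℝ) ^ 2 : ℝ) := by
    have e2 : ((‖hat T r‖ ^ 2 : ℝ) : ℂ) = hat T r * (starRingEnd ℂ) (hat T r) := by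
      rw [Complex.mul_conj, Complex.normSq_eq_norm_sq]
    rw [e2, hat, map_div₀, map_sum, Complex.conj_natCast, Finset.sum_product]
    have : ∀ a b, chr r (y + (a - b)) = chr r y * (chr r a * (starRingEnd ℂ) (chr r b)) := by
      intro a b
      rw [chr_add, chr_sub]
    simp only [this, ← Finset.mul_sum, ← Finset.sum_mul]
    push_cast
    have hc' : (T.card : ℂ) ≠ 0 := by exact_mod_cast hc.ne'
    field_simp
  have e3 := congrArg Complex.re e
  rw [Complex.re_ofReal_mul, Complex.div_ofReal_re, Complex.re_sum] at e3
  rw [Finset.card_product, rchr, e3]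
  push_cast
  rw [sq]
  rfl

lemma Av_pow_rchr (T : Finset (Fin n → ZMod q)) (hT : T.Nonempty) (r : Fin n → ZMod q) (k : ℕ) :
    ((Av (T ×ˢ T) (fun p => p.1 - p.2)) ^ k) (rchr r) = ((‖hat T r‖ ^ 2) ^ k) • rchr r := by
  induction k with
  | zero => simp
  | succ k ih =>
    rw [pow_succ', Module.End.mul_apply, ih, map_smul, Av_rchr T hT, smul_smul,
      pow_succ (‖hat T r‖ ^ 2) k]

/-- The Fourier-analytic part: averaging over `V` changes little. -/
lemma fourier_error (A T : Finset (Fin n → ZMod q)) (hA : A.Nonempty) (hT : T.Nonempty)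
    {ι κ : Type*} (I : Finset ι) (hI : I.Nonempty) (s : ι → Fin n → ZMod q)
    (J : Finset κ) (hJ : J.Nonempty) (u : κ → Fin n → ZMod q)
    (hV : ∀ r, 1 / 2 ≤ ‖hat T r‖ → ∀ j ∈ J, chr r (u j) = 1) (k : ℕ) :
    ((Av (T ×ˢ T) (fun p => p.1 - p.2)) ^ k) (Av I s (dconv (mu A) (mu A))) 0 ≤
      ((Av (T ×ˢ T) (fun p => p.1 - p.2)) ^ k) (Av I s (Av J u (dconv (mu A) (mu A)))) 0
      + 2 * ((q : ℝ) ^ n / A.card) / 4 ^ k := by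
  set P := (Av (T ×ˢ T) (fun p : (Fin n → ZMod q) × (Fin n → ZMod q) => p.1 - p.2)) with hP
  have hQ : dconv (mu A) (mu A) = ∑ r, ‖hat A r‖ ^ 2 • rchr r := by
    ext z
    rw [dconv_mu A hA, Finset.sum_apply]
    rfl
  set D := Av I s
  set M := Av J u
  have c1 : P ^ k * (D * (1 - M)) = (D * (1 - M)) * P ^ k := by
    have : Commute P (D * (1 - M)) :=
      (Av_comm _ _ _ _).mul_right ((Commute.one_right P).sub_right (Av_comm _ _ _ _))
    exact this.pow_left k
  have hterm : ∀ r, (P ^ k * (D * (1 - M))) (rchr r) 0 ≤ 2 / 4 ^ k := by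
    intro r
    rw [c1, Module.End.mul_apply, Av_pow_rchr T hT, map_smul, Pi.smul_apply, smul_eq_mul,
      Module.End.mul_apply]
    by_cases hr : 1 / 2 ≤ ‖hat T r‖
    · have : (1 - M) (rchr r) = 0 := by
        ext y
        have hcJ : (0 : ℝ) < J.card := by exact_mod_cast hJ.card_pos
        have : M (rchr r) y = rchr r y := by
          rw [Av_apply, Finset.sum_congr rfl (g := fun _ => rchr r y)]
          · simp; field_simp
          · intro j hj
            simp [rchr, chr_add, hV r hr j hj]
        simp [this]
      rw [this]
      simp
      positivity
    · push Not at hr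
      have hb : |D ((1 - M) (rchr r)) 0| ≤ 2 := by
        refine Av_abs_le I hI s (fun y => ?_) 0
        have h1 := rchr_abs r y
        have h2 := Av_abs_le J hJ u (rchr_abs r) y
        have : (1 - M) (rchr r) y = rchr r y - M (rchr r) y := by simp
        rw [this]
        rw [abs_le] at *
        constructor <;> linarith [h1.1, h1.2, h2.1, h2.2]
      have h4 : (‖hat T r‖ ^ 2) ^ k ≤ (1 / 4) ^ k := by
        gcongr
        nlinarith [norm_nonneg (hat T r)]
      calc _ ≤ (‖hat T r‖ ^ 2) ^ k * 2 := by
            gcongr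
            exact (abs_le.mp hb).2
        _ ≤ (1 / 4) ^ k * 2 := by gcongr
        _ = _ := by rw [one_div, inv_pow]; field_simp
  have htot : (P ^ k * (D * (1 - M))) (dconv (mu A) (mu A)) 0 ≤
      2 * ((q : ℝ) ^ n / A.card) / 4 ^ k := by
    rw [hQ, map_sum, Finset.sum_apply, ← sum_hat_sq A hA, Finset.mul_sum, Finset.sum_div]
    refine Finset.sum_le_sum fun r _ => ?_
    rw [map_smul, Pi.smul_apply, smul_eq_mul]
    calc _ ≤ ‖hat A r‖ ^ 2 * (2 / 4 ^ k) := by gcongr; exact hterm r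
      _ = _ := by ring
  have hsplit : (P ^ k * (D * (1 - M))) (dconv (mu A) (mu A)) 0 =
      (P ^ k) (D (dconv (mu A) (mu A))) 0 - (P ^ k) (D (M (dconv (mu A) (mu A)))) 0 := by
    simp [Module.End.mul_apply, map_sub]
  linarith

lemma mem_submoduleFinset (V : Submodule (ZMod q) (Fin n → ZMod q)) (x : Fin n → ZMod q) :
    x ∈ submoduleFinset V ↔ x ∈ V := by
  simp [submoduleFinset]

lemma sum_mu (A : Finset (Fin n → ZMod q)) (hA : A.Nonempty) :
    (∑ y, mu A y) = (q : ℝ) ^ n := by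
  have hc : (0 : ℝ) < A.card := by exact_mod_cast hA.card_pos
  simp only [mu, Finset.sum_ite_mem, Finset.univ_inter, Finset.sum_const, nsmul_eq_mul, card_vec]
  field_simp

lemma Av_le_norm (A : Finset (Fin n → ZMod q)) (hA : A.Nonempty)
    (V : Submodule (ZMod q) (Fin n → ZMod q)) (z : Fin n → ZMod q) :
    Av (submoduleFinset V) (fun v => -v) (dconv (mu A) (mu A)) z ≤
      ‖conv (mu (submoduleFinset V)) (mu A)‖ := by
  have hN : (0 : ℝ) < (q : ℝ) ^ n := by
    have := (Fact.out : q.Prime).pos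
    positivity
  set N : ℝ := ‖conv (mu (submoduleFinset V)) (mu A)‖
  have hVne : (submoduleFinset V).Nonempty := ⟨0, (mem_submoduleFinset V 0).mpr V.zero_mem⟩
  have hc : (0 : ℝ) < (submoduleFinset V).card := by exact_mod_cast hVne.card_pos
  have hconv : ∀ x, (∑ v ∈ submoduleFinset V, mu A (x - v)) / (submoduleFinset V).card ≤ N := by
    intro x
    have h1 : conv (mu (submoduleFinset V)) (mu A) x =
        (∑ v ∈ submoduleFinset V, mu A (x - v)) / (submoduleFinset V).card := by
      simp only [conv]
      rw [show (∑ y, mu (submoduleFinset V) y * mu A (x - y)) =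
        ∑ y, if y ∈ submoduleFinset V then
          (q : ℝ) ^ n / (submoduleFinset V).card * mu A (x - y) else 0 from
        Finset.sum_congr rfl fun y _ => by
          rw [mu, card_vec]; split_ifs <;> simp]
      rw [Finset.sum_ite_mem, Finset.univ_inter, ← Finset.mul_sum, card_vec]
      field_simp
    rw [← h1]
    exact (le_abs_self _).trans (norm_le_pi_norm (conv (mu (submoduleFinset V)) (mu A)) x)
  have h2 : Av (submoduleFinset V) (fun v => -v) (dconv (mu A) (mu A)) z =
      (∑ y, ((∑ v ∈ submoduleFinset V, mu A (z + y - v)) / (submoduleFinset V).card) * mu A y)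
        / (q : ℝ) ^ n := by
    rw [Av_apply]
    simp only [dconv, card_vec]
    rw [← Finset.sum_div, Finset.sum_comm, div_right_comm]
    congr 1
    rw [Finset.sum_div]
    refine Finset.sum_congr rfl fun y _ => ?_
    rw [← Finset.sum_mul, div_mul_eq_mul_div]
    congr 2
    refine Finset.sum_congr rfl fun v _ => ?_
    congr 1; abel
  rw [h2, div_le_iff₀ hN, ← sum_mu A hA, Finset.mul_sum]
  refine Finset.sum_le_sum fun y _ => ?_
  refine mul_le_mul_of_nonneg_right (hconv _) ?_
  rw [mu]; split_ifs <;> positivity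

lemma nip_eq_Av (S A₁ A₂ : Finset (Fin n → ZMod q)) (h₁ : A₁.Nonempty) (h₂ : A₂.Nonempty) :
    nip (dconv (mu A₁) (mu A₂)) (indic S) =
      Av (A₁ ×ˢ A₂) (fun p => p.1 - p.2) (indic S) 0 := by
  have hN : (0 : ℝ) < (q : ℝ) ^ n := by
    have := (Fact.out : q.Prime).pos
    positivity
  have hc₁ : (0 : ℝ) < A₁.card := by exact_mod_cast h₁.card_pos
  have hc₂ : (0 : ℝ) < A₂.card := by exact_mod_cast h₂.card_pos
  rw [Av_apply, Finset.sum_product_right, Finset.card_product]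
  simp only [nip, dconv, card_vec, zero_add]
  have e : ∀ x, (∑ y, mu A₁ (x + y) * mu A₂ y) / (q : ℝ) ^ n * indic S x
      = (∑ y ∈ A₂, mu A₁ (x + y) * indic S x) / A₂.card := by
    intro x
    rw [show (∑ y, mu A₁ (x + y) * mu A₂ y) = ∑ y, if y ∈ A₂ then
        mu A₁ (x + y) * ((q : ℝ) ^ n / A₂.card) else 0 from
        Finset.sum_congr rfl fun y _ => by
          rw [mu, mu, card_vec]; split_ifs <;> simp]
    rw [Finset.sum_ite_mem, Finset.univ_inter, ← Finset.sum_mul, ← Finset.sum_mul]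
    field_simp
  simp only [e]
  rw [← Finset.sum_div, Finset.sum_comm]
  have e2 : ∀ y, ∑ x, mu A₁ (x + y) * indic S x
      = (∑ a ∈ A₁, indic S (a - y)) * ((q : ℝ) ^ n / A₁.card) := by
    intro y
    have := Equiv.sum_comp (Equiv.addRight y) (fun x => mu A₁ x * indic S (x - y))
    simp only [Equiv.coe_addRight, add_sub_cancel_right] at this
    rw [this]
    rw [show (∑ x, mu A₁ x * indic S (x - y)) = ∑ x, if x ∈ A₁ then
        indic S (x - y) * ((q : ℝ) ^ n / A₁.card) else 0 from
        Finset.sum_congr rfl fun y _ => by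
          rw [mu, card_vec]; split_ifs
          · ring
          · simp]
    rw [Finset.sum_ite_mem, Finset.univ_inter, ← Finset.sum_mul]
  simp only [e2]
  rw [← Finset.sum_mul]
  push_cast
  field_simp

/-- Combination of all ingredients, with explicit parameters. -/
lemma main_param (ε : ℝ) (hε : 0 < ε) (hε8 : ε < 1 / 8)
    (S A A₁ A₂ : Finset (Fin n → ZMod q)) (hA : A.Nonempty) (h₁ : A₁.Nonempty) (h₂ : A₂.Nonempty)
    (hS : nip (dconv (mu A₁) (mu A₂)) (indic S) ≥ 1 - ε)
    (hQ : ∀ x ∈ S, dconv (mu A) (mu A) x ≥ 1 + 4 * ε)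
    (k m : ℕ) (hk : 0 < k) (hm : 0 < m)
    (hk4 : 4 * ((q : ℝ) ^ n / A.card) ≤ ε * 4 ^ k)
    (hmk : 2 * Real.log (4 * (q : ℝ) ^ n / A₂.card) ≤ m * (ε / (4 * k)) ^ 2) :
    ∃ V : Submodule (ZMod q) (Fin n → ZMod q),
      ((n : ℝ) - Module.finrank (ZMod q) V) ≤
        8 * (Real.log 2 + m * Real.log ((q : ℝ) ^ n / A₁.card)) ∧
      ‖conv (mu (submoduleFinset V)) (mu A)‖ ≥ 1 + ε / 2 := by
  have hN : (0 : ℝ) < (q : ℝ) ^ n := by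
    have := (Fact.out : q.Prime).pos
    positivity
  have hc₁ : (0 : ℝ) < A₁.card := by exact_mod_cast h₁.card_pos
  have hk0 : (0 : ℝ) < k := by exact_mod_cast hk
  obtain ⟨T, hT1, hT2⟩ := croot_sisask (indic S) (fun x => by
    rw [indic]; split_ifs <;> norm_num) A₁ A₂ h₁ h₂ m hm (ε / (4 * k)) (by positivity)
    (by rw [card_vec]; exact hmk)
  rw [card_vec] at hT1
  have hTpos : (0 : ℝ) < T.card := by
    have : 0 < (q : ℝ) ^ n * ((A₁.card : ℝ) / (q : ℝ) ^ n) ^ m := by positivity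
    linarith
  have hT : T.Nonempty := by
    rw [← Finset.card_pos]; exact_mod_cast hTpos
  obtain ⟨V, hV1, hV2⟩ := chang T hT
  have hVne : (submoduleFinset V).Nonempty := ⟨0, (mem_submoduleFinset V 0).mpr V.zero_mem⟩
  refine ⟨V, hV1.trans ?_, ?_⟩
  · have : (q : ℝ) ^ n / T.card ≤ 2 * ((q : ℝ) ^ n / A₁.card) ^ m := by
      rw [div_le_iff₀ hTpos]
      have e : ((q : ℝ) ^ n / A₁.card) ^ m * ((A₁.card : ℝ) / (q : ℝ) ^ n) ^ m = 1 := by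
        rw [← mul_pow]; field_simp; simp
      calc (q : ℝ) ^ n = ((q : ℝ) ^ n / A₁.card) ^ m *
            ((q : ℝ) ^ n * ((A₁.card : ℝ) / (q : ℝ) ^ n) ^ m) := by
            linear_combination (-(q : ℝ) ^ n) * e
        _ ≤ ((q : ℝ) ^ n / A₁.card) ^ m * (2 * T.card) := by gcongr
        _ = _ := by ring
    have h := Real.log_le_log (by positivity) this
    rw [Real.log_mul (by norm_num) (by positivity), Real.log_pow] at h
    linarith
  · set P := (Av (T ×ˢ T) (fun p : (Fin n → ZMod q) × (Fin n → ZMod q) => p.1 - p.2)) with hP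
    set D := (Av (A₁ ×ˢ A₂) (fun p : (Fin n → ZMod q) × (Fin n → ZMod q) => p.1 - p.2)) with hD
    have hTT : (T ×ˢ T).Nonempty := hT.product hT
    have hAA : (A₁ ×ˢ A₂).Nonempty := h₁.product h₂
    have s1 : 1 - ε ≤ D (indic S) 0 := by
      rw [hD, ← nip_eq_Av S A₁ A₂ h₁ h₂]; exact hS
    have s2 := Av_pow_close (T ×ˢ T) hTT (fun p => p.1 - p.2) (D (indic S)) (2 * (ε / (4 * k)))
      (fun p hp y => hT2 p.1 (Finset.mem_product.mp hp).1 p.2 (Finset.mem_product.mp hp).2 y) k 0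
    rw [← hP] at s2
    have s3 : (k : ℝ) * (2 * (ε / (4 * k))) = ε / 2 := by field_simp; norm_num
    rw [s3] at s2
    have s4 : 1 - 3 / 2 * ε ≤ (P ^ k) (D (indic S)) 0 := by
      linarith [(abs_le.mp s2).1]
    have s5 : (1 + 4 * ε) * (P ^ k) (D (indic S)) 0 ≤ (P ^ k) (D (dconv (mu A) (mu A))) 0 := by
      have : (1 + 4 * ε) * (P ^ k) (D (indic S)) 0 =
          (P ^ k) (D ((1 + 4 * ε) • indic S)) 0 := by
        rw [map_smul, map_smul]; rfl
      rw [this]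
      refine Av_pow_mono _ _ k (fun y => Av_mono _ _ (fun x => ?_) y) 0
      rw [Pi.smul_apply, smul_eq_mul, indic]
      split_ifs with hx
      · have := hQ x hx; linarith
      · rw [mul_zero, dconv]
        refine div_nonneg (Finset.sum_nonneg fun y _ => mul_nonneg ?_ ?_) (by positivity)
        · rw [mu]; split_ifs <;> positivity
        · rw [mu]; split_ifs <;> positivity
    have s6 := fourier_error A T hA hT (A₁ ×ˢ A₂) hAA (fun p => p.1 - p.2)
      (submoduleFinset V) hVne (fun v => -v) (fun r hr v hv => by
        exact hV2 r hr (-v) (V.neg_mem ((mem_submoduleFinset V v).mp hv))) k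
    rw [← hP, ← hD] at s6
    have s7 : (P ^ k) (D (Av (submoduleFinset V) (fun v => -v) (dconv (mu A) (mu A)))) 0 ≤
        ‖conv (mu (submoduleFinset V)) (mu A)‖ := by
      rw [← Av_pow_const (T ×ˢ T) hTT (fun p => p.1 - p.2) k
        ‖conv (mu (submoduleFinset V)) (mu A)‖ 0]
      refine Av_pow_mono _ _ k (fun y => ?_) 0
      rw [← Av_const (A₁ ×ˢ A₂) hAA (fun p => p.1 - p.2)
        ‖conv (mu (submoduleFinset V)) (mu A)‖ y]
      exact Av_mono _ _ (fun z => Av_le_norm A hA V z) y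
    have s8 : 2 * ((q : ℝ) ^ n / A.card) / 4 ^ k ≤ ε / 2 := by
      rw [div_le_iff₀ (by positivity)]; linarith
    have s9 : (1 + 4 * ε) * (1 - 3 / 2 * ε) ≤ (1 + 4 * ε) * (P ^ k) (D (indic S)) 0 := by
      gcongr
    have s10 : 1 + ε ≤ (1 + 4 * ε) * (1 - 3 / 2 * ε) := by nlinarith
    have : 1 + ε / 2 ≤ ‖conv (mu (submoduleFinset V)) (mu A)‖ := by linarith
    exact this

lemma card_le_pow (A : Finset (Fin n → ZMod q)) : (A.card : ℝ) ≤ (q : ℝ) ^ n := by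
  rw [← card_vec]; exact_mod_cast Finset.card_le_univ A

lemma lo_eq (A : Finset (Fin n → ZMod q)) (hA : A.Nonempty) :
    lo ((A.card : ℝ) / (q : ℝ) ^ n) = Real.log 2 + Real.log ((q : ℝ) ^ n / A.card) ∧
    0 ≤ Real.log ((q : ℝ) ^ n / A.card) := by
  have hN : (0 : ℝ) < (q : ℝ) ^ n := by
    have := (Fact.out : q.Prime).pos
    positivity
  have hc : (0 : ℝ) < A.card := by exact_mod_cast hA.card_pos
  constructor
  · rw [lo, ← Real.log_mul (by norm_num) (by positivity)]
    congr 1; field_simp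
  · apply Real.log_nonneg
    rw [one_le_div hc]
    exact card_le_pow A

end fourier

/-- **Lemma 2 (improved bootstrapping, `𝔽_q^n` case)**: for every `ε ∈ (0,1/8)` there is
`C = C(ε) > 0` such that whenever `S ⊆ 𝔽_q^n` and nonempty `A, A₁, A₂ ⊆ 𝔽_q^n` of densities
`α, α₁, α₂` satisfy `⟨μ_{A₁} ∘ μ_{A₂}, 1_S⟩ ≥ 1 − ε` and `μ_A ∘ μ_A(x) ≥ 1 + 4ε` on `S`, there
is a subspace `V` of codimension at most `C ⌞α⌟² ⌞α₁⌟ ⌞α₂⌟` with `‖μ_V ∗ μ_A‖_∞ ≥ 1 + ε/2`. -/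
theorem symmetry_subspace :
    ∀ ε : ℝ, 0 < ε → ε < 1 / 8 →
      ∃ C : ℝ, 0 < C ∧
        ∀ (q n : ℕ) [Fact q.Prime], 0 < n →
          ∀ (S A A₁ A₂ : Finset (Fin n → ZMod q)),
            A.Nonempty → A₁.Nonempty → A₂.Nonempty →
            ∀ α α₁ α₂ : ℝ,
              α = (A.card : ℝ) / (q : ℝ) ^ n →
              α₁ = (A₁.card : ℝ) / (q : ℝ) ^ n →
              α₂ = (A₂.card : ℝ) / (q : ℝ) ^ n →
              nip (dconv (mu A₁) (mu A₂)) (indic S) ≥ 1 - ε →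
              (∀ x ∈ S, dconv (mu A) (mu A) x ≥ 1 + 4 * ε) →
              ∃ V : Submodule (ZMod q) (Fin n → ZMod q),
                ((n : ℝ) - Module.finrank (ZMod q) V) ≤ C * lo α ^ 2 * lo α₁ * lo α₂ ∧
                ‖conv (mu (submoduleFinset V)) (mu A)‖ ≥ 1 + ε / 2 := by
  intro ε hε hε8
  set K : ℝ := 1 + 2 * (Real.log (2 / ε) + 1) with hK
  have hlε : 0 ≤ Real.log (2 / ε) := Real.log_nonneg (by rw [one_le_div hε]; linarith)
  have hK0 : 0 < K := by positivity
  have hl2 : (1 / 2 : ℝ) < Real.log 2 := by linarith [Real.log_two_gt_d9]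
  refine ⟨8 * (64 / ε ^ 2 + 2) * K ^ 2, by positivity, ?_⟩
  intro q n _ hn S A A₁ A₂ hA h₁ h₂ α α₁ α₂ hα hα₁ hα₂ hS hQ
  subst hα hα₁ hα₂
  have hN : (0 : ℝ) < (q : ℝ) ^ n := by
    have := (Fact.out : q.Prime).pos
    positivity
  have hc : (0 : ℝ) < A.card := by exact_mod_cast hA.card_pos
  have hc₁ : (0 : ℝ) < A₁.card := by exact_mod_cast h₁.card_pos
  have hc₂ : (0 : ℝ) < A₂.card := by exact_mod_cast h₂.card_pos
  obtain ⟨eL, eL0⟩ := lo_eq A hA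
  obtain ⟨eL₁, eL₁0⟩ := lo_eq A₁ h₁
  obtain ⟨eL₂, eL₂0⟩ := lo_eq A₂ h₂
  set L := lo ((A.card : ℝ) / (q : ℝ) ^ n) with hL
  set L₁ := lo ((A₁.card : ℝ) / (q : ℝ) ^ n) with hL₁
  set L₂ := lo ((A₂.card : ℝ) / (q : ℝ) ^ n) with hL₂
  have hLpos : 1 / 2 < L := by linarith
  have hL₁pos : 1 / 2 < L₁ := by linarith
  have hL₂pos : 1 / 2 < L₂ := by linarith
  -- the parameter `k`
  set k : ℕ := ⌈Real.log (2 / ε) + L⌉₊ with hk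
  have hk1 : Real.log (2 / ε) + L ≤ k := Nat.le_ceil _
  have hk2 : (k : ℝ) ≤ K * L := by
    have := (Nat.ceil_lt_add_one (show 0 ≤ Real.log (2 / ε) + L by linarith)).le
    rw [← hk] at this
    rw [hK]
    nlinarith
  have hkpos : 0 < k := Nat.ceil_pos.mpr (by linarith)
  have hk0 : (1 : ℝ) ≤ k := by exact_mod_cast hkpos
  have hk4 : 4 * ((q : ℝ) ^ n / A.card) ≤ ε * 4 ^ k := by
    have h1 : Real.exp (Real.log (2 / ε) + L) ≤ 4 ^ k := by
      calc _ ≤ Real.exp k := Real.exp_le_exp.mpr hk1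
        _ = Real.exp 1 ^ k := by rw [← Real.exp_nat_mul, mul_one]
        _ ≤ 4 ^ k := by
            gcongr
            linarith [Real.exp_one_lt_d9]
    rw [eL, Real.exp_add, Real.exp_add, Real.exp_log (by positivity), Real.exp_log (by positivity),
      Real.exp_log (by positivity)] at h1
    calc 4 * ((q : ℝ) ^ n / A.card) = ε * (2 / ε * (2 * ((q : ℝ) ^ n / A.card))) := by
          field_simp; norm_num
      _ ≤ _ := by gcongr
  -- the parameter `m`
  set δ : ℝ := ε / (4 * k) with hδ
  have hδ0 : 0 < δ := by positivity
  have hl4 : Real.log (4 * (q : ℝ) ^ n / A₂.card) ≤ 2 * L₂ := by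
    have : Real.log (4 * (q : ℝ) ^ n / A₂.card) = Real.log 2 + L₂ := by
      rw [eL₂, ← add_assoc, ← Real.log_mul (by norm_num) (by norm_num),
        ← Real.log_mul (by norm_num) (by positivity)]
      congr 1; ring
    linarith
  set m : ℕ := ⌈4 * L₂ / δ ^ 2⌉₊ with hm
  have hmpos : 0 < m := Nat.ceil_pos.mpr (by positivity)
  have hm1 : 4 * L₂ ≤ m * δ ^ 2 := by
    have := Nat.le_ceil (4 * L₂ / δ ^ 2)
    rwa [div_le_iff₀ (by positivity)] at this
  have hm2 : (m : ℝ) ≤ (64 / ε ^ 2 + 2) * k ^ 2 * L₂ := by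
    have := (Nat.ceil_lt_add_one (show 0 ≤ 4 * L₂ / δ ^ 2 by positivity)).le
    rw [← hm] at this
    have e : 4 * L₂ / δ ^ 2 = 64 / ε ^ 2 * k ^ 2 * L₂ := by
      rw [hδ]; field_simp; norm_num
    rw [e] at this
    have hk2' : (1 : ℝ) ≤ (k : ℝ) ^ 2 := one_le_pow₀ hk0
    nlinarith
  have hm0 : (1 : ℝ) ≤ m := by exact_mod_cast hmpos
  obtain ⟨V, hV1, hV2⟩ := main_param ε hε hε8 S A A₁ A₂ hA h₁ h₂ hS hQ k m hkpos hmpos hk4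
    (by linarith)
  refine ⟨V, hV1.trans ?_, hV2⟩
  calc 8 * (Real.log 2 + m * Real.log ((q : ℝ) ^ n / A₁.card)) ≤ 8 * (m * L₁) := by
        rw [eL₁]; nlinarith
    _ ≤ 8 * ((64 / ε ^ 2 + 2) * (K * L) ^ 2 * L₂ * L₁) := by
        gcongr
        refine hm2.trans ?_
        gcongr
    _ = _ := by ring
end
end

section
/- For every ε ∈ (0,1) there is a constant C = C(ε) > 0 such that the following holds. Let q be any prime, n ≥ 1, and let A, C' ⊆ 𝔽_q^n be nonempty sets with densities α = |A|/q^n and γ = |C'|/q^n. Then either (1) |⟨μ_A ∗ μ_A, μ_{C'}⟩ − 1| ≤ ε, or (2) there is a linear subspace V ≤ 𝔽_q^n of codimension at most C·⌞α⌟⁴·⌞γ⌟² such that ‖1_A ∗ μ_V‖_∞ ≥ (1 + ε/64)·α. -/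
open Finset

noncomputable section

section Moments
set_option linter.unusedSectionVars false
variable {G : Type*} [AddCommGroup G] [Fintype G] [DecidableEq G]

lemma km_autocorr_moment (g : G → ℝ) (k : ℕ) :
    (Fintype.card G : ℝ) * ∑ x, (∑ y, g y * g (y + x)) ^ k =
      ∑ y : Fin k → G, (∑ t, ∏ i, g (y i + t)) ^ 2 := by
  have h1 : ∀ x t : G, (∑ y, g y * g (y + x)) ^ k =
      ∑ y : Fin k → G, (∏ i, g (y i + t)) * ∏ i, g (y i + t + x) := by
    intro x t
    rw [Finset.sum_pow', Fintype.piFinset_univ]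
    rw [← Equiv.sum_comp (Equiv.addRight (fun _ : Fin k => t))]
    refine Finset.sum_congr rfl fun y _ => ?_
    simp [Finset.prod_mul_distrib]
  calc (Fintype.card G : ℝ) * ∑ x, (∑ y, g y * g (y + x)) ^ k
      = ∑ t : G, ∑ x, (∑ y, g y * g (y + x)) ^ k := by simp
    _ = ∑ t : G, ∑ x, ∑ y : Fin k → G, (∏ i, g (y i + t)) * ∏ i, g (y i + t + x) := by
        refine Finset.sum_congr rfl fun t _ => Finset.sum_congr rfl fun x _ => h1 x t
    _ = ∑ t : G, ∑ x, ∑ y : Fin k → G, (∏ i, g (y i + t)) * ∏ i, g (y i + x) := by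
        refine Finset.sum_congr rfl fun t _ => ?_
        rw [← Equiv.sum_comp (Equiv.addLeft t)
          (fun x => ∑ y : Fin k → G, (∏ i, g (y i + t)) * ∏ i, g (y i + x))]
        simp [add_assoc]
    _ = ∑ y : Fin k → G, ∑ t : G, ∑ x, (∏ i, g (y i + t)) * ∏ i, g (y i + x) := by
        rw [Finset.sum_comm' (t' := univ) (s' := fun _ => univ) (by simp)]
        rw [Finset.sum_congr rfl (fun x _ => Finset.sum_comm)]
        rw [Finset.sum_comm]
        refine Finset.sum_congr rfl fun y _ => ?_
        rw [Finset.sum_comm]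
    _ = _ := by
        refine Finset.sum_congr rfl fun y _ => ?_
        rw [sq, Finset.sum_mul_sum]

lemma km_conv_moment (g : G → ℝ) (k : ℕ) :
    (Fintype.card G : ℝ) * ∑ x, (∑ y, g y * g (x - y)) ^ k =
      ∑ y : Fin k → G, (∑ t, ∏ i, g (y i + t)) * (∑ t, ∏ i, g ((-y) i + t)) := by
  have h1 : ∀ x t : G, (∑ y, g y * g (x - y)) ^ k =
      ∑ y : Fin k → G, (∏ i, g (y i + t)) * ∏ i, g ((-y) i + (x - t)) := by
    intro x t
    rw [Finset.sum_pow', Fintype.piFinset_univ]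
    rw [← Equiv.sum_comp (Equiv.addRight (fun _ : Fin k => t))]
    refine Finset.sum_congr rfl fun y _ => ?_
    simp only [Equiv.coe_addRight, Pi.add_apply, Finset.prod_mul_distrib, Pi.neg_apply]
    congr 1
    refine Finset.prod_congr rfl fun i _ => ?_
    congr 1; abel
  calc (Fintype.card G : ℝ) * ∑ x, (∑ y, g y * g (x - y)) ^ k
      = ∑ t : G, ∑ x, (∑ y, g y * g (x - y)) ^ k := by simp
    _ = ∑ t : G, ∑ x, ∑ y : Fin k → G, (∏ i, g (y i + t)) * ∏ i, g ((-y) i + (x - t)) := by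
        refine Finset.sum_congr rfl fun t _ => Finset.sum_congr rfl fun x _ => h1 x t
    _ = ∑ t : G, ∑ x, ∑ y : Fin k → G, (∏ i, g (y i + t)) * ∏ i, g ((-y) i + x) := by
        refine Finset.sum_congr rfl fun t _ => ?_
        rw [← Equiv.sum_comp (Equiv.subRight t)
          (fun x => ∑ y : Fin k → G, (∏ i, g (y i + t)) * ∏ i, g ((-y) i + x))]
        simp
    _ = ∑ y : Fin k → G, ∑ t : G, ∑ x, (∏ i, g (y i + t)) * ∏ i, g ((-y) i + x) := by
        rw [Finset.sum_comm' (t' := univ) (s' := fun _ => univ) (by simp)]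
        rw [Finset.sum_congr rfl (fun x _ => Finset.sum_comm)]
        rw [Finset.sum_comm]
        refine Finset.sum_congr rfl fun y _ => ?_
        rw [Finset.sum_comm]
    _ = _ := by
        refine Finset.sum_congr rfl fun y _ => ?_
        rw [Finset.sum_mul_sum]

lemma km_card_pos : (0:ℝ) < (Fintype.card G : ℝ) := by
  exact_mod_cast Fintype.card_pos_iff.mpr ⟨0⟩

lemma km_autocorr_nonneg (g : G → ℝ) (k : ℕ) : 0 ≤ ∑ x, (∑ y, g y * g (y + x)) ^ k := by
  have h := km_autocorr_moment g k
  have h2 : 0 ≤ ∑ y : Fin k → G, (∑ t, ∏ i, g (y i + t)) ^ 2 :=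
    Finset.sum_nonneg fun _ _ => sq_nonneg _
  rw [← h] at h2
  exact nonneg_of_mul_nonneg_right h2 km_card_pos

lemma km_conv_le_autocorr (g : G → ℝ) (k : ℕ) :
    ∑ x, (∑ y, g y * g (x - y)) ^ k ≤ ∑ x, (∑ y, g y * g (y + x)) ^ k := by
  refine le_of_mul_le_mul_left ?_ (km_card_pos (G := G))
  rw [km_conv_moment, km_autocorr_moment]
  have h3 : ∑ y : Fin k → G, (∑ t, ∏ i, g ((-y) i + t)) ^ 2 =
      ∑ y : Fin k → G, (∑ t, ∏ i, g (y i + t)) ^ 2 :=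
    Equiv.sum_comp (Equiv.neg (Fin k → G)) (fun y => (∑ t, ∏ i, g (y i + t)) ^ 2)
  have h4 : ∑ y : Fin k → G, (∑ t, ∏ i, g (y i + t)) * (∑ t, ∏ i, g ((-y) i + t)) ≤
      ∑ y : Fin k → G, ((∑ t, ∏ i, g (y i + t)) ^ 2 + (∑ t, ∏ i, g ((-y) i + t)) ^ 2) / 2 := by
    refine Finset.sum_le_sum fun y _ => ?_
    nlinarith [sq_nonneg ((∑ t, ∏ i, g (y i + t)) - (∑ t, ∏ i, g ((-y) i + t)))]
  refine h4.trans ?_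
  rw [← Finset.sum_div, Finset.sum_add_distrib, h3]
  linarith

/-- normalized autocorrelation of `mu A` -/
def Fcor (A : Finset G) (x : G) : ℝ :=
  (∑ y, mu A y * mu A (y + x)) / (Fintype.card G : ℝ)

lemma sum_mu_s8 {A : Finset G} (hA : A.Nonempty) : ∑ x, mu A x = (Fintype.card G : ℝ) := by
  have : (A.card : ℝ) ≠ 0 := by exact_mod_cast hA.card_pos.ne'
  simp only [mu, Finset.sum_ite_mem, Finset.univ_inter, Finset.sum_const, nsmul_eq_mul]
  field_simp

lemma Fcor_eq {A : Finset G} (hA : A.Nonempty) (x : G) :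
    Fcor A x = 1 + (∑ y, (mu A y - 1) * (mu A (y + x) - 1)) / (Fintype.card G : ℝ) := by
  have hN := (km_card_pos (G := G)).ne'
  have h2 : ∑ y, mu A (y + x) = (Fintype.card G : ℝ) := by
    rw [← sum_mu_s8 hA]; exact Equiv.sum_comp (Equiv.addRight x) (mu A)
  have : ∑ y, (mu A y - 1) * (mu A (y + x) - 1) =
      ∑ y, mu A y * mu A (y + x) - Fintype.card G := by
    have : ∀ y, (mu A y - 1) * (mu A (y + x) - 1) =
      mu A y * mu A (y + x) - mu A y - mu A (y+x) + 1 := fun y => by ring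
    simp only [this, Finset.sum_add_distrib, Finset.sum_sub_distrib, sum_mu_s8 hA, h2]
    simp
  rw [this, Fcor]; field_simp; ring

lemma conv_eq {A : Finset G} (hA : A.Nonempty) (x : G) :
    conv (mu A) (mu A) x =
      1 + (∑ y, (mu A y - 1) * (mu A (x - y) - 1)) / (Fintype.card G : ℝ) := by
  have hN := (km_card_pos (G := G)).ne'
  have h2 : ∑ y, mu A (x - y) = (Fintype.card G : ℝ) := by
    rw [← sum_mu_s8 hA]; exact Equiv.sum_comp (Equiv.subLeft x) (mu A)
  have : ∑ y, (mu A y - 1) * (mu A (x - y) - 1) =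
      ∑ y, mu A y * mu A (x - y) - Fintype.card G := by
    have : ∀ y, (mu A y - 1) * (mu A (x - y) - 1) =
      mu A y * mu A (x - y) - mu A y - mu A (x - y) + 1 := fun y => by ring
    simp only [this, Finset.sum_add_distrib, Finset.sum_sub_distrib, sum_mu_s8 hA, h2]
    simp
  rw [this, conv]; field_simp; ring

lemma nip_mu {C : Finset G} (h : G → ℝ) :
    nip h (mu C) = (∑ x ∈ C, h x) / C.card := by
  have hN := (km_card_pos (G := G)).ne'
  simp only [nip, mu, mul_ite, mul_zero, Finset.sum_ite_mem, Finset.univ_inter]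
  rw [← Finset.sum_mul]
  field_simp

lemma km_moment {A C : Finset G} (hA : A.Nonempty) (hC : C.Nonempty) {ε : ℝ} (hε : 0 < ε)
    (hε1 : ε ≤ 1) (h : ε < |nip (conv (mu A) (mu A)) (mu C) - 1|) (m : ℕ) :
    (C.card : ℝ) / 2 * (1 + ε) ^ m ≤ ∑ x, Fcor A x ^ m := by
  have hN := (km_card_pos (G := G))
  have hc : (0:ℝ) < C.card := by exact_mod_cast hC.card_pos
  set N : ℝ := (Fintype.card G : ℝ) with hNdef
  set g : G → ℝ := fun y => mu A y - 1 with hg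
  set f : G → ℝ := fun x => (∑ y, g y * g (y + x)) / N with hf
  set c : G → ℝ := fun x => (∑ y, g y * g (x - y)) / N with hcdef
  have hf0 : ∀ k : ℕ, 0 ≤ ∑ x, f x ^ k := by
    intro k
    simp only [hf, div_pow]
    rw [← Finset.sum_div]
    exact div_nonneg (km_autocorr_nonneg g k) (by positivity)
  have hcf : ∀ k : ℕ, ∑ x, c x ^ k ≤ ∑ x, f x ^ k := by
    intro k
    simp only [hf, hcdef, div_pow]
    rw [← Finset.sum_div, ← Finset.sum_div]
    exact div_le_div_of_nonneg_right (km_conv_le_autocorr g k) (by positivity)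
  have hnip : nip (conv (mu A) (mu A)) (mu C) - 1 = ∑ x ∈ C, (1 / (C.card : ℝ)) * c x := by
    rw [nip_mu, Finset.sum_congr rfl (fun x _ => conv_eq hA x), Finset.sum_add_distrib,
      ← Finset.mul_sum]
    simp only [Finset.sum_const, nsmul_eq_mul, mul_one]
    field_simp
    ring
  have heven : ∀ k : ℕ, Even k → C.card * ε ^ k ≤ ∑ x, f x ^ k := by
    intro k hk
    have h1 : ε ^ k ≤ (∑ x ∈ C, (1 / (C.card : ℝ)) * c x) ^ k := by
      rw [← hnip, ← hk.pow_abs (nip _ _ - 1)]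
      exact pow_le_pow_left₀ hε.le h.le k
    have h2 := Real.pow_arith_mean_le_arith_mean_pow_of_even C (fun _ => 1 / (C.card : ℝ)) c
      (fun _ _ => by positivity) (by simp; field_simp) hk
    have h3 : ∑ x ∈ C, c x ^ k ≤ ∑ x, c x ^ k :=
      Finset.sum_le_sum_of_subset_of_nonneg (Finset.subset_univ _)
        (fun x _ _ => hk.pow_nonneg _)
    have h4 := h1.trans h2
    rw [← Finset.mul_sum, one_div, ← div_eq_inv_mul, le_div_iff₀ hc] at h4
    linarith [hcf k]
  have hterm : ∀ k : ℕ, C.card * ((ε ^ k + (-ε) ^ k) / 2) ≤ ∑ x, f x ^ k := by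
    intro k
    rcases Nat.even_or_odd k with hk | hk
    · rw [hk.neg_pow]; have := heven k hk; linarith
    · rw [hk.neg_pow]; have := hf0 k; simpa using this
  have hFf : ∀ x, Fcor A x = f x + 1 := fun x => by rw [Fcor_eq hA x, add_comm]
  have hsum : ∑ x, Fcor A x ^ m = ∑ k ∈ Finset.range (m + 1), (∑ x, f x ^ k) * (m.choose k) := by
    simp only [hFf, add_pow, one_pow, mul_one]
    rw [Finset.sum_comm]
    simp only [Finset.sum_mul]
  rw [hsum]
  calc (C.card : ℝ) / 2 * (1 + ε) ^ m
      ≤ C.card / 2 * ((ε + 1) ^ m + (-ε + 1) ^ m) := by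
        have : 0 ≤ (-ε + 1) ^ m := pow_nonneg (by linarith) m
        have h5 : (1 + ε) ^ m ≤ (ε + 1) ^ m + (-ε + 1) ^ m := by rw [add_comm 1 ε]; linarith
        exact mul_le_mul_of_nonneg_left h5 (by positivity)
    _ = ∑ k ∈ Finset.range (m + 1), (C.card * ((ε ^ k + (-ε) ^ k) / 2)) * (m.choose k) := by
        rw [add_pow, add_pow, ← Finset.sum_add_distrib, Finset.mul_sum]
        refine Finset.sum_congr rfl fun k _ => ?_
        simp only [one_pow]; ring
    _ ≤ _ := Finset.sum_le_sum fun k _ =>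
        mul_le_mul_of_nonneg_right (hterm k) (Nat.cast_nonneg _)

end Moments
section Sift
set_option linter.unusedSectionVars false
variable {G : Type*} [AddCommGroup G] [Fintype G] [DecidableEq G]

lemma km_sift_identity (i φ : G → ℝ) (m : ℕ) :
    ∑ s : Fin m → G, ∑ x, ∑ y, φ (y - x) * ((∏ j, i (x + s j)) * ∏ j, i (y + s j)) =
      (Fintype.card G : ℝ) * ∑ z, φ z * (∑ y, i y * i (y + z)) ^ m := by
  have h1 : ∀ x y : G, ∑ s : Fin m → G, φ (y - x) * ((∏ j, i (x + s j)) * ∏ j, i (y + s j)) =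
      φ (y - x) * (∑ w, i w * i (w + (y - x))) ^ m := by
    intro x y
    rw [← Finset.mul_sum]
    congr 1
    rw [← Equiv.sum_comp (Equiv.addLeft x) (fun w => i w * i (w + (y - x)))]
    rw [Finset.sum_pow', Fintype.piFinset_univ]
    refine Finset.sum_congr rfl fun s _ => ?_
    rw [← Finset.prod_mul_distrib]
    refine Finset.prod_congr rfl fun j _ => ?_
    simp only [Equiv.coe_addLeft]
    congr 2; abel
  rw [Finset.sum_comm]
  rw [Finset.sum_congr rfl (fun x _ => Finset.sum_comm)]
  simp only [h1]
  have h2 : ∀ x : G, ∑ y, φ (y - x) * (∑ w, i w * i (w + (y - x))) ^ m =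
      ∑ z, φ z * (∑ y, i y * i (y + z)) ^ m := fun x =>
    Equiv.sum_comp (Equiv.subRight x) (fun z => φ z * (∑ y, i y * i (y + z)) ^ m)
  simp [h2]

lemma km_sift {A : Finset G} (hA : A.Nonempty) (m : ℕ) (S : Finset G) {δ : ℝ} (hδ : 0 < δ)
    (h : ∑ x ∈ Sᶜ, Fcor A x ^ m ≤ δ / 2 * ∑ x, Fcor A x ^ m) :
    ∃ B : Finset G,
      ((A.card : ℝ) / Fintype.card G) ^ (2 * m) * Fintype.card G / 2 * ∑ x, Fcor A x ^ m
        ≤ (B.card : ℝ) ^ 2 ∧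
      (((B ×ˢ B).filter (fun p => p.2 - p.1 ∉ S)).card : ℝ) ≤ δ * (B.card : ℝ) ^ 2 := by
  have hN := (km_card_pos (G := G))
  have ha : (0:ℝ) < A.card := by exact_mod_cast hA.card_pos
  set N : ℝ := (Fintype.card G : ℝ) with hNdef
  set φ : G → ℝ := fun z => 1 - (if z ∈ Sᶜ then 1 else 0) / δ with hφ
  have hmu : ∀ y, mu A y = N / A.card * indic A y := by
    intro y; simp only [mu, indic]; split_ifs <;> simp [hNdef]
  have hF : ∀ z, ∑ y, indic A y * indic A (y + z) = (A.card : ℝ) ^ 2 / N * Fcor A z := by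
    intro z
    simp only [Fcor, hmu]
    have : ∀ y, N / A.card * indic A y * (N / A.card * indic A (y + z)) =
      (N / A.card) ^ 2 * (indic A y * indic A (y + z)) := fun y => by ring
    simp only [this]
    rw [← Finset.mul_sum, ← hNdef]
    field_simp
  have hid := km_sift_identity (indic A) φ m
  simp only [hF, mul_pow] at hid
  set Q : ℝ := ∑ x, Fcor A x ^ m with hQ
  have hlow : ((A.card : ℝ) ^ 2 / N) ^ m * (Q / 2) ≤
      ∑ z, φ z * (((A.card : ℝ) ^ 2 / N) ^ m * Fcor A z ^ m) := by
    have e1 : ∑ z, φ z * (((A.card : ℝ) ^ 2 / N) ^ m * Fcor A z ^ m) =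
        ((A.card : ℝ) ^ 2 / N) ^ m * (Q - (∑ x ∈ Sᶜ, Fcor A x ^ m) / δ) := by
      have : ∀ z, φ z * (((A.card : ℝ) ^ 2 / N) ^ m * Fcor A z ^ m) =
        ((A.card : ℝ) ^ 2 / N) ^ m * (Fcor A z ^ m - (if z ∈ Sᶜ then Fcor A z ^ m else 0) / δ) := by
        intro z; simp only [hφ]; split_ifs <;> ring
      simp only [this]
      rw [← Finset.mul_sum, Finset.sum_sub_distrib, ← Finset.sum_div, Finset.sum_ite_mem,
        Finset.univ_inter]
    rw [e1]
    refine mul_le_mul_of_nonneg_left ?_ (by positivity)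
    have : (∑ x ∈ Sᶜ, Fcor A x ^ m) / δ ≤ Q / 2 := by
      rw [div_le_iff₀ hδ]; linarith
    linarith
  obtain ⟨s, -, hs⟩ : ∃ s ∈ (univ : Finset (Fin m → G)),
      ((A.card : ℝ) / N) ^ (2 * m) * N / 2 * Q ≤
      ∑ x, ∑ y, φ (y - x) * ((∏ j, indic A (x + s j)) * ∏ j, indic A (y + s j)) := by
    refine Finset.exists_le_of_sum_le ⟨fun _ => 0, Finset.mem_univ _⟩ ?_
    rw [hid]
    refine le_trans (le_of_eq ?_) (mul_le_mul_of_nonneg_left hlow hN.le)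
    simp only [Finset.sum_const, Finset.card_univ, Fintype.card_pi, Finset.prod_const,
      Fintype.card_fin, nsmul_eq_mul, Nat.cast_pow, ← hNdef]
    rw [pow_mul, div_pow, div_pow, div_pow]
    have : N ^ m ≠ 0 := by positivity
    field_simp
    ring
  set B : Finset G := univ.filter (fun x => ∀ j, x + s j ∈ A) with hB
  have hind : ∀ x, ∏ j, indic A (x + s j) = if x ∈ B then (1:ℝ) else 0 := by
    intro x
    simp only [indic, hB, Finset.mem_filter, Finset.mem_univ, true_and]
    split_ifs with hx
    · exact Finset.prod_eq_one fun j _ => by simp [hx j]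
    · push Not at hx
      obtain ⟨j, hj⟩ := hx
      exact Finset.prod_eq_zero (Finset.mem_univ j) (by simp [hj])
  have hval : ∑ x, ∑ y, φ (y - x) * ((∏ j, indic A (x + s j)) * ∏ j, indic A (y + s j)) =
      (B.card : ℝ) ^ 2 - (((B ×ˢ B).filter (fun p => p.2 - p.1 ∉ S)).card : ℝ) / δ := by
    simp only [hind]
    have e : ∀ x y : G, φ (y - x) * ((if x ∈ B then (1:ℝ) else 0) * (if y ∈ B then (1:ℝ) else 0)) =
      if x ∈ B then (if y ∈ B then φ (y - x) else 0) else 0 := by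
      intro x y; split_ifs <;> simp
    simp only [e]
    have e2 : ∀ x : G, ∑ y, (if x ∈ B then (if y ∈ B then φ (y - x) else 0) else 0) =
      if x ∈ B then ∑ y ∈ B, φ (y - x) else 0 := by
      intro x; split_ifs <;> simp [Finset.sum_ite_mem]
    simp only [e2]
    rw [Finset.sum_ite_mem, Finset.univ_inter, ← Finset.sum_product']
    simp only [hφ, Finset.sum_sub_distrib, ← Finset.sum_div]
    have e3 : (((B ×ˢ B).filter (fun p => p.2 - p.1 ∉ S)).card : ℝ) =
        ∑ p ∈ B ×ˢ B, (if p.2 - p.1 ∈ Sᶜ then (1:ℝ) else 0) := by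
      rw [Finset.card_filter]; push_cast; simp only [Finset.mem_compl]
    rw [e3, Finset.sum_const, Finset.card_product, nsmul_eq_mul, mul_one, sq, Nat.cast_mul]
  rw [hval] at hs
  have hQ0 : 0 ≤ Q := Finset.sum_nonneg fun x _ => by
    refine pow_nonneg (div_nonneg (Finset.sum_nonneg fun y _ => ?_) hN.le) _
    rw [hmu, hmu]; unfold indic; positivity
  have hX : 0 ≤ (((B ×ˢ B).filter (fun p => p.2 - p.1 ∉ S)).card : ℝ) / δ := by positivity
  have h0 : 0 ≤ ((A.card : ℝ) / N) ^ (2 * m) * N / 2 * Q := by positivity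
  refine ⟨B, by linarith, ?_⟩
  have : (((B ×ˢ B).filter (fun p => p.2 - p.1 ∉ S)).card : ℝ) / δ ≤ (B.card : ℝ) ^ 2 := by linarith
  rw [div_le_iff₀ hδ] at this
  linarith
end Sift
section CrootSisask
set_option linter.unusedSectionVars false
variable {G : Type*} [AddCommGroup G] [Fintype G] [DecidableEq G]

lemma km_mgf {B : Finset G} (X : G → ℝ) (hX : ∀ b ∈ B, |X b| ≤ 1)
    (h0 : ∑ b ∈ B, X b = 0) (lam : ℝ) (M : ℕ) :
    ∑ l ∈ Fintype.piFinset (fun _ : Fin M => B), Real.exp (lam * ∑ i, X (l i)) ≤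
      (B.card : ℝ) ^ M * Real.exp (M * (lam ^ 2 / 2)) := by
  have h1 : ∑ l ∈ Fintype.piFinset (fun _ : Fin M => B), Real.exp (lam * ∑ i, X (l i)) =
      (∑ b ∈ B, Real.exp (lam * X b)) ^ M := by
    rw [Finset.sum_pow']
    refine Finset.sum_congr rfl fun l _ => ?_
    rw [Finset.mul_sum, Real.exp_sum]
  have h2 : ∑ b ∈ B, Real.exp (lam * X b) ≤ B.card * Real.exp (lam ^ 2 / 2) := by
    calc ∑ b ∈ B, Real.exp (lam * X b)
        ≤ ∑ b ∈ B, (Real.cosh lam + X b * Real.sinh lam) := by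
          refine Finset.sum_le_sum fun b hb => ?_
          have := Real.exp_mul_le_cosh_add_mul_sinh (hX b hb) lam
          rwa [mul_comm] at this
      _ = B.card * Real.cosh lam := by
          rw [Finset.sum_add_distrib, ← Finset.sum_mul, h0]; simp
      _ ≤ _ := by
          gcongr
          exact Real.cosh_le_exp_half_sq lam
  rw [h1, Real.exp_nat_mul, ← mul_pow]
  exact pow_le_pow_left₀ (Finset.sum_nonneg fun _ _ => (Real.exp_pos _).le) h2 M

lemma km_hoeffding {B : Finset G} (X : G → ℝ) (hX : ∀ b ∈ B, |X b| ≤ 1)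
    (h0 : ∑ b ∈ B, X b = 0) {η : ℝ} (hη : 0 ≤ η) (M : ℕ) :
    (((Fintype.piFinset (fun _ : Fin M => B)).filter
      (fun l => M * η < |∑ i, X (l i)|)).card : ℝ) ≤
      2 * Real.exp (-(M * η ^ 2 / 2)) * (B.card : ℝ) ^ M := by
  set P := Fintype.piFinset (fun _ : Fin M => B) with hP
  have h1 := km_mgf X hX h0 η M
  have h2 := km_mgf X hX h0 (-η) M
  have h3 : ((P.filter (fun l => M * η < |∑ i, X (l i)|)).card : ℝ) * Real.exp (M * η ^ 2) ≤
      ∑ l ∈ P, (Real.exp (η * ∑ i, X (l i)) + Real.exp (-η * ∑ i, X (l i))) := by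
    have hsub : ∑ l ∈ P.filter (fun l => M * η < |∑ i, X (l i)|),
        (Real.exp (η * ∑ i, X (l i)) + Real.exp (-η * ∑ i, X (l i))) ≤
        ∑ l ∈ P, (Real.exp (η * ∑ i, X (l i)) + Real.exp (-η * ∑ i, X (l i))) :=
      Finset.sum_le_sum_of_subset_of_nonneg (Finset.filter_subset _ _) fun l _ _ =>
        add_nonneg (Real.exp_pos _).le (Real.exp_pos _).le
    refine le_trans ?_ hsub
    rw [← nsmul_eq_mul]
    refine Finset.card_nsmul_le_sum _ _ _ ?_
    intro l hl
    have hl2 := (Finset.mem_filter.1 hl).2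
    have p1 := Real.exp_pos (η * ∑ i, X (l i))
    have p2 := Real.exp_pos (-η * ∑ i, X (l i))
    rcases lt_abs.1 hl2 with h | h
    · have : Real.exp (M * η ^ 2) ≤ Real.exp (η * ∑ i, X (l i)) := by
        apply Real.exp_le_exp.2; nlinarith
      linarith
    · have : Real.exp (M * η ^ 2) ≤ Real.exp (-η * ∑ i, X (l i)) := by
        apply Real.exp_le_exp.2; nlinarith
      linarith
  rw [Finset.sum_add_distrib] at h3
  rw [neg_sq] at h2
  have h4 := h3.trans (add_le_add h1 h2)
  have e : Real.exp (M * η ^ 2) = Real.exp (M * (η ^ 2 / 2)) * Real.exp (M * η ^ 2 / 2) := by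
    rw [← Real.exp_add]; ring_nf
  have e2 : Real.exp (-(M * η ^ 2 / 2)) = (Real.exp (M * η ^ 2 / 2))⁻¹ := Real.exp_neg _
  have p := Real.exp_pos (M * η ^ 2 / 2)
  have p' := Real.exp_pos (M * (η ^ 2 / 2))
  rw [e2, mul_right_comm, ← div_eq_mul_inv, le_div_iff₀ p]
  rw [e] at h4
  refine le_of_mul_le_mul_right ?_ p'
  calc _ = _ := by ring
    _ ≤ _ := h4
    _ = _ := by ring

lemma km_croot_sisask {B : Finset G} (hB : B.Nonempty) (f : G → ℝ) (hf0 : ∀ x, 0 ≤ f x)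
    (hf1 : ∀ x, f x ≤ 1) {η : ℝ} (hη : 0 < η) {M : ℕ} (hM : 0 < M) (g : G → ℝ)
    (hg : ∀ x, g x = (∑ b ∈ B, f (x + b)) / B.card) :
    ∃ T : Finset G, 1 / 2 * ((B.card : ℝ) / Fintype.card G) ^ M * Fintype.card G ≤ T.card ∧
      ∀ t ∈ T, ∀ t' ∈ T, ∀ y, ∑ b ∈ B, |g (y - b + (t - t')) - g (y - b)| ≤
        2 * η * B.card + 8 * Real.exp (-(M * η ^ 2 / 2)) * Fintype.card G := by
  have hN := (km_card_pos (G := G))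
  have hb : (0:ℝ) < B.card := by exact_mod_cast hB.card_pos
  have hM' : (0:ℝ) < M := by exact_mod_cast hM
  set N : ℝ := (Fintype.card G : ℝ) with hNdef
  have hg0 : ∀ x, 0 ≤ g x := fun x => by
    rw [hg]; exact div_nonneg (Finset.sum_nonneg fun _ _ => hf0 _) hb.le
  have hg1 : ∀ x, g x ≤ 1 := fun x => by
    rw [hg, div_le_one hb]
    calc ∑ b ∈ B, f (x + b) ≤ ∑ b ∈ B, (1:ℝ) := Finset.sum_le_sum fun _ _ => hf1 _
      _ = _ := by simp
  set E := Real.exp (-(M * η ^ 2 / 2)) with hE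
  have hEp : 0 < E := Real.exp_pos _
  set P := Fintype.piFinset (fun _ : Fin M => B) with hP
  have hPc : (P.card : ℝ) = (B.card : ℝ) ^ M := by simp [hP]
  -- deviation
  set bad : (Fin M → G) → G → Prop := fun l x => M * η < |∑ i, (f (x + l i) - g x)| with hbad
  classical
  have hx : ∀ x, ((P.filter (fun l => bad l x)).card : ℝ) ≤ 2 * E * (B.card : ℝ) ^ M := by
    intro x
    refine km_hoeffding (B := B) (fun b => f (x + b) - g x) ?_ ?_ hη.le M
    · intro b _
      rw [abs_le]
      constructor <;> linarith [hf0 (x + b), hf1 (x + b), hg0 x, hg1 x]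
    · rw [Finset.sum_sub_distrib, hg x]
      simp only [Finset.sum_const, nsmul_eq_mul]
      field_simp
      ring
  set L := P.filter (fun l => ((univ.filter (fun x => bad l x)).card : ℝ) ≤ 4 * E * N) with hL
  have hdc : ∑ l ∈ P, ((univ.filter (fun x => bad l x)).card : ℝ) ≤
      N * (2 * E * (B.card : ℝ) ^ M) := by
    have : ∑ l ∈ P, ((univ.filter (fun x => bad l x)).card : ℝ) =
        ∑ x : G, ((P.filter (fun l => bad l x)).card : ℝ) := by
      simp only [Finset.card_filter, Nat.cast_sum]
      rw [Finset.sum_comm]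
    rw [this]
    refine (Finset.sum_le_sum fun x _ => hx x).trans ?_
    simp [hNdef]
  have hLc : (B.card : ℝ) ^ M / 2 ≤ L.card := by
    have h1 : ((P.filter (fun l => ¬ ((univ.filter (fun x => bad l x)).card : ℝ) ≤
        4 * E * N)).card : ℝ) * (4 * E * N) ≤
        ∑ l ∈ P, ((univ.filter (fun x => bad l x)).card : ℝ) := by
      rw [← nsmul_eq_mul, ← Finset.sum_const]
      refine (Finset.sum_le_sum (g := fun l => ((univ.filter (fun x => bad l x)).card : ℝ)) ?_).trans
        (Finset.sum_le_sum_of_subset_of_nonneg (Finset.filter_subset _ _) fun _ _ _ => by positivity)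
      intro l hl
      have := (Finset.mem_filter.1 hl).2
      push Not at this
      exact this.le
    have h2 := Finset.card_filter_add_card_filter_not (s := P)
      (fun l => ((univ.filter (fun x => bad l x)).card : ℝ) ≤ 4 * E * N)
    have h3 : (L.card : ℝ) + ((P.filter (fun l => ¬ ((univ.filter (fun x => bad l x)).card : ℝ) ≤
        4 * E * N)).card : ℝ) = (B.card : ℝ) ^ M := by
      rw [← hPc]; exact_mod_cast h2
    have h4 := h1.trans hdc
    have h5 : ((P.filter (fun l => ¬ ((univ.filter (fun x => bad l x)).card : ℝ) ≤
        4 * E * N)).card : ℝ) ≤ (B.card : ℝ) ^ M / 2 := by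
      refine le_of_mul_le_mul_right (h4.trans (le_of_eq ?_)) (show 0 < 4 * E * N by positivity)
      ring
    linarith
  -- pigeonhole
  have hpig : ∑ u : Fin M → G, ((univ.filter (fun t : G => (fun i => u i + t) ∈ L)).card : ℝ) =
      N * L.card := by
    simp only [Finset.card_filter, Nat.cast_sum]
    rw [Finset.sum_comm]
    have : ∀ t : G, ∑ u : Fin M → G, (((if (fun i => u i + t) ∈ L then 1 else 0) : ℕ) : ℝ) =
        L.card := by
      intro t
      have := Equiv.sum_comp (Equiv.addRight (fun _ : Fin M => t))
        (fun u => (((if u ∈ L then 1 else 0) : ℕ) : ℝ))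
      rw [show (L.card : ℝ) = ∑ u : Fin M → G, (((if u ∈ L then 1 else 0) : ℕ) : ℝ) by simp]
      rw [← this]
      rfl
    rw [Finset.sum_congr rfl (fun t _ => this t)]
    simp [hNdef]
  obtain ⟨u, -, hu⟩ : ∃ u ∈ (univ : Finset (Fin M → G)),
      1 / 2 * ((B.card : ℝ) / N) ^ M * N ≤
        ((univ.filter (fun t : G => (fun i => u i + t) ∈ L)).card : ℝ) := by
    refine Finset.exists_le_of_sum_le ⟨fun _ => 0, Finset.mem_univ _⟩ ?_
    rw [hpig]
    simp only [Finset.sum_const, Finset.card_univ, Fintype.card_pi, Finset.prod_const,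
      Fintype.card_fin, nsmul_eq_mul, Nat.cast_pow, ← hNdef]
    rw [div_pow]
    have : N ^ M ≠ 0 := by positivity
    calc N ^ M * (1 / 2 * ((B.card : ℝ) ^ M / N ^ M) * N) = N * ((B.card : ℝ) ^ M / 2) := by
          field_simp
      _ ≤ _ := mul_le_mul_of_nonneg_left hLc hN.le
  refine ⟨_, hu, ?_⟩
  intro t ht t' ht' y
  simp only [Finset.mem_filter, Finset.mem_univ, true_and, hL] at ht ht'
  set bt := univ.filter (fun x => bad (fun i => u i + t) x) with hbt
  set bt' := univ.filter (fun x => bad (fun i => u i + t') (x + (t - t'))) with hbt'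
  have hbt'c : (bt'.card : ℝ) ≤ 4 * E * N := by
    refine le_trans ?_ ht'.2
    exact_mod_cast Finset.card_le_card_of_injOn (fun x => x + (t - t'))
      (fun x hx => by simpa [hbt'] using hx) (fun a _ b _ h => by simpa using h)
  have hpt : ∀ x, |g (x + (t - t')) - g x| ≤
      2 * η + ((if x ∈ bt then 1 else 0) + (if x ∈ bt' then 1 else 0)) := by
    intro x
    have htriv : |g (x + (t - t')) - g x| ≤ 1 := by
      rw [abs_le]
      constructor <;> linarith [hg0 x, hg1 x, hg0 (x + (t - t')), hg1 (x + (t - t'))]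
    by_cases h1 : x ∈ bt
    · have : (0:ℝ) ≤ (if x ∈ bt' then 1 else 0) := by positivity
      rw [if_pos h1]; linarith
    by_cases h2 : x ∈ bt'
    · rw [if_pos h2, if_neg h1]; linarith
    rw [if_neg h1, if_neg h2]
    simp only [hbt, hbt', hbad, Finset.mem_filter, Finset.mem_univ, true_and, not_lt] at h1 h2
    have e1 : ∀ i, x + (t - t') + (u i + t') = x + (u i + t) := fun i => by abel
    simp only [e1] at h2
    have h3 : ∑ i, (f (x + (u i + t)) - g x) - ∑ i, (f (x + (u i + t)) - g (x + (t - t'))) =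
        M * (g (x + (t - t')) - g x) := by
      rw [← Finset.sum_sub_distrib]
      simp
      ring
    have h4 : M * |g (x + (t - t')) - g x| ≤ M * (2 * η) := by
      rw [← abs_of_pos hM', ← abs_mul, ← h3, abs_of_pos hM']
      refine (abs_sub _ _).trans ?_
      linarith
    have := le_of_mul_le_mul_left h4 hM'
    linarith
  calc ∑ b ∈ B, |g (y - b + (t - t')) - g (y - b)|
      ≤ ∑ b ∈ B, (2 * η + ((if y - b ∈ bt then 1 else 0) + (if y - b ∈ bt' then 1 else 0))) :=
        Finset.sum_le_sum fun b _ => hpt _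
    _ = 2 * η * B.card + (∑ b ∈ B, (if y - b ∈ bt then (1:ℝ) else 0) +
          ∑ b ∈ B, (if y - b ∈ bt' then (1:ℝ) else 0)) := by
        rw [Finset.sum_add_distrib, Finset.sum_add_distrib]; simp [mul_comm]
    _ ≤ 2 * η * B.card + (bt.card + bt'.card) := by
        have key : ∀ s : Finset G, ∑ b ∈ B, (if y - b ∈ s then (1:ℝ) else 0) ≤ s.card := by
          intro s
          calc ∑ b ∈ B, (if y - b ∈ s then (1:ℝ) else 0)
              ≤ ∑ b : G, (if y - b ∈ s then (1:ℝ) else 0) :=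
                Finset.sum_le_sum_of_subset_of_nonneg (Finset.subset_univ _)
                  fun _ _ _ => by positivity
            _ = ∑ b : G, (if b ∈ s then (1:ℝ) else 0) :=
                Equiv.sum_comp (Equiv.subLeft y) (fun b => (if b ∈ s then (1:ℝ) else 0))
            _ = _ := by simp
        gcongr
        · exact key _
        · exact key _
    _ ≤ _ := by linarith [ht.2]
end CrootSisask
section Chang
set_option linter.unusedSectionVars false
variable {G : Type*} [AddCommGroup G] [Fintype G] [DecidableEq G]

lemma km_chang {T : Finset G} (hT : T.Nonempty) (D : Finset (AddChar G ℂ))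
    (hd : AddDissociated (D : Set (AddChar G ℂ)))
    (h : ∀ ψ ∈ D, (T.card : ℝ) / 2 ≤ ‖∑ t ∈ T, ψ t‖) :
    (D.card : ℝ) ≤ 8 * Real.log (Fintype.card G / T.card) := by
  classical
  have hN := (km_card_pos (G := G))
  have ht : (0:ℝ) < T.card := by exact_mod_cast hT.card_pos
  set N : ℝ := (Fintype.card G : ℝ) with hNdef
  set c : AddChar G ℂ → ℂ := fun ψ => (starRingEnd ℂ) (∑ t ∈ T, ψ t) / ‖∑ t ∈ T, ψ t‖ with hc
  have hc1 : ∀ ψ, ‖c ψ‖ ≤ 1 := by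
    intro ψ
    simp only [hc, norm_div, RCLike.norm_conj, Complex.norm_real, norm_norm]
    exact div_self_le_one _
  have hc2 : ∀ ψ, c ψ * ∑ t ∈ T, ψ t = (‖∑ t ∈ T, ψ t‖ : ℂ) := by
    intro ψ
    simp only [hc]
    rw [div_mul_eq_mul_div, mul_comm, Complex.mul_conj, Complex.normSq_eq_norm_sq]
    by_cases h0 : ‖∑ t ∈ T, ψ t‖ = 0
    · simp [h0]
    · have : (‖∑ t ∈ T, ψ t‖ : ℂ) ≠ 0 := by exact_mod_cast h0
      push_cast
      field_simp
  set u : G → ℝ := fun a => ∑ ψ ∈ D, (c ψ * ψ a).re with hu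
  have hbound : ∀ ψ a, |(c ψ * ψ a).re| ≤ 1 := by
    intro ψ a
    refine (Complex.abs_re_le_norm _).trans ?_
    rw [norm_mul, AddChar.norm_apply, mul_one]
    exact hc1 ψ
  set sh := Real.sinh (1/2) with hsh
  set ch := Real.cosh (1/2) with hch
  have hrand := AddDissociated.randomisation (G := G) (fun ψ => if ψ ∈ D then ch else 1)
    (fun ψ => if ψ ∈ D then c ψ * sh else 0) (hd.subset (fun ψ hψ => by
      by_contra hne
      have : ψ ∉ D := hne
      simp [this] at hψ))
  have hprod : ∏ ψ : AddChar G ℂ, (if ψ ∈ D then ch else 1) = ch ^ D.card := by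
    rw [Finset.prod_ite_mem]; simp
  have hprod2 : ∀ a : G, ∏ ψ : AddChar G ℂ, ((if ψ ∈ D then ch else 1) +
      ((if ψ ∈ D then c ψ * sh else 0) * ψ a).re) = ∏ ψ ∈ D, (ch + (c ψ * ψ a).re * sh) := by
    intro a
    have : ∀ ψ : AddChar G ℂ, ((if ψ ∈ D then ch else 1) +
      ((if ψ ∈ D then c ψ * sh else 0) * ψ a).re) =
      if ψ ∈ D then (ch + (c ψ * ψ a).re * sh) else 1 := by
      intro ψ
      split_ifs
      · rw [mul_right_comm, Complex.re_mul_ofReal]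
      · simp
    simp only [this]
    rw [Finset.prod_ite_mem]; simp
  simp only [hprod2, hprod] at hrand
  rw [Fintype.expect_eq_sum_div_card] at hrand
  have hexp : ∀ a, Real.exp (1 / 2 * u a) ≤ ∏ ψ ∈ D, (ch + (c ψ * ψ a).re * sh) := by
    intro a
    rw [hu, Finset.mul_sum, Real.exp_sum]
    refine Finset.prod_le_prod (fun _ _ => (Real.exp_pos _).le) fun ψ _ => ?_
    have := Real.exp_mul_le_cosh_add_mul_sinh (hbound ψ a) (1/2)
    rwa [mul_comm] at this
  have hup : ∑ t ∈ T, Real.exp (1 / 2 * u t) ≤ N * Real.exp ((D.card : ℝ) / 8) := by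
    calc ∑ t ∈ T, Real.exp (1 / 2 * u t) ≤ ∑ t : G, Real.exp (1 / 2 * u t) :=
          Finset.sum_le_sum_of_subset_of_nonneg (Finset.subset_univ _)
            fun _ _ _ => (Real.exp_pos _).le
      _ ≤ ∑ a : G, ∏ ψ ∈ D, (ch + (c ψ * ψ a).re * sh) := Finset.sum_le_sum fun a _ => hexp a
      _ = N * ch ^ D.card := by
          rw [div_eq_iff hN.ne'] at hrand; rw [hrand, mul_comm]
      _ ≤ N * Real.exp ((D.card : ℝ) / 8) := by
          refine mul_le_mul_of_nonneg_left ?_ hN.le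
          have h1 : ch ≤ Real.exp (1 / 8) := by
            have := Real.cosh_le_exp_half_sq (1/2)
            norm_num at this ⊢
            convert this using 2
          calc ch ^ D.card ≤ Real.exp (1/8) ^ D.card :=
                pow_le_pow_left₀ (Real.cosh_pos _).le h1 _
            _ = _ := by rw [← Real.exp_nat_mul]; ring_nf
  have hsum : (T.card : ℝ) * (D.card / 2) ≤ ∑ t ∈ T, u t := by
    rw [hu, Finset.sum_comm]
    have : ∀ ψ ∈ D, (T.card : ℝ) / 2 ≤ ∑ t ∈ T, (c ψ * ψ t).re := by
      intro ψ hψ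
      rw [← Complex.re_sum, ← Finset.mul_sum, hc2]
      simpa using h ψ hψ
    refine le_trans (le_of_eq ?_) (Finset.card_nsmul_le_sum D _ _ this)
    rw [nsmul_eq_mul]; ring
  have hlow : (T.card : ℝ) * Real.exp ((D.card : ℝ) / 4) ≤ ∑ t ∈ T, Real.exp (1 / 2 * u t) := by
    have h1 : ∀ t ∈ T, Real.exp ((D.card : ℝ) / 4) * (1 + (1 / 2 * u t - D.card / 4)) ≤
        Real.exp (1 / 2 * u t) := by
      intro t _
      have h2 := Real.add_one_le_exp (1 / 2 * u t - D.card / 4)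
      calc _ ≤ Real.exp ((D.card : ℝ) / 4) * Real.exp (1 / 2 * u t - D.card / 4) :=
            mul_le_mul_of_nonneg_left (by linarith) (Real.exp_pos _).le
        _ = _ := by rw [← Real.exp_add]; ring_nf
    refine le_trans ?_ (Finset.sum_le_sum h1)
    rw [← Finset.mul_sum, mul_comm]
    refine mul_le_mul_of_nonneg_left ?_ (Real.exp_pos _).le
    rw [Finset.sum_add_distrib, Finset.sum_sub_distrib, ← Finset.mul_sum]
    simp only [Finset.sum_const, nsmul_eq_mul]
    linarith
  have h3 := hlow.trans hup
  have h4 : Real.exp ((D.card : ℝ) / 8) ≤ N / T.card := by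
    rw [le_div_iff₀ ht]
    have e : Real.exp ((D.card : ℝ) / 4) =
        Real.exp ((D.card : ℝ) / 8) * Real.exp ((D.card : ℝ) / 8) := by
      rw [← Real.exp_add]; ring_nf
    rw [e] at h3
    refine le_of_mul_le_mul_right ?_ (Real.exp_pos ((D.card : ℝ) / 8))
    linarith
  have h5 := Real.log_le_log (Real.exp_pos _) h4
  rw [Real.log_exp] at h5
  linarith

lemma km_spec {T : Finset G} (hT : T.Nonempty) :
    ∃ D : Finset (AddChar G ℂ), (D.card : ℝ) ≤ 8 * Real.log (Fintype.card G / T.card) ∧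
      ∀ ψ : AddChar G ℂ, (T.card : ℝ) / 2 ≤ ‖∑ t ∈ T, ψ t‖ →
        ∀ x, (∀ χ ∈ D, χ x = 1) → ψ x = 1 := by
  classical
  have ht : (0:ℝ) < T.card := by exact_mod_cast hT.card_pos
  have hlog : 0 ≤ 8 * Real.log (Fintype.card G / T.card) := by
    have : 0 ≤ Real.log (Fintype.card G / T.card) := by
      apply Real.log_nonneg
      rw [le_div_iff₀ ht, one_mul]
      exact_mod_cast Finset.card_le_univ T
    linarith
  obtain ⟨D, -, hD, hspan⟩ := exists_subset_addSpan_card_le_of_forall_addDissociated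
    (s := univ.filter (fun ψ : AddChar G ℂ => (T.card : ℝ) / 2 ≤ ‖∑ t ∈ T, ψ t‖))
    (d := ⌊8 * Real.log (Fintype.card G / T.card)⌋₊) (by
      intro s' hs' hdis
      refine Nat.le_floor (km_chang hT s' hdis fun ψ hψ => ?_)
      exact (Finset.mem_filter.1 (hs' hψ)).2)
  refine ⟨D, (Nat.cast_le.2 hD).trans (Nat.floor_le hlog), ?_⟩
  intro ψ hψ x hx
  have hm := hspan (Finset.mem_filter.2 ⟨Finset.mem_univ _, hψ⟩)
  rw [Finset.mem_addSpan] at hm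
  obtain ⟨e, -, he⟩ := hm
  rw [← he, AddChar.sum_apply]
  refine Finset.prod_eq_one fun χ hχ => ?_
  have := hx χ hχ
  rcases e χ with k | k
  · simp [AddChar.nsmul_apply, this]
  · rw [negSucc_zsmul, AddChar.neg_apply, AddChar.nsmul_apply, AddChar.map_neg_eq_inv, this]
    simp
end Chang

lemma km_subspace (q n : ℕ) [Fact q.Prime] (D : Finset (AddChar (Fin n → ZMod q) ℂ)) :
    ∃ V : Submodule (ZMod q) (Fin n → ZMod q),
      (n : ℝ) - Module.finrank (ZMod q) V ≤ D.card ∧ ∀ x ∈ V, ∀ χ ∈ D, χ x = 1 := by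
  classical
  have hq : q.Prime := Fact.out
  let V : Submodule (ZMod q) (Fin n → ZMod q) :=
    { carrier := {x | ∀ χ ∈ D, χ x = 1}
      add_mem' := by
        intro a b ha hb χ hχ
        rw [AddChar.map_add_eq_mul, ha χ hχ, hb χ hχ, mul_one]
      zero_mem' := by
        intro χ _
        exact χ.map_zero_eq_one
      smul_mem' := by
        intro c x hx χ hχ
        have : c • x = c.val • x := by
          rw [← Nat.cast_smul_eq_nsmul (ZMod q), ZMod.natCast_zmod_val]
        rw [this, AddChar.map_nsmul_eq_pow, hx χ hχ, one_pow] }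
  refine ⟨V, ?_, fun x hx => hx⟩
  have hV : Fintype.card V = q ^ Module.finrank (ZMod q) V := by
    rw [Module.card_eq_pow_finrank (K := ZMod q), ZMod.card]
  let Φ : (Fin n → ZMod q) → (D → ℂ) := fun x χ => χ.1 x
  have h1 := Finset.card_le_mul_card_image (f := Φ) (univ : Finset (Fin n → ZMod q))
    (Fintype.card V) (by
      intro a ha
      obtain ⟨x0, -, rfl⟩ := Finset.mem_image.1 ha
      rw [← Finset.card_univ (α := V)]
      refine Finset.card_le_card_of_surjOn (fun v : V => v.1 + x0) ?_
      intro x hx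
      have hx' : Φ x = Φ x0 := by simpa using hx
      refine ⟨⟨x - x0, ?_⟩, by simp, by simp⟩
      intro χ hχ
      have := congrFun hx' ⟨χ, hχ⟩
      simp only [Φ] at this
      rw [AddChar.map_sub_eq_div, this]
      exact div_self (by
        intro h0
        have h1 := AddChar.norm_apply χ x0
        rw [h0, norm_zero] at h1
        exact zero_ne_one h1))
  have h2 : (univ.image Φ).card ≤ q ^ D.card := by
    have hsub : univ.image Φ ⊆ Fintype.piFinset (fun _ : D => Polynomial.nthRootsFinset q (1:ℂ)) := by
      intro a ha
      obtain ⟨x, -, rfl⟩ := Finset.mem_image.1 ha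
      rw [Fintype.mem_piFinset]
      intro χ
      rw [Polynomial.mem_nthRootsFinset hq.pos]
      simp only [Φ]
      rw [← AddChar.map_nsmul_eq_pow]
      have : q • x = 0 := by
        ext i; simp
      rw [this, AddChar.map_zero_eq_one]
    refine (Finset.card_le_card hsub).trans ?_
    rw [Fintype.card_piFinset]
    simp only [Finset.prod_const, Finset.card_univ, Fintype.card_coe]
    refine Nat.pow_le_pow_left ?_ _
    unfold Polynomial.nthRootsFinset
    exact (Multiset.toFinset_card_le _).trans (Polynomial.card_nthRoots _ _)
  have h3 : q ^ n ≤ q ^ (Module.finrank (ZMod q) V + D.card) := by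
    rw [pow_add, ← hV]
    refine le_trans (le_of_eq ?_) (h1.trans (Nat.mul_le_mul_left _ h2))
    simp [ZMod.card]
  have h4 := (Nat.pow_le_pow_iff_right hq.one_lt).1 h3
  have h5 : (n : ℝ) ≤ Module.finrank (ZMod q) V + D.card := by exact_mod_cast h4
  linarith
section Fourier
set_option linter.unusedSectionVars false
variable {G : Type*} [AddCommGroup G] [Fintype G] [DecidableEq G]

/-- averaging over differences of `T` -/
def avgT (T : Finset G) (f : G → ℝ) : G → ℝ :=
  fun x => (∑ t ∈ T, ∑ t' ∈ T, f (x + (t - t'))) / (T.card : ℝ) ^ 2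

lemma conv_mu (f : G → ℝ) (V : Finset G) (x : G) :
    conv f (mu V) x = (∑ v ∈ V, f (x - v)) / V.card := by
  have hN := (km_card_pos (G := G)).ne'
  have h1 : ∑ y, f y * mu V (x - y) = ∑ y, f (x - y) * mu V y := by
    rw [← Equiv.sum_comp (Equiv.subLeft x) (fun y => f (x - y) * mu V y)]
    simp
  simp only [conv, h1]
  simp only [mu, mul_ite, mul_zero, Finset.sum_ite_mem, Finset.univ_inter]
  rw [← Finset.sum_mul]
  field_simp

lemma avgT_mono (T : Finset G) {f g : G → ℝ} (h : ∀ x, f x ≤ g x) (x : G) :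
    avgT T f x ≤ avgT T g x := by
  unfold avgT
  refine div_le_div_of_nonneg_right ?_ (by positivity)
  exact Finset.sum_le_sum fun _ _ => Finset.sum_le_sum fun _ _ => h _

lemma avgT_iter_mono (T : Finset G) (k : ℕ) {f g : G → ℝ} (h : ∀ x, f x ≤ g x) (x : G) :
    (avgT T)^[k] f x ≤ (avgT T)^[k] g x := by
  induction k generalizing x with
  | zero => exact h x
  | succ k ih =>
    rw [Function.iterate_succ_apply', Function.iterate_succ_apply']
    exact avgT_mono T ih x

lemma avgT_smul (T : Finset G) (c : ℝ) (f : G → ℝ) :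
    avgT T (fun x => c * f x) = fun x => c * avgT T f x := by
  ext x
  simp only [avgT, ← Finset.mul_sum, mul_div_assoc]

lemma avgT_iter_smul (T : Finset G) (k : ℕ) (c : ℝ) (f : G → ℝ) :
    (avgT T)^[k] (fun x => c * f x) = fun x => c * (avgT T)^[k] f x := by
  induction k with
  | zero => rfl
  | succ k ih =>
    rw [Function.iterate_succ_apply', Function.iterate_succ_apply', ih, avgT_smul]

lemma avgT_trans (T : Finset G) (B : Finset G) (f : G → ℝ) :
    avgT T (fun x => (∑ b ∈ B, f (x + b)) / B.card) =
      fun x => (∑ b ∈ B, avgT T f (x + b)) / B.card := by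
  ext x
  simp only [avgT, ← Finset.sum_div]
  rw [div_right_comm]
  congr 2
  rw [Finset.sum_comm (s := B)]
  refine Finset.sum_congr rfl fun t _ => ?_
  rw [Finset.sum_comm]
  refine Finset.sum_congr rfl fun t' _ => ?_
  refine Finset.sum_congr rfl fun b _ => ?_
  congr 1; abel

lemma avgT_iter_trans (T : Finset G) (B : Finset G) (k : ℕ) (f : G → ℝ) :
    (avgT T)^[k] (fun x => (∑ b ∈ B, f (x + b)) / B.card) =
      fun x => (∑ b ∈ B, (avgT T)^[k] f (x + b)) / B.card := by
  induction k with
  | zero => rfl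
  | succ k ih =>
    rw [Function.iterate_succ_apply', ih, avgT_trans]
    simp only [Function.iterate_succ_apply']

lemma avgT_le {T : Finset G} (hT : T.Nonempty) {f : G → ℝ} {K : ℝ} (h : ∀ x, f x ≤ K) (x : G) :
    avgT T f x ≤ K := by
  have ht : (0:ℝ) < T.card := by exact_mod_cast hT.card_pos
  unfold avgT
  rw [div_le_iff₀ (by positivity)]
  calc ∑ t ∈ T, ∑ t' ∈ T, f (x + (t - t')) ≤ ∑ t ∈ T, ∑ t' ∈ T, K :=
        Finset.sum_le_sum fun _ _ => Finset.sum_le_sum fun _ _ => h _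
    _ = _ := by simp; ring

lemma conv_avgT_comm (T V : Finset G) (f : G → ℝ) :
    conv (avgT T f) (mu V) = avgT T (conv f (mu V)) := by
  ext x
  rw [conv_mu]
  simp only [avgT, conv_mu, ← Finset.sum_div]
  rw [div_right_comm]
  congr 2
  rw [Finset.sum_comm]
  refine Finset.sum_congr rfl fun t _ => ?_
  rw [Finset.sum_comm]
  refine Finset.sum_congr rfl fun t' _ => ?_
  refine Finset.sum_congr rfl fun b _ => ?_
  congr 1; abel

lemma conv_avgT_iter_le {T : Finset G} (hT : T.Nonempty) (V : Finset G) (k : ℕ) {f : G → ℝ} {K : ℝ}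
    (h : ∀ x, conv f (mu V) x ≤ K) (x : G) : conv ((avgT T)^[k] f) (mu V) x ≤ K := by
  induction k generalizing x with
  | zero => exact h x
  | succ k ih =>
    rw [Function.iterate_succ_apply', conv_avgT_comm]
    exact avgT_le hT ih x

lemma Fcor_conv_le {A : Finset G} (hA : A.Nonempty) (V : Finset G) {K : ℝ}
    (h : ∀ x, conv (indic A) (mu V) x ≤ K * ((A.card : ℝ) / Fintype.card G)) (x : G) :
    conv (Fcor A) (mu V) x ≤ K := by
  have hN := (km_card_pos (G := G))
  have ha : (0:ℝ) < A.card := by exact_mod_cast hA.card_pos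
  rw [conv_mu]
  have hmu : ∀ y, mu A y = (Fintype.card G : ℝ) / A.card * indic A y := by
    intro y; simp only [mu, indic]; split_ifs <;> simp
  have e : (∑ v ∈ V, Fcor A (x - v)) / V.card =
      (∑ y, mu A y * ((Fintype.card G : ℝ) / A.card * conv (indic A) (mu V) (y + x))) /
        Fintype.card G := by
    simp only [Fcor, conv_mu, ← Finset.sum_div]
    rw [div_right_comm]
    congr 1
    rw [Finset.sum_comm, Finset.sum_div]
    refine Finset.sum_congr rfl fun y _ => ?_
    rw [← Finset.mul_sum, mul_div_assoc]
    congr 1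
    rw [mul_div_assoc', Finset.mul_sum]
    congr 1
    refine Finset.sum_congr rfl fun v _ => ?_
    rw [hmu, add_sub_assoc]
  rw [e, div_le_iff₀ hN]
  calc _ ≤ ∑ y, mu A y * ((Fintype.card G : ℝ) / A.card * (K * ((A.card : ℝ) / Fintype.card G))) := by
        refine Finset.sum_le_sum fun y _ => ?_
        have : 0 ≤ mu A y := by unfold mu; positivity
        have := h (y + x)
        gcongr
    _ = _ := by
        rw [← Finset.sum_mul, sum_mu_s8 hA]; field_simp

/-- Normalised square of the Fourier transform of a set. -/
def wt (T : Finset G) (ψ : AddChar G ℂ) : ℝ := ‖∑ t ∈ T, ψ t‖ ^ 2 / (T.card : ℝ) ^ 2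

lemma wt_nonneg (T : Finset G) (ψ : AddChar G ℂ) : 0 ≤ wt T ψ := by unfold wt; positivity

lemma wt_eq (T : Finset G) (ψ : AddChar G ℂ) :
    ((wt T ψ : ℝ) : ℂ) = (∑ t ∈ T, ∑ t' ∈ T, ψ (t - t')) / (T.card : ℂ) ^ 2 := by
  unfold wt
  push_cast
  rw [← Complex.ofReal_pow, ← Complex.normSq_eq_norm_sq, ← Complex.mul_conj, map_sum,
    Finset.sum_mul_sum]
  congr 1
  refine Finset.sum_congr rfl fun t _ => Finset.sum_congr rfl fun t' _ => ?_
  rw [sub_eq_add_neg, AddChar.map_add_eq_mul, AddChar.map_neg_eq_conj]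

lemma Fcor_fourier {A : Finset G} (hA : A.Nonempty) (x : G) :
    (Fcor A x : ℂ) = ∑ ψ : AddChar G ℂ, (wt A ψ : ℂ) * ψ x := by
  have hN := (km_card_pos (G := G))
  have hN' : (Fintype.card G : ℂ) ≠ 0 := by exact_mod_cast hN.ne'
  have ha : (A.card : ℂ) ≠ 0 := by exact_mod_cast hA.card_pos.ne'
  simp only [wt_eq, div_mul_eq_mul_div, ← Finset.sum_div, Finset.sum_mul]
  rw [Finset.sum_comm]
  have h1 : ∀ t ∈ A, ∑ ψ : AddChar G ℂ, ∑ t' ∈ A, ψ (t - t') * ψ x =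
      if t + x ∈ A then (Fintype.card G : ℂ) else 0 := by
    intro t _
    rw [Finset.sum_comm]
    have : ∀ t' ∈ A, ∑ ψ : AddChar G ℂ, ψ (t - t') * ψ x =
        if t + x = t' then (Fintype.card G : ℂ) else 0 := by
      intro t' _
      simp only [← AddChar.map_add_eq_mul]
      rw [AddChar.sum_apply_eq_ite]
      have : t - t' + x = 0 ↔ t + x = t' := by
        rw [sub_add_eq_add_sub, sub_eq_zero]
      simp only [this]
    rw [Finset.sum_congr rfl this, Finset.sum_ite_eq]
  rw [Finset.sum_congr rfl h1]
  have h2 : ∑ y, mu A y * mu A (y + x) = ∑ y ∈ A, (if y + x ∈ A then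
      ((Fintype.card G : ℝ) / A.card) ^ 2 else 0) := by
    rw [← Finset.univ_inter A, ← Finset.sum_ite_mem, Finset.univ_inter]
    refine Finset.sum_congr rfl fun y _ => ?_
    simp only [mu]
    split_ifs <;> ring
  rw [Fcor, h2]
  push_cast
  rw [Finset.sum_div, Finset.sum_div]
  refine Finset.sum_congr rfl fun y _ => ?_
  split_ifs
  · push_cast; field_simp
  · simp

lemma avgT_fourier (T : Finset G) (f : G → ℝ) (c : AddChar G ℂ → ℂ)
    (h : ∀ x, (f x : ℂ) = ∑ ψ : AddChar G ℂ, c ψ * ψ x) (x : G) :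
    (avgT T f x : ℂ) = ∑ ψ : AddChar G ℂ, (c ψ * wt T ψ) * ψ x := by
  simp only [avgT, wt_eq]
  push_cast
  simp only [h]
  simp only [mul_div_assoc', div_mul_eq_mul_div, ← Finset.sum_div]
  congr 1
  rw [Finset.sum_congr rfl (fun t _ => Finset.sum_comm), Finset.sum_comm]
  refine Finset.sum_congr rfl fun ψ _ => ?_
  rw [Finset.mul_sum, Finset.sum_mul]
  refine Finset.sum_congr rfl fun t _ => ?_
  rw [Finset.mul_sum, Finset.sum_mul]
  refine Finset.sum_congr rfl fun t' _ => ?_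
  rw [AddChar.map_add_eq_mul]; ring

lemma avgT_iter_fourier {A : Finset G} (hA : A.Nonempty) (T : Finset G) (k : ℕ) (x : G) :
    (((avgT T)^[k] (Fcor A) x : ℝ) : ℂ) =
      ∑ ψ : AddChar G ℂ, ((wt A ψ : ℂ) * (wt T ψ : ℂ) ^ k) * ψ x := by
  induction k generalizing x with
  | zero => simpa using Fcor_fourier hA x
  | succ k ih =>
    rw [Function.iterate_succ_apply', avgT_fourier T _ _ ih]
    refine Finset.sum_congr rfl fun ψ _ => ?_
    ring

lemma Fcor_zero {A : Finset G} (hA : A.Nonempty) :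
    Fcor A 0 = (Fintype.card G : ℝ) / A.card := by
  have hN := (km_card_pos (G := G))
  have ha : (A.card : ℝ) ≠ 0 := by exact_mod_cast hA.card_pos.ne'
  have : ∀ y, mu A y * mu A (y + 0) = (Fintype.card G : ℝ) / A.card * mu A y := by
    intro y; rw [add_zero]; unfold mu; split_ifs <;> ring
  rw [Fcor]
  simp only [this]
  rw [← Finset.mul_sum, sum_mu_s8 hA]
  field_simp

lemma sum_wt {A : Finset G} (hA : A.Nonempty) :
    ∑ ψ : AddChar G ℂ, wt A ψ = (Fintype.card G : ℝ) / A.card := by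
  rw [← Fcor_zero hA]
  have := Fcor_fourier hA 0
  simp only [AddChar.map_zero_eq_one, mul_one] at this
  exact_mod_cast this.symm

lemma km_fourier_compare {A T V : Finset G} (hA : A.Nonempty) (hT : T.Nonempty) (hV : V.Nonempty)
    (hspec : ∀ ψ : AddChar G ℂ, (T.card : ℝ) / 2 ≤ ‖∑ t ∈ T, ψ t‖ → ∀ x ∈ V, ψ x = 1)
    (k : ℕ) (x : G) :
    (avgT T)^[k] (Fcor A) x ≤ conv ((avgT T)^[k] (Fcor A)) (mu V) x +
      2 * (1 / 4) ^ k * ((Fintype.card G : ℝ) / A.card) := by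
  have ht : (0:ℝ) < T.card := by exact_mod_cast hT.card_pos
  have hv : (0:ℝ) < V.card := by exact_mod_cast hV.card_pos
  have hv' : (V.card : ℂ) ≠ 0 := by exact_mod_cast hv.ne'
  have key : (((avgT T)^[k] (Fcor A) x - conv ((avgT T)^[k] (Fcor A)) (mu V) x : ℝ) : ℂ) =
      ∑ ψ : AddChar G ℂ, ((wt A ψ : ℂ) * (wt T ψ : ℂ) ^ k) * (ψ x *
        (1 - (∑ v ∈ V, ψ (-v)) / V.card)) := by
    rw [conv_mu]
    push_cast
    simp only [avgT_iter_fourier hA]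
    simp only [mul_sub, mul_one, Finset.sum_sub_distrib]
    congr 1
    rw [Finset.sum_comm, Finset.sum_div]
    refine Finset.sum_congr rfl fun ψ _ => ?_
    rw [mul_div_assoc', mul_div_assoc', Finset.mul_sum, Finset.mul_sum]
    congr 1
    refine Finset.sum_congr rfl fun v _ => ?_
    rw [sub_eq_add_neg, AddChar.map_add_eq_mul]
  have hterm : ∀ ψ : AddChar G ℂ, ‖((wt A ψ : ℂ) * (wt T ψ : ℂ) ^ k) * (ψ x *
        (1 - (∑ v ∈ V, ψ (-v)) / V.card))‖ ≤ wt A ψ * (2 * (1 / 4) ^ k) := by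
    intro ψ
    by_cases hψ : (T.card : ℝ) / 2 ≤ ‖∑ t ∈ T, ψ t‖
    · have : ∑ v ∈ V, ψ (-v) = V.card := by
        rw [Finset.sum_congr rfl (fun v hv => by
          rw [AddChar.map_neg_eq_conj, hspec ψ hψ v hv, map_one])]
        simp
      rw [this, div_self hv']
      simp only [sub_self, mul_zero, norm_zero]
      have := wt_nonneg A ψ
      positivity
    · push Not at hψ
      have h1 : wt T ψ ≤ 1 / 4 := by
        unfold wt
        rw [div_le_iff₀ (by positivity)]
        nlinarith [norm_nonneg (∑ t ∈ T, ψ t)]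
      have h2 : ‖(1:ℂ) - (∑ v ∈ V, ψ (-v)) / V.card‖ ≤ 2 := by
        refine (norm_sub_le _ _).trans ?_
        have : ‖(∑ v ∈ V, ψ (-v)) / (V.card : ℂ)‖ ≤ 1 := by
          rw [norm_div, Complex.norm_natCast, div_le_one hv]
          refine (norm_sum_le _ _).trans ?_
          simp
        rw [norm_one]; linarith
      rw [norm_mul, norm_mul, norm_mul, norm_pow, AddChar.norm_apply, one_mul,
        Complex.norm_real, Complex.norm_real, Real.norm_of_nonneg (wt_nonneg _ _),
        Real.norm_of_nonneg (wt_nonneg _ _)]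
      have h3 := pow_le_pow_left₀ (wt_nonneg T ψ) h1 k
      have h4 := wt_nonneg A ψ
      calc wt A ψ * wt T ψ ^ k * ‖(1:ℂ) - (∑ v ∈ V, ψ (-v)) / V.card‖
          ≤ wt A ψ * (1 / 4) ^ k * 2 := by gcongr
        _ = _ := by ring
  have hfin : |(avgT T)^[k] (Fcor A) x - conv ((avgT T)^[k] (Fcor A)) (mu V) x| ≤
      2 * (1 / 4) ^ k * ((Fintype.card G : ℝ) / A.card) := by
    rw [← Real.norm_eq_abs, ← Complex.norm_real, key]
    refine (norm_sum_le _ _).trans ((Finset.sum_le_sum fun ψ _ => hterm ψ).trans ?_)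
    rw [← Finset.sum_mul, sum_wt hA, mul_comm]
  linarith [le_abs_self ((avgT T)^[k] (Fcor A) x - conv ((avgT T)^[k] (Fcor A)) (mu V) x)]

end Fourier
section Combine
set_option linter.unusedSectionVars false

lemma km_iter_close {G : Type*} [AddCommGroup G] [Fintype G] [DecidableEq G]
    {B T : Finset G} (hT : T.Nonempty) (g : G → ℝ) {c : ℝ}
    (hper : ∀ t ∈ T, ∀ t' ∈ T, ∀ y, ∑ b ∈ B, |g (y - b + (t - t')) - g (y - b)| ≤ c) (k : ℕ) :
    ∀ y, ∑ b ∈ B, |(avgT T)^[k] g (y - b) - g (y - b)| ≤ k * c := by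
  have ht : (0:ℝ) < T.card := by exact_mod_cast hT.card_pos
  -- averaging preserves the local norm
  have havg : ∀ (F1 F2 : G → ℝ) (y : G) (c' : ℝ),
      (∀ t ∈ T, ∀ t' ∈ T, ∑ b ∈ B, |F1 (y - b + (t - t')) - F2 (y - b + (t - t'))| ≤ c') →
      ∑ b ∈ B, |avgT T F1 (y - b) - avgT T F2 (y - b)| ≤ c' := by
    intro F1 F2 y c' h
    have h1 : ∀ b ∈ B, |avgT T F1 (y - b) - avgT T F2 (y - b)| ≤
        (∑ t ∈ T, ∑ t' ∈ T, |F1 (y - b + (t - t')) - F2 (y - b + (t - t'))|) /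
          (T.card : ℝ) ^ 2 := by
      intro b _
      simp only [avgT]
      rw [← sub_div, abs_div, abs_of_pos (show 0 < (T.card : ℝ) ^ 2 by positivity),
        ← Finset.sum_sub_distrib]
      refine div_le_div_of_nonneg_right ?_ (by positivity)
      refine (Finset.abs_sum_le_sum_abs _ _).trans (Finset.sum_le_sum fun t _ => ?_)
      rw [← Finset.sum_sub_distrib]
      exact Finset.abs_sum_le_sum_abs _ _
    refine (Finset.sum_le_sum h1).trans ?_
    rw [← Finset.sum_div, div_le_iff₀ (by positivity), Finset.sum_comm]
    rw [Finset.sum_congr rfl (fun t _ => Finset.sum_comm)]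
    calc _ ≤ ∑ t ∈ T, ∑ t' ∈ T, c' :=
          Finset.sum_le_sum fun t ht => Finset.sum_le_sum fun t' ht' => h t ht t' ht'
      _ = _ := by simp; ring
  have hconst : ∀ y, avgT T (fun _ => g y) y = g y := by
    intro y
    simp only [avgT, Finset.sum_const, nsmul_eq_mul]
    field_simp
  have hone : ∀ y, ∑ b ∈ B, |avgT T g (y - b) - g (y - b)| ≤ c := by
    intro y
    have h1 : ∀ b ∈ B, |avgT T g (y - b) - g (y - b)| ≤
        (∑ t ∈ T, ∑ t' ∈ T, |g (y - b + (t - t')) - g (y - b)|) / (T.card : ℝ) ^ 2 := by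
      intro b _
      have : g (y - b) = (∑ t ∈ T, ∑ t' ∈ T, g (y - b)) / (T.card : ℝ) ^ 2 := by
        simp only [Finset.sum_const, nsmul_eq_mul]
        field_simp
      conv_lhs => rw [this]
      simp only [avgT]
      rw [← sub_div, abs_div, abs_of_pos (show 0 < (T.card : ℝ) ^ 2 by positivity),
        ← Finset.sum_sub_distrib]
      refine div_le_div_of_nonneg_right ?_ (by positivity)
      refine (Finset.abs_sum_le_sum_abs _ _).trans (Finset.sum_le_sum fun t _ => ?_)
      rw [← Finset.sum_sub_distrib]
      exact Finset.abs_sum_le_sum_abs _ _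
    refine (Finset.sum_le_sum h1).trans ?_
    rw [← Finset.sum_div, div_le_iff₀ (by positivity), Finset.sum_comm]
    rw [Finset.sum_congr rfl (fun t _ => Finset.sum_comm)]
    calc _ ≤ ∑ t ∈ T, ∑ t' ∈ T, c :=
          Finset.sum_le_sum fun t ht => Finset.sum_le_sum fun t' ht' => hper t ht t' ht' y
      _ = _ := by simp; ring
  induction k with
  | zero => intro y; simp
  | succ k ih =>
    intro y
    rw [Function.iterate_succ_apply']
    have h1 : ∑ b ∈ B, |avgT T ((avgT T)^[k] g) (y - b) - avgT T g (y - b)| ≤ k * c := by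
      refine havg _ _ y _ fun t _ t' _ => ?_
      have := ih (y + (t - t'))
      have e : ∀ b, y + (t - t') - b = y - b + (t - t') := fun b => by abel
      simpa only [e] using this
    have h2 := hone y
    calc _ ≤ ∑ b ∈ B, (|avgT T ((avgT T)^[k] g) (y - b) - avgT T g (y - b)| +
          |avgT T g (y - b) - g (y - b)|) := Finset.sum_le_sum fun b _ => abs_sub_le _ _ _
      _ ≤ _ := by
          rw [Finset.sum_add_distrib]; push_cast; linarith

lemma km_combine {G : Type*} [AddCommGroup G] [Fintype G] [DecidableEq G]
    {A B S T V : Finset G} (hA : A.Nonempty) (hB : B.Nonempty) (hT : T.Nonempty)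
    (hV : V.Nonempty)
    (hspec : ∀ ψ : AddChar G ℂ, (T.card : ℝ) / 2 ≤ ‖∑ t ∈ T, ψ t‖ → ∀ x ∈ V, ψ x = 1)
    {ε δ c K : ℝ} (hε : 0 < ε) (hS : ∀ x ∈ S, 1 + ε / 2 ≤ Fcor A x)
    (hBS : (((B ×ˢ B).filter (fun p => p.2 - p.1 ∉ S)).card : ℝ) ≤ δ * (B.card : ℝ) ^ 2)
    (g : G → ℝ) (hg : ∀ x, g x = (∑ b ∈ B, indic S (x + b)) / B.card)
    (hper : ∀ t ∈ T, ∀ t' ∈ T, ∀ y, ∑ b ∈ B, |g (y - b + (t - t')) - g (y - b)| ≤ c * B.card)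
    (hK : ∀ x, conv (indic A) (mu V) x ≤ K * ((A.card : ℝ) / Fintype.card G)) (k : ℕ) :
    (1 + ε / 2) * (1 - δ - k * c) ≤ K + 2 * (1 / 4) ^ k * ((Fintype.card G : ℝ) / A.card) := by
  have hN := (km_card_pos (G := G))
  have hb : (0:ℝ) < B.card := by exact_mod_cast hB.card_pos
  set R := K + 2 * (1 / 4) ^ k * ((Fintype.card G : ℝ) / A.card) with hR
  have h1 : ∀ x, (avgT T)^[k] (Fcor A) x ≤ R := fun x =>
    (km_fourier_compare hA hT hV hspec k x).trans
      (by have := conv_avgT_iter_le hT V k (Fcor_conv_le hA V hK) x; linarith)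
  have h2 : ∀ x, (1 + ε / 2) * (avgT T)^[k] (indic S) x ≤ R := by
    intro x
    have e := congrFun (avgT_iter_smul T k (1 + ε / 2) (indic S)) x
    rw [← e]
    refine (avgT_iter_mono T k ?_ x).trans (h1 x)
    intro y
    unfold indic
    split_ifs with hy
    · simpa using hS y hy
    · rw [mul_zero]
      refine div_nonneg (Finset.sum_nonneg fun z _ => ?_) hN.le
      unfold mu
      positivity
  have hg' : g = fun x => (∑ b ∈ B, indic S (x + b)) / B.card := funext hg
  have h3 : ∀ x, (1 + ε / 2) * (avgT T)^[k] g x ≤ R := by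
    intro x
    rw [hg', avgT_iter_trans]
    simp only
    rw [mul_div_assoc', div_le_iff₀ hb, Finset.mul_sum]
    calc _ ≤ ∑ b ∈ B, R := Finset.sum_le_sum fun b _ => h2 _
      _ = _ := by simp; ring
  have h4 := km_iter_close hT g hper k 0
  have h5 : (1 - δ) * B.card ≤ ∑ b ∈ B, g (0 - b) := by
    have e1 : ∑ b ∈ B, g (0 - b) =
        (∑ p ∈ B ×ˢ B, (if p.2 - p.1 ∈ S then (1:ℝ) else 0)) / B.card := by
      rw [Finset.sum_product, Finset.sum_div]
      refine Finset.sum_congr rfl fun b _ => ?_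
      rw [hg]
      congr 1
      refine Finset.sum_congr rfl fun b' _ => ?_
      simp only [indic, zero_sub, neg_add_eq_sub]
    have e2 := Finset.card_filter_add_card_filter_not (s := B ×ˢ B) (fun p => p.2 - p.1 ∈ S)
    have e3 : (((B ×ˢ B).filter (fun p => p.2 - p.1 ∈ S)).card : ℝ) +
        (((B ×ˢ B).filter (fun p => p.2 - p.1 ∉ S)).card : ℝ) = (B.card : ℝ) ^ 2 := by
      rw [sq, ← Nat.cast_mul, ← Finset.card_product]; exact_mod_cast e2
    have e4 : (((B ×ˢ B).filter (fun p => p.2 - p.1 ∈ S)).card : ℝ) =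
        ∑ p ∈ B ×ˢ B, (if p.2 - p.1 ∈ S then (1:ℝ) else 0) := by
      rw [Finset.card_filter]; push_cast; rfl
    rw [e1, ← e4, le_div_iff₀ hb]
    nlinarith
  have h6 : ∑ b ∈ B, g (0 - b) - k * (c * B.card) ≤ ∑ b ∈ B, (avgT T)^[k] g (0 - b) := by
    have : ∑ b ∈ B, (g (0 - b) - (avgT T)^[k] g (0 - b)) ≤
        ∑ b ∈ B, |(avgT T)^[k] g (0 - b) - g (0 - b)| :=
      Finset.sum_le_sum fun b _ => by rw [abs_sub_comm]; exact le_abs_self _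
    rw [Finset.sum_sub_distrib] at this
    linarith
  have h7 : (1 + ε / 2) * ∑ b ∈ B, (avgT T)^[k] g (0 - b) ≤ R * B.card := by
    rw [Finset.mul_sum]
    calc _ ≤ ∑ b ∈ B, R := Finset.sum_le_sum fun b _ => h3 _
      _ = _ := by simp; ring
  refine le_of_mul_le_mul_right (le_trans ?_ h7) hb
  rw [mul_assoc]
  refine mul_le_mul_of_nonneg_left ?_ (by linarith)
  linarith

lemma km_param (r s : ℝ) (hr : 0 < r) (hs : 0 ≤ s) :
    ∃ C : ℝ, 0 < C ∧ ∀ c : ℝ, 1 / 2 ≤ c → ∃ m : ℕ, 1 ≤ m ∧ c + s ≤ m * r ∧ m ≤ C * c := by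
  refine ⟨1 / r + 2 * s / r + 4, by positivity, ?_⟩
  intro c hc
  refine ⟨⌈(c + s) / r⌉₊ + 1, by omega, ?_, ?_⟩
  · have := Nat.le_ceil ((c + s) / r)
    rw [div_le_iff₀ hr] at this
    push_cast
    nlinarith
  · have h0 : 0 ≤ (c + s) / r := by positivity
    have := (Nat.ceil_lt_add_one h0).le
    push_cast
    have e : (1 / r + 2 * s / r + 4) * c = (c + s) / r + (2 * c - 1) * (s / r) + 4 * c := by ring
    rw [e]
    have : 0 ≤ (2 * c - 1) * (s / r) := mul_nonneg (by linarith) (by positivity)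
    linarith

lemma lo_ge {a : ℝ} (h0 : 0 < a) (h1 : a ≤ 1) : 1 / 2 ≤ lo a := by
  unfold lo
  have : Real.log 2 ≤ Real.log (2 / a) := by
    apply Real.log_le_log (by norm_num)
    rw [le_div_iff₀ h0]; linarith
  linarith [Real.log_two_gt_d9]

lemma exp_lo {a : ℝ} (h0 : 0 < a) : Real.exp (lo a) = 2 / a := by
  unfold lo; rw [Real.exp_log (by positivity)]

end Combine

theorem km_num_step {δ β ℓ : ℝ} {k : ℕ} (hδ : 0 < δ) (hβ : 0 < β) (hk : 1 ≤ k)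
    (hℓ0 : 0 ≤ ℓ) (hℓ : Real.exp (-ℓ) ≤ β) :
    ∃ M : ℕ, 0 < M ∧ (M : ℝ) ≤ 32 * k ^ 2 / δ ^ 2 * (ℓ + 16 * k / δ) + 1 ∧
      k * (2 * (δ / (4 * k)) + 8 * Real.exp (-(M * (δ / (4 * k)) ^ 2 / 2)) / β) ≤ δ := by
  have hk0 : (0:ℝ) < k := by exact_mod_cast hk
  have hX : 0 < 32 * (k:ℝ) ^ 2 / δ ^ 2 * (ℓ + 16 * k / δ) := by positivity
  refine ⟨⌈32 * (k:ℝ) ^ 2 / δ ^ 2 * (ℓ + 16 * k / δ)⌉₊, Nat.ceil_pos.2 hX,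
    (Nat.ceil_lt_add_one hX.le).le, ?_⟩
  set M := ⌈32 * (k:ℝ) ^ 2 / δ ^ 2 * (ℓ + 16 * k / δ)⌉₊
  have hM : 32 * (k:ℝ) ^ 2 / δ ^ 2 * (ℓ + 16 * k / δ) ≤ M := Nat.le_ceil _
  have h1 : ℓ + 16 * k / δ ≤ M * (δ / (4 * k)) ^ 2 / 2 := by
    have : ℓ + 16 * k / δ
        = (32 * (k:ℝ) ^ 2 / δ ^ 2 * (ℓ + 16 * k / δ)) * (δ / (4 * k)) ^ 2 / 2 := by
      field_simp
      ring
    rw [this]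
    gcongr
  have h2 : Real.exp (-(M * (δ / (4 * k)) ^ 2 / 2)) ≤ β * (δ / (16 * k)) := by
    calc Real.exp (-(M * (δ / (4 * k)) ^ 2 / 2)) ≤ Real.exp (-ℓ + -(16 * k / δ)) := by
          apply Real.exp_le_exp.2; linarith
      _ = Real.exp (-ℓ) * Real.exp (-(16 * k / δ)) := Real.exp_add _ _
      _ ≤ β * (δ / (16 * k)) := by
          have h3 : Real.exp (-(16 * k / δ)) ≤ δ / (16 * k) := by
            rw [Real.exp_neg, ← inv_div (16 * (k:ℝ)) δ]
            apply inv_anti₀ (by positivity)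
            have := Real.add_one_le_exp (16 * k / δ)
            linarith
          gcongr
  have h4 : 8 * Real.exp (-(M * (δ / (4 * k)) ^ 2 / 2)) / β ≤ δ / (2 * k) := by
    rw [div_le_iff₀ hβ]
    calc _ ≤ 8 * (β * (δ / (16 * k))) := by gcongr
      _ = δ / (2 * k) * β := by field_simp; norm_num
  calc k * (2 * (δ / (4 * k)) + 8 * Real.exp (-(M * (δ / (4 * k)) ^ 2 / 2)) / β)
      ≤ k * (2 * (δ / (4 * k)) + δ / (2 * k)) := by gcongr
    _ = δ := by field_simp; norm_num

theorem km_num_bound {δ C1 C2 a c m k M : ℝ} (hδ : 0 < δ) (hC1 : 0 < C1) (hC2 : 0 < C2)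
    (ha : 1 / 2 ≤ a) (hc : 1 / 2 ≤ c) (hm0 : 0 ≤ m) (hm : m ≤ C1 * c) (hk0 : 0 ≤ k)
    (hk : k ≤ C2 * a) (hM0 : 0 ≤ M)
    (hM : M ≤ 32 * k ^ 2 / δ ^ 2 * (m * a + 16 * k / δ) + 1) :
    8 * (1 + M * (m * a)) ≤
      8 * ((32 * C2 ^ 2 / δ ^ 2 * (C1 + 32 * C2 / δ) + 16) * C1 + 64) * a ^ 4 * c ^ 2 := by
  have ha0 : 0 < a := by linarith
  have hc0 : 0 < c := by linarith
  have h1c : 1 ≤ 2 * c := by linarith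
  have h1a : 1 ≤ 2 * a := by linarith
  have hma : m * a ≤ C1 * c * a := by gcongr
  have h1 : m * a + 16 * k / δ ≤ (C1 + 32 * C2 / δ) * (a * c) := by
    calc m * a + 16 * k / δ ≤ C1 * c * a + 16 * (C2 * a) / δ * (2 * c) := by
          have : 16 * k / δ ≤ 16 * (C2 * a) / δ * (2 * c) := by
            calc 16 * k / δ ≤ 16 * (C2 * a) / δ * 1 := by rw [mul_one]; gcongr
              _ ≤ _ := by gcongr
          linarith
      _ = _ := by ring
  have h16 : 1 ≤ 16 * (a ^ 3 * c) := by
    calc (1:ℝ) = 1 ^ 3 * 1 := by norm_num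
      _ ≤ (2 * a) ^ 3 * (2 * c) := by gcongr
      _ = _ := by ring
  have h64 : 1 ≤ 64 * (a ^ 4 * c ^ 2) := by
    calc (1:ℝ) = 1 ^ 4 * 1 ^ 2 := by norm_num
      _ ≤ (2 * a) ^ 4 * (2 * c) ^ 2 := by gcongr
      _ = _ := by ring
  have h2 : M ≤ (32 * C2 ^ 2 / δ ^ 2 * (C1 + 32 * C2 / δ) + 16) * (a ^ 3 * c) := by
    calc M ≤ 32 * k ^ 2 / δ ^ 2 * (m * a + 16 * k / δ) + 1 := hM
      _ ≤ 32 * (C2 * a) ^ 2 / δ ^ 2 * ((C1 + 32 * C2 / δ) * (a * c)) + 16 * (a ^ 3 * c) := by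
          gcongr
      _ = _ := by ring
  have h3 : M * (m * a) ≤
      (32 * C2 ^ 2 / δ ^ 2 * (C1 + 32 * C2 / δ) + 16) * (a ^ 3 * c) * (C1 * c * a) := by
    gcongr
  calc 8 * (1 + M * (m * a)) ≤ 8 * (64 * (a ^ 4 * c ^ 2) +
      (32 * C2 ^ 2 / δ ^ 2 * (C1 + 32 * C2 / δ) + 16) * (a ^ 3 * c) * (C1 * c * a)) := by gcongr
    _ = _ := by ring

/-- choice of the moment parameter -/
theorem km_num_m {ε δ γ : ℝ} {m : ℕ} (hε : 0 < ε) (hδ : 0 < δ) (hγ : 0 < γ)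
    (h : lo γ + Real.log (2 / δ) ≤ m * Real.log ((1 + ε) / (1 + ε / 2))) :
    (1 + ε / 2) ^ m ≤ δ / 2 * (γ / 2 * (1 + ε) ^ m) := by
  have h1 := Real.exp_le_exp.2 h
  rw [Real.exp_add, exp_lo hγ, Real.exp_log (by positivity), Real.exp_nat_mul,
    Real.exp_log (by positivity), div_pow, le_div_iff₀ (by positivity)] at h1
  have h2 : δ * γ / 4 * (2 / γ * (2 / δ) * (1 + ε / 2) ^ m) ≤ δ * γ / 4 * (1 + ε) ^ m := by
    gcongr
  have h3 : δ * γ / 4 * (2 / γ * (2 / δ) * (1 + ε / 2) ^ m) = (1 + ε / 2) ^ m := by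
    field_simp
    norm_num
  rw [h3] at h2
  linarith

theorem km_num_k {δ α : ℝ} {k : ℕ} (hδ : 0 < δ) (hα : 0 < α)
    (h : lo α + Real.log (1 / δ) ≤ k * Real.log 4) :
    2 * (1 / 4) ^ k * (1 / α) ≤ δ := by
  have h1 := Real.exp_le_exp.2 h
  rw [Real.exp_add, exp_lo hα, Real.exp_log (by positivity), Real.exp_nat_mul,
    Real.exp_log (by positivity)] at h1
  rw [one_div_pow]
  have h2 : 2 * (1 / (4:ℝ) ^ k) * (1 / α) = δ * (2 / α * (1 / δ)) / 4 ^ k := by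
    field_simp
  rw [h2, div_le_iff₀ (by positivity)]
  gcongr

set_option maxHeartbeats 1600000 in
theorem km_general {ε : ℝ} (hε : 0 < ε) (hε1 : ε < 1) : ∃ C : ℝ, 0 < C ∧
    ∀ (G : Type) [AddCommGroup G] [Fintype G] [DecidableEq G] (A C' : Finset G),
      A.Nonempty → C'.Nonempty → ε < |nip (conv (mu A) (mu A)) (mu C') - 1| →
      ∃ D : Finset (AddChar G ℂ),
        (D.card : ℝ) ≤ C * lo ((A.card : ℝ) / Fintype.card G) ^ 4
          * lo ((C'.card : ℝ) / Fintype.card G) ^ 2 ∧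
        ∀ V : Finset G, V.Nonempty → (∀ x ∈ V, ∀ χ ∈ D, χ x = 1) →
          ∃ x, (1 + ε / 64) * ((A.card : ℝ) / Fintype.card G) ≤ conv (indic A) (mu V) x := by
  obtain ⟨δ, hδe⟩ : ∃ δ, δ = ε / 32 := ⟨_, rfl⟩
  have hδ : 0 < δ := by rw [hδe]; positivity
  have hδ1 : δ ≤ 1 := by linarith
  obtain ⟨C1, hC1, H1⟩ := km_param (Real.log ((1 + ε) / (1 + ε / 2))) (Real.log (2 / δ))
    (Real.log_pos (by rw [one_lt_div (by positivity)]; linarith))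
    (Real.log_nonneg (by rw [one_le_div hδ]; linarith))
  obtain ⟨C2, hC2, H2⟩ := km_param (Real.log 4) (Real.log (1 / δ))
    (Real.log_pos (by norm_num)) (Real.log_nonneg (by rw [one_le_div hδ]; linarith))
  refine ⟨8 * ((32 * C2 ^ 2 / δ ^ 2 * (C1 + 32 * C2 / δ) + 16) * C1 + 64), by positivity, ?_⟩
  intro G _ _ _ A C' hA hC hbig
  have hN := (km_card_pos (G := G))
  have hAc : (0:ℝ) < A.card := by exact_mod_cast hA.card_pos
  have hCc : (0:ℝ) < C'.card := by exact_mod_cast hC.card_pos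
  obtain ⟨α, hα⟩ : ∃ α, α = (A.card : ℝ) / Fintype.card G := ⟨_, rfl⟩
  obtain ⟨γ, hγ⟩ : ∃ γ, γ = (C'.card : ℝ) / Fintype.card G := ⟨_, rfl⟩
  have hα0 : 0 < α := by rw [hα]; positivity
  have hγ0 : 0 < γ := by rw [hγ]; positivity
  have hα1 : α ≤ 1 := by
    rw [hα, div_le_one hN]; exact_mod_cast Finset.card_le_univ A
  have hγ1 : γ ≤ 1 := by
    rw [hγ, div_le_one hN]; exact_mod_cast Finset.card_le_univ C'
  have hCN : (C'.card : ℝ) = γ * Fintype.card G := by rw [hγ]; field_simp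
  have ha := lo_ge hα0 hα1
  have hc := lo_ge hγ0 hγ1
  obtain ⟨m, hm1, hm, hmC⟩ := H1 _ hc
  obtain ⟨k, hk1, hk, hkC⟩ := H2 _ ha
  rw [← hα, ← hγ]
  have hmom := km_moment hA hC hε hε1.le hbig m
  have hnm := km_num_m hε hδ hγ0 hm
  have hnk := km_num_k hδ hα0 hk
  have hF0 : ∀ x, 0 ≤ Fcor A x := by
    intro x
    unfold Fcor mu
    refine div_nonneg (Finset.sum_nonneg fun y _ => mul_nonneg ?_ ?_) hN.le <;>
    · split_ifs
      · exact div_nonneg (Nat.cast_nonneg _) (Nat.cast_nonneg _)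
      · exact le_rfl
  set S : Finset G := Finset.univ.filter (fun x => 1 + ε / 2 ≤ Fcor A x) with hS
  have hSmem : ∀ x ∈ S, 1 + ε / 2 ≤ Fcor A x := by
    intro x hx; rw [hS, Finset.mem_filter] at hx; exact hx.2
  have hsum : ∑ x ∈ Sᶜ, Fcor A x ^ m ≤ δ / 2 * ∑ x, Fcor A x ^ m := by
    calc ∑ x ∈ Sᶜ, Fcor A x ^ m ≤ ∑ x ∈ Sᶜ, (1 + ε / 2) ^ m := by
          apply Finset.sum_le_sum
          intro x hx
          have : ¬ (1 + ε / 2 ≤ Fcor A x) := by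
            intro h
            rw [Finset.mem_compl] at hx
            exact hx (by rw [hS, Finset.mem_filter]; exact ⟨Finset.mem_univ _, h⟩)
          exact pow_le_pow_left₀ (hF0 x) (not_le.1 this).le m
      _ = (Sᶜ).card * (1 + ε / 2) ^ m := by rw [Finset.sum_const, nsmul_eq_mul]
      _ ≤ Fintype.card G * (1 + ε / 2) ^ m := by
          gcongr
          exact Finset.card_le_univ _
      _ ≤ Fintype.card G * (δ / 2 * (γ / 2 * (1 + ε) ^ m)) := by gcongr
      _ = δ / 2 * ((C'.card : ℝ) / 2 * (1 + ε) ^ m) := by rw [hCN]; ring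
      _ ≤ _ := by gcongr
  have hsumN : (Fintype.card G : ℝ) ≤ ∑ x, Fcor A x ^ m := by
    refine le_trans ?_ hmom
    have h1 : (1:ℝ) ≤ (1 + ε / 2) ^ m := one_le_pow₀ (by linarith)
    have h2 : (1:ℝ) ≤ γ / 2 * (1 + ε) ^ m := by
      have h0 : 0 ≤ γ / 2 * (1 + ε) ^ m := by positivity
      nlinarith
    rw [hCN]
    calc (Fintype.card G : ℝ) = Fintype.card G * 1 := (mul_one _).symm
      _ ≤ Fintype.card G * (γ / 2 * (1 + ε) ^ m) := by gcongr
      _ = _ := by ring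
  obtain ⟨B, hBc, hBS⟩ := km_sift hA m S hδ hsum
  rw [← hα] at hBc
  have hBc2 : (α ^ m * Fintype.card G / 2) ^ 2 ≤ (B.card : ℝ) ^ 2 := by
    refine le_trans ?_ hBc
    calc (α ^ m * Fintype.card G / 2) ^ 2 
        = α ^ (2 * m) * Fintype.card G / 4 * Fintype.card G := by ring
      _ ≤ α ^ (2 * m) * Fintype.card G / 2 * Fintype.card G := by
          gcongr; norm_num
      _ ≤ _ := by gcongr
  have hBc3 : α ^ m * Fintype.card G / 2 ≤ (B.card : ℝ) :=
    le_of_sq_le_sq hBc2 (Nat.cast_nonneg _)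
  have hBpos : (0:ℝ) < B.card := lt_of_lt_of_le (by positivity) hBc3
  have hB : B.Nonempty := by
    rw [← Finset.card_pos]; exact_mod_cast hBpos
  obtain ⟨β, hβ⟩ : ∃ β, β = (B.card : ℝ) / Fintype.card G := ⟨_, rfl⟩
  have hβ0 : 0 < β := by rw [hβ]; exact div_pos hBpos hN
  have hBN : (B.card : ℝ) = β * Fintype.card G := by rw [hβ, div_mul_cancel₀ _ hN.ne']
  have hℓ : Real.exp (-(m * lo α)) ≤ β := by
    rw [Real.exp_neg, Real.exp_nat_mul, exp_lo hα0, ← inv_pow, inv_div, div_pow]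
    calc α ^ m / 2 ^ m ≤ α ^ m / 2 := by
          gcongr
          exact le_self_pow₀ (by norm_num) (by omega)
      _ ≤ β := by
          rw [hβ, le_div_iff₀ hN]; linarith
  have hℓ0 : 0 ≤ m * lo α := mul_nonneg (Nat.cast_nonneg m) (by linarith)
  obtain ⟨M, hM0, hMle, hMk⟩ := km_num_step hδ hβ0 hk1 hℓ0 hℓ
  have hk0 : (0:ℝ) < k := by exact_mod_cast hk1
  obtain ⟨g, hg⟩ : ∃ g : G → ℝ, ∀ x, g x = (∑ b ∈ B, indic S (x + b)) / B.card :=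
    ⟨_, fun x => rfl⟩
  have hη : 0 < δ / (4 * k) := by positivity
  obtain ⟨T, hTc, hTper⟩ := km_croot_sisask hB (indic S)
    (fun x => by unfold indic; split_ifs <;> norm_num)
    (fun x => by unfold indic; split_ifs <;> norm_num) hη hM0 g hg
  rw [← hβ] at hTc
  have hTpos : (0:ℝ) < T.card := lt_of_lt_of_le (by positivity) hTc
  have hT : T.Nonempty := by
    rw [← Finset.card_pos]; exact_mod_cast hTpos
  obtain ⟨D, hDc, hD⟩ := km_spec hT
  have hlog : Real.log (Fintype.card G / T.card) ≤ 1 + M * (m * lo α) := by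
    rw [Real.log_le_iff_le_exp (div_pos hN hTpos), Real.exp_add, Real.exp_nat_mul,
      div_le_iff₀ hTpos]
    have h2 : (2:ℝ) ≤ Real.exp 1 := by
      have := Real.add_one_le_exp (1:ℝ); linarith
    have h3 : 1 ≤ Real.exp (m * lo α) * β := by
      calc (1:ℝ) = Real.exp (m * lo α) * Real.exp (-(m * lo α)) := by
            rw [← Real.exp_add]; simp
        _ ≤ _ := by gcongr
    calc (Fintype.card G : ℝ) = 2 * 1 ^ M * (1 / 2 * Fintype.card G) := by ring
      _ ≤ Real.exp 1 * (Real.exp (m * lo α) * β) ^ M * (1 / 2 * Fintype.card G) := by gcongr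
      _ = Real.exp 1 * Real.exp (m * lo α) ^ M * (1 / 2 * β ^ M * Fintype.card G) := by
          rw [mul_pow]; ring
      _ ≤ _ := by gcongr
  refine ⟨D, ?_, ?_⟩
  · refine (hDc.trans (by gcongr)).trans
      (km_num_bound hδ hC1 hC2 ha hc (Nat.cast_nonneg m) hmC hk0.le hkC (Nat.cast_nonneg M) hMle)
  intro V hV hVD
  by_contra hcon
  push Not at hcon
  have hcomb := km_combine (ε := ε) (δ := δ)
    (c := 2 * (δ / (4 * k)) + 8 * Real.exp (-(M * (δ / (4 * k)) ^ 2 / 2)) / β)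
    (K := 1 + ε / 64) hA hB hT hV (fun ψ hψ x hx => hD ψ hψ x (hVD x hx)) hε hSmem hBS g hg
    (by
      intro t ht t' ht' y
      refine (hTper t ht t' ht' y).trans (le_of_eq ?_)
      rw [hBN]; field_simp)
    (by intro x; rw [← hα]; exact (hcon x).le) k
  have e1 : (Fintype.card G : ℝ) / A.card = 1 / α := by rw [hα, one_div_div]
  rw [e1] at hcomb
  have h5 : (1 + ε / 2) * (1 - δ - δ) ≤ 1 + ε / 64 + δ := by
    refine le_trans ?_ (hcomb.trans (by linarith))
    gcongr
  rw [hδe] at h5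
  nlinarith

/-- **Proposition 1 (density increment dichotomy in `𝔽_q^n`)**: for every `ε ∈ (0,1)` there is a
constant `C = C(ε) > 0` such that for every prime `q`, `n ≥ 1`, and nonempty `A, C' ⊆ 𝔽_q^n` of
densities `α, γ`, either `|⟨μ_A ∗ μ_A, μ_{C'}⟩ − 1| ≤ ε` or there is a subspace `V` of
codimension at most `C ⌞α⌟⁴ ⌞γ⌟²` with `‖1_A ∗ μ_V‖_∞ ≥ (1 + ε/64) α`. -/
theorem density_increment_dichotomy :
    ∀ ε : ℝ, 0 < ε → ε < 1 →
      ∃ C : ℝ, 0 < C ∧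
        ∀ (q n : ℕ) [Fact q.Prime], 0 < n →
          ∀ (A C' : Finset (Fin n → ZMod q)), A.Nonempty → C'.Nonempty →
            ∀ α γ : ℝ,
              α = (A.card : ℝ) / (q : ℝ) ^ n →
              γ = (C'.card : ℝ) / (q : ℝ) ^ n →
              |nip (conv (mu A) (mu A)) (mu C') - 1| ≤ ε ∨
              ∃ V : Submodule (ZMod q) (Fin n → ZMod q),
                ((n : ℝ) - Module.finrank (ZMod q) V) ≤ C * lo α ^ 4 * lo γ ^ 2 ∧
                ‖conv (indic A) (mu (submoduleFinset V))‖ ≥ (1 + ε / 64) * α := by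
  intro ε hε hε1
  obtain ⟨C, hC, H⟩ := km_general hε hε1
  refine ⟨C, hC, ?_⟩
  intro q n _ hn A C' hA hC' α γ hα hγ
  by_cases hbig : |nip (conv (mu A) (mu A)) (mu C') - 1| ≤ ε
  · exact Or.inl hbig
  right
  obtain ⟨D, hD, hV⟩ := H (Fin n → ZMod q) A C' hA hC' (not_le.1 hbig)
  have hcard : (Fintype.card (Fin n → ZMod q) : ℝ) = (q:ℝ) ^ n := by
    simp [ZMod.card]
  rw [hcard, ← hα, ← hγ] at hD
  rw [hcard, ← hα] at hV
  obtain ⟨V, hVc, hVD⟩ := km_subspace q n D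
  refine ⟨V, hVc.trans hD, ?_⟩
  obtain ⟨x, hx⟩ := hV (submoduleFinset V) ⟨0, by simp [submoduleFinset]⟩
    (fun x hx => hVD x (by simpa [submoduleFinset] using hx))
  exact hx.trans ((Real.le_norm_self _).trans (norm_le_pi_norm _ x))
end
end
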